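/- arXiv:math/0505138 — 2 statements merged into one kernel-verified Lean document; each statement's English description precedes it below -/
import Mathlib

section
/- Let S be a set with 21 elements. Up to the natural action of the symmetric group of S, there are exactly three F₂-linear codes C ⊆ Pow(S) of dimension 9 such that the full word S belongs to C and every word of C has weight in {0, 5, 8, 9, 12, 13, 16, 21}; representatives of the three classes are given (via any bijection S → P²(F₄)) by the codes C_F for: F with no three points collinear, F with exactly one collinear triple of points, and F consisting of four collinear points. -/
/-- An `F`-rational line in the projective plane over `F`: the vanishing set of a nonzero
linear functional. -/
def IsProjLine (F : Type*) [Field F] (L : Set (Projectivization F (Fin 3 → F))) : Prop :=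
  ∃ φ : (Fin 3 → F) →ₗ[F] F, φ ≠ 0 ∧ L = {P | φ P.rep = 0}

/-- A set of points of the projective plane is collinear if it is contained in a line. -/
def CollinSet (F : Type*) [Field F] (T : Set (Projectivization F (Fin 3 → F))) : Prop :=
  ∃ L, IsProjLine F L ∧ T ⊆ L

/-- The Dolgachev–Kondō code `C_DK ⊆ Pow(P²(F₄))`: the `F₂`-linear span of the (indicator
functions of the) point sets of the `F₄`-rational lines. -/
noncomputable def CDK (F : Type*) [Field F] :
    Submodule (ZMod 2) (Projectivization F (Fin 3 → F) → ZMod 2) :=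
  Submodule.span (ZMod 2)
    {w | ∃ L : Set (Projectivization F (Fin 3 → F)), IsProjLine F L ∧
      w = Set.indicator L (fun _ => (1 : ZMod 2))}

/-- The code `C_F = {w ∈ C_DK : |w ∩ F| even}`: the condition `|w ∩ F| ≡ 0 (mod 2)` is the
vanishing of the `F₂`-linear functional `w ↦ ∑_{x ∈ F} w(x)`. -/
noncomputable def CF (F : Type*) [Field F] (Fs : Finset (Projectivization F (Fin 3 → F))) :
    Submodule (ZMod 2) (Projectivization F (Fin 3 → F) → ZMod 2) :=
  CDK F ⊓ LinearMap.ker (∑ x ∈ Fs, LinearMap.proj x)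

/-- The weight of a word `w ∈ Pow(S) = F₂^S`: the cardinality of its support. -/
noncomputable def wt {S : Type*} (w : S → ZMod 2) : ℕ := {x | w x = 1}.ncard

/-- A code of dimension 9 containing the full word `S`, all of whose words have weight in
`{0, 5, 8, 9, 12, 13, 16, 21}`. -/
def GoodCode9 (S : Type*) (C : Submodule (ZMod 2) (S → ZMod 2)) : Prop :=
  Module.finrank (ZMod 2) C = 9 ∧ (fun _ => (1 : ZMod 2)) ∈ C ∧
    ∀ w ∈ C, wt w ∈ ({0, 5, 8, 9, 12, 13, 16, 21} : Set ℕ)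

/-- Two codes on `S` are isomorphic if one is carried onto the other by a permutation
of `S`. -/
def CodeEquiv (S : Type*) (C₁ C₂ : Submodule (ZMod 2) (S → ZMod 2)) : Prop :=
  ∃ σ : Equiv.Perm S, Submodule.map (LinearMap.funLeft (ZMod 2) (ZMod 2) ⇑σ) C₁ = C₂

/-- Words of length 21 over `F₂`. -/
abbrev Word := Fin 21 → ZMod 2

/-- The `i`-th coordinate of a word as a natural number, `0` outside the range. -/
def Word.bit (w : Word) (i : ℕ) : ℕ := if h : i < 21 then (w ⟨i, h⟩).val else 0

/-- The number with `n` digits `f i, f (i + 1), …` in base 32, least significant first. -/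
def digits32 (f : ℕ → ℕ) : ℕ → ℕ → ℕ
  | 0, _ => 0
  | n + 1, i => f i + 32 * digits32 f n (i + 1)

/-- A word as a number, one base-32 digit for each coordinate. Addition of words becomes bitwise
exclusive or, and the weight is the residue modulo 31. -/
def enc (w : Word) : ℕ := digits32 w.bit 21 0

/-- The `i`-th coordinate of an encoded word. -/
def mbit (m i : ℕ) : ℕ := m / 32 ^ i % 2

/-- The word encoded by a number. -/
def dec (m : ℕ) : Word := fun i => if mbit m i = 1 then 1 else 0

lemma ZMod.val_two_cases (a : ZMod 2) : a = 0 ∨ a = 1 := by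
  revert a; decide

lemma Word.bit_lt (w : Word) (i : ℕ) : w.bit i < 2 := by
  unfold Word.bit; split_ifs
  · exact ZMod.val_lt _
  · norm_num

lemma Word.bit_fin (w : Word) (i : Fin 21) : w.bit i = (w i).val := by
  simp [Word.bit]

lemma Word.bit_add (v w : Word) (i : ℕ) : (v + w).bit i = v.bit i ^^^ w.bit i := by
  unfold Word.bit; split_ifs with h
  · simp only [Pi.add_apply]
    generalize v ⟨i, h⟩ = a; generalize w ⟨i, h⟩ = b
    revert a b; decide
  · rfl

lemma xor_add_mul (a b m n : ℕ) (ha : a < 32) (hb : b < 32) :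
    (a + 32 * m) ^^^ (b + 32 * n) = (a ^^^ b) + 32 * (m ^^^ n) := by
  have hab : a ^^^ b < 2 ^ 5 := Nat.xor_lt_two_pow ha hb
  apply Nat.eq_of_testBit_eq
  intro i
  have key : ∀ c k : ℕ, c < 2 ^ 5 → (c + 32 * k).testBit i =
      if i < 5 then c.testBit i else k.testBit (i - 5) := by
    intro c k hc
    rw [add_comm, show (32 : ℕ) = 2 ^ 5 from rfl, Nat.testBit_two_pow_mul_add k hc]
  rw [Nat.testBit_xor, key a m ha, key b n hb, key _ _ hab]
  split_ifs <;> simp [Nat.testBit_xor]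

lemma digits32_xor (f g : ℕ → ℕ) (hf : ∀ i, f i < 2) (hg : ∀ i, g i < 2) (n i : ℕ) :
    digits32 (fun j => f j ^^^ g j) n i = digits32 f n i ^^^ digits32 g n i := by
  induction n generalizing i with
  | zero => simp [digits32]
  | succ n ih =>
    simp only [digits32, ih]
    rw [xor_add_mul _ _ _ _ ((hf i).trans (by norm_num)) ((hg i).trans (by norm_num))]

lemma enc_add (v w : Word) : enc (v + w) = enc v ^^^ enc w := by
  unfold enc
  rw [← digits32_xor _ _ v.bit_lt w.bit_lt]
  congr 1
  funext i
  exact Word.bit_add v w i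

lemma digits32_modEq (f : ℕ → ℕ) (n i : ℕ) :
    digits32 f n i ≡ ∑ j ∈ Finset.range n, f (i + j) [MOD 31] := by
  induction n generalizing i with
  | zero => rfl
  | succ n ih =>
    have h := (Nat.ModEq.mul (show 32 ≡ 1 [MOD 31] from rfl) (ih (i + 1))).add_left (f i)
    rw [one_mul] at h
    rw [digits32, Finset.sum_range_succ', add_zero, add_comm _ (f i)]
    convert h using 4
    ring

lemma wt_eq_sum {S : Type*} [Fintype S] (w : S → ZMod 2) : wt w = ∑ i, (w i).val := by
  classical
  unfold wt
  rw [Set.ncard_eq_toFinset_card', Finset.card_eq_sum_ones, Set.toFinset_ofPred,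
    Finset.sum_filter]
  refine Finset.sum_congr rfl fun i _ => ?_
  rcases ZMod.val_two_cases (w i) with h | h <;> simp [h, ZMod.val_one]

lemma enc_mod (w : Word) : enc w % 31 = wt w := by
  have h := digits32_modEq w.bit 21 0
  have h2 : ∑ j ∈ Finset.range 21, w.bit (0 + j) = wt w := by
    rw [wt_eq_sum, Finset.sum_range]
    exact Finset.sum_congr rfl fun i _ => by rw [zero_add, Word.bit_fin]
  rw [h2] at h
  have h3 : wt w < 31 := by
    rw [wt_eq_sum]
    calc ∑ i, (w i).val ≤ ∑ _i : Fin 21, 1 :=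
          Finset.sum_le_sum fun i _ => Nat.lt_succ_iff.mp (ZMod.val_lt (w i))
      _ < 31 := by simp
  exact Nat.mod_eq_of_modEq h h3

lemma digits32_div (f : ℕ → ℕ) (hf : ∀ i, f i < 2) (n i k : ℕ) (hk : k < n) :
    mbit (digits32 f n i) k = f (i + k) := by
  unfold mbit
  induction n generalizing i k with
  | zero => omega
  | succ n ih =>
    have h0 := hf i
    cases k with
    | zero => simp only [digits32, pow_zero, Nat.div_one, add_zero]; omega
    | succ k =>
      rw [pow_succ', ← Nat.div_div_eq_div_mul, digits32,
        show (f i + 32 * digits32 f n (i + 1)) / 32 = digits32 f n (i + 1) by omega,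
        ih (i + 1) k (by omega)]
      congr 1; ring

lemma mbit_enc (w : Word) (i : ℕ) (hi : i < 21) : mbit (enc w) i = w.bit i := by
  rw [enc, digits32_div _ w.bit_lt _ _ _ hi, zero_add]

lemma mbit_enc_fin (w : Word) (i : Fin 21) : mbit (enc w) i = (w i).val := by
  rw [mbit_enc w i i.2, Word.bit_fin]

lemma dec_enc (w : Word) : dec (enc w) = w := by
  funext i
  unfold dec
  rw [mbit_enc_fin]
  rcases ZMod.val_two_cases (w i) with h | h <;> simp [h, ZMod.val_one]

lemma enc_injective : Function.Injective enc := fun v w h => by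
  rw [← dec_enc v, h, dec_enc]

lemma enc_zero : enc 0 = 0 := by decide +kernel

/-- Application of `k` to `n`, in a form whose unfolding evaluates `n` first. -/
def forceNat {α : Type*} (n : ℕ) (k : ℕ → α) : α := Nat.rec (k 0) (fun m _ => k (m + 1)) n

lemma forceNat_eq {α : Type*} (n : ℕ) (k : ℕ → α) : forceNat n k = k n := by
  cases n <;> rfl

/-- Application of `k` to `l`, in a form whose unfolding evaluates `l` first. -/
def forceList {α : Type*} : List ℕ → (List ℕ → α) → α
  | [], k => k []
  | a :: l, k => forceNat a fun a' => forceList l fun l' => k (a' :: l')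

lemma forceList_eq {α : Type*} (l : List ℕ) (k : List ℕ → α) : forceList l k = k l := by
  induction l generalizing k with
  | nil => rfl
  | cons a l ih => simp [forceList, forceNat_eq, ih]

/-- Add the encoded word `g` to every entry of a list. -/
def xorAll (g : ℕ) : List ℕ → List ℕ
  | [] => []
  | a :: l => forceNat (a ^^^ g) fun v => v :: xorAll g l

lemma mem_xorAll {g m : ℕ} {l : List ℕ} : m ∈ xorAll g l ↔ ∃ a ∈ l, m = a ^^^ g := by
  induction l with
  | nil => simp [xorAll]
  | cons a l ih => simp [xorAll, forceNat_eq, ih]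

/-- The list `l` consists of the codes of all words of `W`. -/
def ListsCodes (l : List ℕ) (W : Submodule (ZMod 2) Word) : Prop := ∀ m, m ∈ l ↔ ∃ w ∈ W, enc w = m

lemma ListsCodes.bot : ListsCodes [0] ⊥ := by
  intro m
  simp [enc_zero, eq_comm]

lemma mem_sup_span_singleton {V : Type*} [AddCommGroup V] [Module (ZMod 2) V]
    (W : Submodule (ZMod 2) V) (g w : V) :
    w ∈ W ⊔ Submodule.span (ZMod 2) {g} ↔ w ∈ W ∨ ∃ v ∈ W, w = v + g := by
  rw [Submodule.mem_sup]
  constructor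
  · rintro ⟨y, hy, z, hz, rfl⟩
    obtain ⟨a, rfl⟩ := Submodule.mem_span_singleton.mp hz
    rcases ZMod.val_two_cases a with rfl | rfl
    · left; simpa
    · right; exact ⟨y, hy, by simp⟩
  · rintro (h | ⟨v, hv, rfl⟩)
    · exact ⟨w, h, 0, zero_mem _, by simp⟩
    · exact ⟨v, hv, g, Submodule.mem_span_singleton_self g, rfl⟩

lemma ListsCodes.sup {l : List ℕ} {W : Submodule (ZMod 2) Word} (h : ListsCodes l W) (g : Word) :
    ListsCodes (l ++ xorAll (enc g) l) (W ⊔ Submodule.span (ZMod 2) {g}) := by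
  intro m
  rw [List.mem_append, mem_xorAll, h m]
  constructor
  · rintro (⟨w, hw, rfl⟩ | ⟨a, ha, rfl⟩)
    · exact ⟨w, (mem_sup_span_singleton _ _ _).mpr (Or.inl hw), rfl⟩
    · obtain ⟨w, hw, rfl⟩ := (h a).mp ha
      exact ⟨w + g, (mem_sup_span_singleton _ _ _).mpr (Or.inr ⟨w, hw, rfl⟩), enc_add _ _⟩
  · rintro ⟨w, hw, rfl⟩
    rcases (mem_sup_span_singleton _ _ _).mp hw with hw | ⟨v, hv, rfl⟩
    · exact Or.inl ⟨w, hw, rfl⟩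
    · exact Or.inr ⟨enc v, (h _).mpr ⟨v, hv, rfl⟩, enc_add _ _⟩

/-- The list of all sums of sublists of a list of encoded words. -/
def spanList : List ℕ → List ℕ
  | [] => [0]
  | g :: gs => let l := spanList gs; l ++ xorAll g l

/-- The span of a list of encoded words. -/
def spanOf (gs : List ℕ) : Submodule (ZMod 2) Word :=
  Submodule.span (ZMod 2) {w | ∃ m ∈ gs, w = dec m}

lemma spanOf_cons (g : ℕ) (gs : List ℕ) :
    spanOf (g :: gs) = spanOf gs ⊔ Submodule.span (ZMod 2) {dec g} := by
  rw [spanOf, spanOf, ← Submodule.span_union]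
  congr 1
  ext w
  simp

lemma lists_spanList (gs : List ℕ) (h : gs.all (fun m => enc (dec m) == m) = true) :
    ListsCodes (spanList gs) (spanOf gs) := by
  induction gs with
  | nil =>
    have : spanOf [] = ⊥ := by simp [spanOf]
    rw [this]; exact ListsCodes.bot
  | cons g gs ih =>
    simp only [List.all_cons, Bool.and_eq_true, beq_iff_eq] at h
    rw [spanOf_cons]
    have := (ih h.2).sup (dec g)
    rwa [h.1] at this

section Transport

variable {S T : Type*}

local notation "pull" => LinearMap.funLeft (ZMod 2) (ZMod 2)

lemma wt_comp (e : S ≃ T) (w : T → ZMod 2) : wt (w ∘ e) = wt w := by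
  unfold wt
  rw [show {x | (w ∘ e) x = 1} = e ⁻¹' {x | w x = 1} from rfl]
  exact Set.ncard_preimage_of_injective_subset_range e.injective (by simp)

lemma finrank_map_funLeft (e : S ≃ T) (C : Submodule (ZMod 2) (T → ZMod 2)) :
    Module.finrank (ZMod 2) (C.map (pull e)) = Module.finrank (ZMod 2) C :=
  (LinearEquiv.finrank_eq (Submodule.equivMapOfInjective _
    (LinearMap.funLeft_injective_of_surjective _ _ _ e.surjective) C)).symm

lemma GoodCode9.map (e : S ≃ T) {C : Submodule (ZMod 2) (T → ZMod 2)} (h : GoodCode9 T C) :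
    GoodCode9 S (C.map (pull e)) := by
  refine ⟨(finrank_map_funLeft e C).trans h.1, ⟨_, h.2.1, rfl⟩, ?_⟩
  rintro _ ⟨w, hw, rfl⟩
  rw [show pull e w = w ∘ e from rfl, wt_comp]
  exact h.2.2 w hw

lemma map_funLeft_map {U : Type*} (e : S → T) (f : T → U) (C : Submodule (ZMod 2) (U → ZMod 2)) :
    (C.map (pull f)).map (pull e) = C.map (pull (f ∘ e)) := by
  rw [← Submodule.map_comp]; rfl

lemma map_funLeft_id (C : Submodule (ZMod 2) (S → ZMod 2)) : C.map (pull id) = C :=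
  Submodule.map_id C

lemma CodeEquiv.symm {C D : Submodule (ZMod 2) (S → ZMod 2)} (h : CodeEquiv S C D) :
    CodeEquiv S D C := by
  obtain ⟨σ, rfl⟩ := h
  refine ⟨σ.symm, ?_⟩
  rw [map_funLeft_map, σ.self_comp_symm, map_funLeft_id]

lemma CodeEquiv.trans {C D E : Submodule (ZMod 2) (S → ZMod 2)} (h : CodeEquiv S C D)
    (h' : CodeEquiv S D E) : CodeEquiv S C E := by
  obtain ⟨σ, rfl⟩ := h
  obtain ⟨τ, rfl⟩ := h'
  exact ⟨τ.trans σ, (map_funLeft_map τ σ C).symm⟩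

lemma CodeEquiv.map (e : S ≃ T) {C D : Submodule (ZMod 2) (T → ZMod 2)} (h : CodeEquiv T C D) :
    CodeEquiv S (C.map (pull e)) (D.map (pull e)) := by
  obtain ⟨σ, rfl⟩ := h
  refine ⟨(e.trans σ).trans e.symm, ?_⟩
  rw [map_funLeft_map, map_funLeft_map]
  congr 2
  funext x
  simp

/-- The number of words of weight 5 in a code. -/
noncomputable def lightWords (C : Submodule (ZMod 2) (S → ZMod 2)) : ℕ := {w ∈ C | wt w = 5}.ncard

lemma lightWords_map (e : S ≃ T) (C : Submodule (ZMod 2) (T → ZMod 2)) :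
    lightWords (C.map (pull e)) = lightWords C := by
  have : {w ∈ C.map (pull e) | wt w = 5} = pull e '' {w ∈ C | wt w = 5} := by
    ext w
    constructor
    · rintro ⟨⟨v, hv, rfl⟩, h⟩
      exact ⟨v, ⟨hv, (wt_comp e v).symm.trans h⟩, rfl⟩
    · rintro ⟨v, ⟨hv, h⟩, rfl⟩
      exact ⟨⟨v, hv, rfl⟩, (wt_comp e v).trans h⟩
  unfold lightWords
  rw [this, Set.ncard_image_of_injective _
    (LinearMap.funLeft_injective_of_surjective _ _ _ e.surjective)]

lemma CodeEquiv.lightWords_eq {C D : Submodule (ZMod 2) (S → ZMod 2)} (h : CodeEquiv S C D) :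
    lightWords C = lightWords D := by
  obtain ⟨σ, rfl⟩ := h
  exact (lightWords_map σ C).symm

end Transport

section LinearAlgebra

variable {V : Type*} [AddCommGroup V] [Module (ZMod 2) V]

lemma finrank_sup_span_singleton [Finite V] (W : Submodule (ZMod 2) V) {g : V} (hg : g ∉ W) :
    Module.finrank (ZMod 2) ↥(W ⊔ Submodule.span (ZMod 2) {g}) =
      Module.finrank (ZMod 2) W + 1 := by
  have h := Submodule.finrank_sup_add_finrank_inf_eq W (Submodule.span (ZMod 2) {g})
  have h0 : g ≠ 0 := fun h => hg (h ▸ W.zero_mem)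
  have hdisj : W ⊓ Submodule.span (ZMod 2) {g} = ⊥ := by
    rw [← disjoint_iff, Submodule.disjoint_span_singleton' h0]
    exact hg
  rw [hdisj, finrank_bot, finrank_span_singleton h0] at h
  exact h

lemma inf_ker_sup_span_singleton (W : Submodule (ZMod 2) V) (f : V →ₗ[ZMod 2] ZMod 2) {g : V}
    (hg : g ∈ W) (hf : f g = 1) :
    W ⊓ LinearMap.ker f ⊔ Submodule.span (ZMod 2) {g} = W := by
  apply le_antisymm (sup_le inf_le_left ((Submodule.span_singleton_le_iff_mem _ _).mpr hg))
  intro w hw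
  rw [mem_sup_span_singleton]
  rcases ZMod.val_two_cases (f w) with h | h
  · exact Or.inl ⟨hw, h⟩
  · refine Or.inr ⟨w - g, ⟨W.sub_mem hw hg, ?_⟩, by abel⟩
    change f (w - g) = 0
    rw [map_sub, h, hf, sub_self]

lemma finrank_inf_ker [Finite V] (W : Submodule (ZMod 2) V) (f : V →ₗ[ZMod 2] ZMod 2) {g : V}
    (hg : g ∈ W) (hf : f g = 1) :
    Module.finrank (ZMod 2) ↥(W ⊓ LinearMap.ker f) + 1 = Module.finrank (ZMod 2) W := by
  conv_rhs => rw [← inf_ker_sup_span_singleton W f hg hf]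
  refine (finrank_sup_span_singleton _ fun h => ?_).symm
  exact one_ne_zero (hf.symm.trans h.2)

end LinearAlgebra

lemma mbit_eq_testBit (m i : ℕ) : mbit m i = (m.testBit (5 * i)).toNat := by
  rw [Nat.toNat_testBit, mbit, pow_mul]; norm_num

lemma mbit_lt (m i : ℕ) : mbit m i < 2 := Nat.mod_lt _ two_pos

lemma dec_xor (a b : ℕ) : dec (a ^^^ b) = dec a + dec b := by
  funext i
  simp only [dec, mbit_eq_testBit, Nat.testBit_xor, Pi.add_apply]
  cases a.testBit (5 * i) <;> cases b.testBit (5 * i) <;> decide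

lemma dec_zero : dec 0 = 0 := by
  funext i
  simp [dec, mbit]

/-- Reduction of the encoded word `m` by generators with specified leading coordinates. -/
def reduce (R : List (ℕ × ℕ)) (w : ℕ) : ℕ → ℕ :=
  fun m => R.foldl (fun a r => bif Nat.beq (mbit w r.1) 1 then a ^^^ r.2 else a) m

lemma dec_reduce (R : List (ℕ × ℕ)) (w m : ℕ) :
    dec m - dec (reduce R w m) ∈ spanOf (R.map Prod.snd) := by
  induction R generalizing m with
  | nil => simp [reduce]
  | cons r R ih =>
    rw [List.map_cons, spanOf_cons]
    have key : reduce (r :: R) w m =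
        reduce R w (bif Nat.beq (mbit w r.1) 1 then m ^^^ r.2 else m) := rfl
    rw [key]
    cases Nat.beq (mbit w r.1) 1
    · exact Submodule.mem_sup_left (ih m)
    · have h1 := Submodule.mem_sup_left (T := Submodule.span (ZMod 2) {dec r.2}) (ih (m ^^^ r.2))
      have h2 := Submodule.mem_sup_right (S := spanOf (R.map Prod.snd))
        (Submodule.mem_span_singleton_self (R := ZMod 2) (dec r.2))
      have h3 := Submodule.sub_mem _ h1 h2
      rw [dec_xor] at h3
      rw [cond_true]
      convert h3 using 1
      abel

lemma finrank_spanOf_le (l : List ℕ) : Module.finrank (ZMod 2) (spanOf l) ≤ l.length := by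
  have : {w | ∃ m ∈ l, w = dec m} = ((l.map dec).toFinset : Set Word) := by
    ext w; simp [eq_comm]
  rw [spanOf, this]
  exact (finrank_span_finset_le_card _).trans ((List.toFinset_card_le _).trans (by simp))

lemma dec_mem_spanOf_of_reduce {R : List (ℕ × ℕ)} {m : ℕ} (h : Nat.beq (reduce R m m) 0 = true) :
    dec m ∈ spanOf (R.map Prod.snd) := by
  have := dec_reduce R m m
  rwa [Nat.eq_of_beq_eq_true h, dec_zero, sub_zero] at this

/-- Generators that form the identity matrix at their leading coordinates are independent. -/
lemma finrank_spanOf_eq {R : List (ℕ × ℕ)} (h : ∀ a b : Fin R.length,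
    dec R[b].2 (Fin.ofNat 21 R[a].1) = if a = b then 1 else 0) :
    Module.finrank (ZMod 2) (spanOf (R.map Prod.snd)) = R.length := by
  have hli : LinearIndependent (ZMod 2) fun b : Fin R.length => dec R[b].2 := by
    rw [Fintype.linearIndependent_iff]
    intro c hc a
    have := congrFun hc (Fin.ofNat 21 R[a].1)
    simp only [Finset.sum_apply, Pi.smul_apply, smul_eq_mul, h, mul_ite, mul_one, mul_zero,
      Finset.sum_ite_eq, Finset.mem_univ, if_true, Pi.zero_apply] at this
    exact this
  have hs : {w | ∃ m ∈ R.map Prod.snd, w = dec m} =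
      Set.range fun b : Fin R.length => dec R[b].2 := by
    ext w
    constructor
    · rintro ⟨m, hm, rfl⟩
      obtain ⟨r, hr, rfl⟩ := List.mem_map.mp hm
      obtain ⟨n, rfl⟩ := List.mem_iff_get.mp hr
      exact ⟨n, rfl⟩
    · rintro ⟨n, rfl⟩
      exact ⟨_, List.mem_map_of_mem (List.getElem_mem n.2), rfl⟩
  rw [spanOf, hs, finrank_span_eq_card hli, Fintype.card_fin]

/-- Addition of the field with four elements on `Fin 4`. -/
def addF4 (x y : Fin 4) : Fin 4 := ![![0, 1, 2, 3], ![1, 0, 3, 2], ![2, 3, 0, 1], ![3, 2, 1, 0]] x y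

/-- Multiplication of the field with four elements on `Fin 4`. -/
def mulF4 (x y : Fin 4) : Fin 4 := ![![0, 0, 0, 0], ![0, 1, 2, 3], ![0, 2, 3, 1], ![0, 3, 1, 2]] x y

/-- Normalized coordinates of the 21 points of the projective plane over `F₄`. -/
def coords (i : Fin 21) : Fin 3 → Fin 4 :=
  if h : i.1 < 16 then ![1, ⟨i.1 / 4, by omega⟩, ⟨i.1 % 4, by omega⟩]
  else if i.1 < 20 then ![0, 1, ⟨i.1 % 4, by omega⟩] else ![0, 0, 1]

/-- The standard bilinear form on `F₄³`. -/
def dotF4 (u v : Fin 3 → Fin 4) : Fin 4 :=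
  addF4 (addF4 (mulF4 (u 0) (v 0)) (mulF4 (u 1) (v 1))) (mulF4 (u 2) (v 2))

/-- Incidence of the `j`-th line and the `i`-th point. -/
def incident (j i : Fin 21) : Bool := dotF4 (coords j) (coords i) == 0

lemma coords_ne_zero (i : Fin 21) : ∃ t, coords i t ≠ 0 := by
  revert i; decide +kernel

lemma coords_injective (i j : Fin 21) (k : Fin 4)
    (h : ∀ t, mulF4 k (coords j t) = coords i t) : i = j := by
  revert i j k; decide +kernel

lemma exists_coords (u : Fin 3 → Fin 4) (h : ∃ t, u t ≠ 0) :
    ∃ i k, k ≠ 0 ∧ ∀ t, mulF4 k (coords i t) = u t := by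
  revert u; decide +kernel

lemma exists_parametrization (F : Type*) [Field F] [Fintype F] (hF : Fintype.card F = 4) :
    ∃ ι : Fin 4 → F, Function.Bijective ι ∧ ι 0 = 0 ∧ (∀ x y, ι (addF4 x y) = ι x + ι y) ∧
      ∀ x y, ι (mulF4 x y) = ι x * ι y := by
  have h2 : (2 : F) = 0 := by
    have h : ((4 : ℕ) : F) = 0 := hF ▸ Nat.cast_card_eq_zero F
    have h' : (2 : F) * 2 = 0 := by rw [← h]; norm_num
    exact mul_self_eq_zero.mp h'
  obtain ⟨a, ha0, ha1⟩ : ∃ a : F, a ≠ 0 ∧ a ≠ 1 := by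
    by_contra! h
    classical
    have : (Finset.univ : Finset F) ⊆ {0, 1} := by
      intro a _
      by_cases ha : a = 0
      · simp [ha]
      · simp [h a ha]
    have := (Finset.card_le_card this).trans Finset.card_le_two
    rw [Finset.card_univ, hF] at this
    omega
  have ha : a ^ 2 = a + 1 := by
    have h4 : a ^ 4 = a := hF ▸ FiniteField.pow_card a
    have h : a * ((a - 1) * (a ^ 2 + a + 1)) = 0 := by linear_combination h4
    have h3 := ((mul_eq_zero.mp ((mul_eq_zero.mp h).resolve_left ha0)).resolve_left
      (sub_ne_zero.mpr ha1))
    linear_combination h3 - (a + 1) * h2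
  have hinj : Function.Injective ![0, 1, a, a + 1] := by
    intro x y hxy
    fin_cases x <;> fin_cases y <;> simp at hxy ⊢ <;> grind
  refine ⟨![0, 1, a, a + 1], ?_, rfl, ?_, ?_⟩
  · rw [Fintype.bijective_iff_injective_and_card]
    exact ⟨hinj, by simp [hF]⟩
  · intro x y
    fin_cases x <;> fin_cases y <;> simp [addF4] <;> grind
  · intro x y
    fin_cases x <;> fin_cases y <;> simp [mulF4] <;> grind

theorem exists_plane_equiv (F : Type*) [Field F] [Fintype F] (hF : Fintype.card F = 4) :
    ∃ φ : Fin 21 ≃ Projectivization F (Fin 3 → F), ∀ L, IsProjLine F L ↔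
      ∃ j, L = {P | incident j (φ.symm P) = true} := by
  obtain ⟨ι, hι, h0, hadd, hmul⟩ := exists_parametrization F hF
  have hι0 : ∀ x, ι x = 0 ↔ x = 0 := fun x => by rw [← h0, hι.1.eq_iff]
  have hv : ∀ i, ι ∘ coords i ≠ 0 := by
    intro i h
    obtain ⟨t, ht⟩ := coords_ne_zero i
    exact ht ((hι0 _).mp (congrFun h t))
  have hscale : ∀ v : Fin 3 → F, v ≠ 0 → ∃ i, ∃ k : F, k ≠ 0 ∧ v = k • (ι ∘ coords i) := by
    intro v hv
    choose u hu using fun t => hι.2 (v t)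
    obtain ⟨t, ht⟩ := Function.ne_iff.mp hv
    obtain ⟨i, k, hk, hik⟩ := exists_coords u
      ⟨t, fun h => ht (by rw [← hu t, h, h0]; rfl)⟩
    refine ⟨i, ι k, (hι0 k).not.mpr hk, funext fun t => ?_⟩
    rw [← hu t, ← hik t, hmul]; rfl
  let f : Fin 21 → Projectivization F (Fin 3 → F) := fun i => Projectivization.mk F _ (hv i)
  have hf : Function.Bijective f := by
    constructor
    · intro i j hij
      obtain ⟨c, hc⟩ := (Projectivization.mk_eq_mk_iff' F _ _ _ _).mp hij
      obtain ⟨k, rfl⟩ := hι.2 c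
      refine coords_injective i j k fun t => hι.1 ?_
      rw [hmul]
      exact congrFun hc t
    · intro P
      obtain ⟨i, k, hk, h⟩ := hscale P.rep P.rep_nonzero
      refine ⟨i, ?_⟩
      rw [← P.mk_rep]
      exact ((Projectivization.mk_eq_mk_iff' F _ _ _ _).mpr ⟨k, h.symm⟩).symm
  have hdot : ∀ j i, incident j i = true ↔ ∑ t, ι (coords j t) * ι (coords i t) = 0 := by
    intro j i
    rw [incident, beq_iff_eq, ← hι0, dotF4, hadd, hadd, hmul, hmul, hmul, Fin.sum_univ_three]
  have hrep : ∀ (g : (Fin 3 → F) →ₗ[F] F) i, g (f i).rep = 0 ↔ g (ι ∘ coords i) = 0 := by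
    intro g i
    obtain ⟨c, hc⟩ := Projectivization.exists_smul_eq_mk_rep F _ (hv i)
    rw [← hc, Units.smul_def, map_smul, smul_eq_mul, mul_eq_zero, or_iff_right c.ne_zero]
  have hlin : ∀ (g : (Fin 3 → F) →ₗ[F] F) (v : Fin 3 → F),
      g v = ∑ t, g (Pi.single t 1) * v t := by
    intro g v
    rw [LinearMap.pi_apply_eq_sum_univ g v]
    refine Finset.sum_congr rfl fun t _ => ?_
    rw [smul_eq_mul, mul_comm]
    congr 2
    ext j
    simp [Pi.single_apply, eq_comm]
  let φ := Equiv.ofBijective f hf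
  have hset : ∀ (L : Set (Projectivization F (Fin 3 → F))) (j : Fin 21),
      L = {P | incident j (φ.symm P) = true} ↔ ∀ i, f i ∈ L ↔ incident j i = true := by
    intro L j
    rw [Set.ext_iff, φ.symm.forall_congr_left]
    refine forall_congr' fun i => ?_
    simp [φ]
  refine ⟨φ, fun L => ?_⟩
  constructor
  · rintro ⟨g, hg, rfl⟩
    obtain ⟨j, k, hk, hj⟩ := hscale (fun t => g (Pi.single t 1)) (fun h => hg (by
      ext t; simpa using congrFun h t))
    refine ⟨j, (hset _ j).mpr fun i => ?_⟩
    rw [Set.mem_ofPred_eq, hrep, hdot, hlin]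
    simp only [funext_iff, Pi.smul_apply, smul_eq_mul, Function.comp] at hj ⊢
    simp only [hj, mul_assoc, ← Finset.mul_sum, mul_eq_zero, hk, false_or]
  · rintro ⟨j, hL⟩
    rw [hset] at hL
    let g : (Fin 3 → F) →ₗ[F] F := ∑ t, ι (coords j t) • LinearMap.proj t
    have hg : ∀ v, g v = ∑ t, ι (coords j t) * v t := by
      intro v
      simp [g]
    refine ⟨g, ?_, ?_⟩
    · intro h
      obtain ⟨t, ht⟩ := coords_ne_zero j
      apply ht
      rw [← hι0]
      have := hg (Pi.single t 1)
      rw [h] at this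
      simpa [Pi.single_apply] using this.symm
    · ext P
      obtain ⟨i, rfl⟩ := hf.2 P
      rw [hL, Set.mem_ofPred_eq, hrep, hdot, hg]
      rfl

/-- Generators, with leading coordinates, of the code spanned by the lines. -/
def planeGens : List (ℕ × ℕ) := [
  (0, 39614082437723824732915105793),
  (1, 1268888579263932879527861026848),
  (2, 1267689285891387747693370541056),
  (3, 1308541344929842510490505347072),
  (4, 1268927263709604955741060333568),
  (5, 39652805842884481723607810048),
  (6, 40852022513938721953326039040),
  (8, 1267650600228266592477512728576),
  (12, 1267650639225799294823302168576),
  (16, 1308542516076694233331139608576)]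

/-- The elements of `planeGens` as sums of lines. -/
def planeCoeffs : List (List (Fin 21)) := [
  [1, 3, 4, 6, 16],
  [0, 2, 5, 6],
  [1, 3, 4, 5],
  [0, 2],
  [0, 2, 6],
  [1, 2, 5, 6],
  [0, 1, 4, 5],
  [12],
  [8],
  [0]]

/-- The word of the `j`-th line. -/
def lineWord (j : Fin 21) : Word := fun i => if incident j i then 1 else 0

/-- The code spanned by the lines of the projective plane. -/
def planeCode : Submodule (ZMod 2) Word := Submodule.span (ZMod 2) (Set.range lineWord)

lemma lineWord_mem (j : Fin 21) : lineWord j ∈ planeCode := Submodule.subset_span ⟨j, rfl⟩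

lemma planeCode_eq : planeCode = spanOf (planeGens.map Prod.snd) := by
  apply le_antisymm
  · rw [planeCode, Submodule.span_le]
    rintro _ ⟨j, rfl⟩
    have h : ∀ j, Nat.beq (reduce planeGens (enc (lineWord j)) (enc (lineWord j))) 0 = true := by
      decide +kernel
    rw [← dec_enc (lineWord j)]
    exact dec_mem_spanOf_of_reduce (h j)
  · have h : planeGens.map Prod.snd =
        planeCoeffs.map fun l => enc (l.map lineWord).sum := by decide +kernel
    rw [spanOf, Submodule.span_le, h]
    rintro _ ⟨m, hm, rfl⟩
    obtain ⟨l, -, rfl⟩ := List.mem_map.mp hm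
    rw [dec_enc]
    refine list_sum_mem fun w hw => ?_
    obtain ⟨j, -, rfl⟩ := List.mem_map.mp hw
    exact lineWord_mem j

lemma finrank_planeCode : Module.finrank (ZMod 2) planeCode = 10 := by
  rw [planeCode_eq, finrank_spanOf_eq (by decide +kernel)]
  rfl

lemma one_mem_planeCode : (fun _ => 1 : Word) ∈ planeCode := by
  rw [planeCode_eq, ← dec_enc fun _ => 1]
  exact dec_mem_spanOf_of_reduce (by decide +kernel)

lemma lineWord_injective : Function.Injective lineWord := by
  have h : ∀ i j, enc (lineWord i) = enc (lineWord j) → i = j := by decide +kernel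
  exact fun i j hij => h i j (congrArg enc hij)

lemma wt_lineWord (j : Fin 21) : wt (lineWord j) = 5 := by
  rw [← enc_mod]
  revert j
  decide +kernel

lemma wt_planeCode {w : Word} (hw : w ∈ planeCode) :
    wt w ∈ ({0, 5, 8, 9, 12, 13, 16, 21} : Set ℕ) ∧ (wt w = 5 → ∃ j, w = lineWord j) := by
  rw [planeCode_eq] at hw
  have hl := (lists_spanList _ (by decide +kernel) (enc w)).mpr ⟨w, hw, rfl⟩
  have h : ((spanList (planeGens.map Prod.snd)).all fun m => forceNat (m % 31) fun t =>
      ([0, 8, 9, 12, 13, 16, 21].any fun a => Nat.beq t a) || (Nat.beq t 5 &&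
        (List.finRange 21).any fun j => Nat.beq m (enc (lineWord j)))) = true := by
    decide +kernel
  have := List.all_eq_true.mp h _ hl
  rw [forceNat_eq, enc_mod, Bool.or_eq_true, Bool.and_eq_true] at this
  rcases this with h | ⟨h5, h⟩
  · simp only [List.any_cons, List.any_nil, Bool.or_false, Bool.or_eq_true, Nat.beq_eq] at h
    simp only [Set.mem_insert_iff, Set.mem_singleton_iff]
    omega
  · obtain ⟨j, -, hj⟩ := List.any_eq_true.mp h
    rw [Nat.eq_of_beq_eq_true h5]
    exact ⟨by simp, fun _ => ⟨j, enc_injective (Nat.eq_of_beq_eq_true hj)⟩⟩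

/-- The words of the plane code that meet `T` in an even number of points. -/
def evenPart (T : Finset (Fin 21)) : Submodule (ZMod 2) Word :=
  planeCode ⊓ LinearMap.ker (∑ x ∈ T, LinearMap.proj x)

/-- The number of points of `T` on the `j`-th line. -/
def hits (T : Finset (Fin 21)) (j : Fin 21) : ℕ := (T.filter fun x => incident j x = true).card

lemma sum_lineWord (T : Finset (Fin 21)) (j : Fin 21) :
    (∑ x ∈ T, LinearMap.proj x : Word →ₗ[ZMod 2] ZMod 2) (lineWord j) = (hits T j : ZMod 2) := by
  simp [lineWord, hits, Finset.sum_boole]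

lemma lightWords_evenPart (T : Finset (Fin 21)) :
    lightWords (evenPart T) = (Finset.univ.filter fun j => hits T j % 2 = 0).card := by
  have : {w ∈ evenPart T | wt w = 5} =
      lineWord '' (Finset.univ.filter fun j => hits T j % 2 = 0 : Finset (Fin 21)) := by
    ext w
    simp only [Set.mem_image, Finset.coe_filter, Finset.mem_univ, true_and, Set.mem_ofPred_eq]
    constructor
    · rintro ⟨⟨hw, hk⟩, h⟩
      obtain ⟨j, rfl⟩ := (wt_planeCode hw).2 h
      refine ⟨j, ?_, rfl⟩
      have hk' := (sum_lineWord T j).symm.trans hk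
      rw [ZMod.natCast_eq_zero_iff] at hk'
      omega
    · rintro ⟨j, hj, rfl⟩
      refine ⟨⟨lineWord_mem j, ?_⟩, wt_lineWord j⟩
      refine (sum_lineWord T j).trans ?_
      rw [ZMod.natCast_eq_zero_iff]
      omega
  rw [lightWords, this, Set.ncard_image_of_injective _ lineWord_injective, Set.ncard_coe_finset]

lemma goodCode9_evenPart {T : Finset (Fin 21)} (hT : T.card = 4) {j : Fin 21}
    (hj : hits T j % 2 = 1) : GoodCode9 (Fin 21) (evenPart T) := by
  refine ⟨?_, ⟨one_mem_planeCode, ?_⟩, fun w hw => (wt_planeCode hw.1).1⟩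
  · have := finrank_inf_ker planeCode (∑ x ∈ T, LinearMap.proj x) (lineWord_mem j) (by
      rw [sum_lineWord, ← ZMod.natCast_mod, hj, Nat.cast_one])
    rw [finrank_planeCode] at this
    exact Nat.succ_injective this
  · change (∑ x ∈ T, LinearMap.proj x : Word →ₗ[ZMod 2] ZMod 2) _ = 0
    simp [hT]
    rfl

/-- The relation between the numbers of even and of large intersections of a set of four points
with the lines, where the numbers of common points are the digits of `s`. -/
def profile (s : ℕ) : Bool :=
  forceList ((List.finRange 21).map fun j : Fin 21 => s / 32 ^ (j : ℕ) % 32) fun l =>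
    (fun n => bif l.any (Nat.beq 4) then Nat.beq n 5 else
      bif l.any (Nat.beq 3) then Nat.beq n 9 else Nat.beq n 13)
    (l.countP fun t => Nat.beq (t % 2) 0)

/-- Whether `profile` holds for `acc` plus any sum of `k` entries of a list. -/
def profiles : ℕ → List ℕ → ℕ → Bool
  | 0, _, acc => profile acc
  | _ + 1, [], _ => true
  | k + 1, m :: l, acc => (forceNat (acc + m) fun a => profiles k l a) && profiles (k + 1) l acc

lemma profile_of_profiles {l l' : List ℕ} (hl : l'.Sublist l) (acc : ℕ)
    (h : profiles l'.length l acc = true) : profile (acc + l'.sum) = true := by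
  induction hl generalizing acc with
  | slnil => exact h
  | cons m hl ih =>
    rename_i l₁ l₂
    cases l₁ with
    | nil => exact h
    | cons a l₁ =>
      simp only [List.length_cons, profiles, Bool.and_eq_true] at h
      exact ih acc h.2
  | cons_cons m hl ih =>
    simp only [List.length_cons, profiles, Bool.and_eq_true, forceNat_eq] at h
    rw [List.sum_cons, ← add_assoc]
    exact ih _ h.1

lemma profiles_lineWord :
    (forceList ((List.finRange 21).map fun j => enc (lineWord j)) fun l => profiles 4 l 0) =
      true := by
  decide +kernel

lemma digits32_sum {ι : Type*} (T : Finset ι) (f : ι → ℕ → ℕ) (n i : ℕ) :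
    ∑ x ∈ T, digits32 (f x) n i = digits32 (fun j => ∑ x ∈ T, f x j) n i := by
  induction n generalizing i with
  | zero => simp [digits32]
  | succ n ih => simp only [digits32, ← ih, Finset.sum_add_distrib, Finset.mul_sum]

lemma digits32_digit (f : ℕ → ℕ) (hf : ∀ i, f i < 32) (n i k : ℕ) (hk : k < n) :
    digits32 f n i / 32 ^ k % 32 = f (i + k) := by
  induction n generalizing i k with
  | zero => omega
  | succ n ih =>
    have h0 := hf i
    cases k with
    | zero => simp only [digits32, pow_zero, Nat.div_one, add_zero]; omega
    | succ k =>
      rw [pow_succ', ← Nat.div_div_eq_div_mul, digits32,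
        show (f i + 32 * digits32 f n (i + 1)) / 32 = digits32 f n (i + 1) by omega,
        ih (i + 1) k (by omega)]
      congr 1; ring

lemma incident_comm (i j : Fin 21) : incident i j = incident j i := by
  revert i j; decide +kernel

lemma digit_sum_lineWord {T : Finset (Fin 21)} (hT : T.card < 32) (j : Fin 21) :
    (∑ x ∈ T, enc (lineWord x)) / 32 ^ (j : ℕ) % 32 = hits T j := by
  simp only [enc]
  rw [digits32_sum, digits32_digit _ _ _ _ _ j.2, zero_add]
  · simp only [Word.bit_fin, hits, Finset.card_filter, lineWord]
    refine Finset.sum_congr rfl fun x _ => ?_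
    rw [incident_comm x j]
    split_ifs <;> rfl
  · intro i
    refine lt_of_le_of_lt (Finset.sum_le_card_nsmul _ _ 1 fun x _ => ?_) (by simpa using hT)
    exact Nat.lt_succ_iff.mp (Word.bit_lt _ _)

lemma profile_sum_lineWord {T : Finset (Fin 21)} (hT : T.card = 4) :
    profile (∑ x ∈ T, enc (lineWord x)) = true := by
  have h := profiles_lineWord
  rw [forceList_eq] at h
  have hs : ((List.finRange 21).filter (· ∈ T)).toFinset = T := by ext; simp
  have hn : ((List.finRange 21).filter (· ∈ T)).Nodup := (List.nodup_finRange 21).filter _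
  have hsub := (List.filter_sublist (p := (· ∈ T)) (l := List.finRange 21)).map
    fun j => enc (lineWord j)
  have hlen : ((List.finRange 21).filter (· ∈ T)).length = 4 := by
    rw [← List.toFinset_card_of_nodup hn, hs, hT]
  generalize (List.finRange 21).map (fun j => enc (lineWord j)) = l at h hsub
  have := profile_of_profiles hsub 0 (by rw [List.length_map, hlen]; exact h)
  rwa [zero_add, ← List.sum_toFinset _ hn, hs] at this

lemma lightWords_of_card_eq_four {T : Finset (Fin 21)} (hT : T.card = 4) :
    lightWords (evenPart T) = if ∃ j, hits T j = 4 then 5 else if ∃ j, hits T j = 3 then 9 else 13 := by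
  have h := profile_sum_lineWord hT
  rw [profile, forceList_eq] at h
  simp only [digit_sum_lineWord (show T.card < 32 by omega)] at h
  have hc : ((List.finRange 21).map (hits T)).countP (fun t => Nat.beq (t % 2) 0) =
      lightWords (evenPart T) := by
    rw [lightWords_evenPart, List.countP_map, List.countP_eq_length_filter,
      ← List.toFinset_card_of_nodup ((List.nodup_finRange 21).filter _)]
    congr 1
    ext j
    simp
  have ha : ∀ k, ((List.finRange 21).map (hits T)).any (Nat.beq k) =
      decide (∃ j, hits T j = k) := by
    intro k
    rw [Bool.eq_iff_iff, List.any_eq_true, decide_eq_true_iff]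
    constructor
    · rintro ⟨t, ht, hk⟩
      obtain ⟨j, -, rfl⟩ := List.mem_map.mp ht
      exact ⟨j, (Nat.eq_of_beq_eq_true hk).symm⟩
    · rintro ⟨j, rfl⟩
      exact ⟨_, List.mem_map_of_mem (List.mem_finRange j), Nat.beq_refl _⟩
  rw [hc, ha, ha] at h
  split_ifs with h4 h3
  · simpa [h4] using h
  · simpa [h4, h3] using h
  · simpa [h4, h3] using h

/-- The geometric meaning of the number of light words. -/
lemma lightWords_cases {T : Finset (Fin 21)} (hT : T.card = 4) :
    ((∀ j, hits T j < 3) → lightWords (evenPart T) = 13) ∧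
    ((∃ j, hits T j = 3) → (∀ j, hits T j ≠ 4) → lightWords (evenPart T) = 9) ∧
    ((∃ j, hits T j = 4) → lightWords (evenPart T) = 5) := by
  rw [lightWords_of_card_eq_four hT]
  refine ⟨fun h => ?_, fun h3 h4 => ?_, fun h => by rw [if_pos h]⟩
  · rw [if_neg fun ⟨j, hj⟩ => by have := h j; omega, if_neg fun ⟨j, hj⟩ => by have := h j; omega]
  · rw [if_neg fun ⟨j, hj⟩ => h4 j hj, if_pos h3]

lemma exists_hits_odd {T : Finset (Fin 21)} (hT : T.card = 4) : ∃ j, hits T j % 2 = 1 := by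
  by_contra! h
  have h21 : lightWords (evenPart T) = 21 := by
    rw [lightWords_evenPart, Finset.filter_true_of_mem fun j _ => by have := h j; omega]
    rfl
  rw [lightWords_of_card_eq_four hT] at h21
  split_ifs at h21 <;> omega

section Geometry

variable {F : Type*} [Field F]

local notation "pull" => LinearMap.funLeft (ZMod 2) (ZMod 2)

lemma CDK_map (φ : Fin 21 ≃ Projectivization F (Fin 3 → F))
    (hφ : ∀ L, IsProjLine F L ↔ ∃ j, L = {P | incident j (φ.symm P) = true}) :
    (CDK F).map (pull φ) = planeCode := by
  rw [CDK, Submodule.map_span, planeCode]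
  congr 1
  have h : ∀ j, pull φ (Set.indicator {P | incident j (φ.symm P) = true} fun _ => (1 : ZMod 2)) =
      lineWord j := by
    intro j
    ext i
    simp [LinearMap.funLeft_apply, Set.indicator_apply, lineWord]
  ext w
  constructor
  · rintro ⟨_, ⟨L, hL, rfl⟩, rfl⟩
    obtain ⟨j, rfl⟩ := (hφ L).mp hL
    exact ⟨j, (h j).symm⟩
  · rintro ⟨j, rfl⟩
    exact ⟨_, ⟨_, (hφ _).mpr ⟨j, rfl⟩, rfl⟩, h j⟩

lemma CF_map (φ : Fin 21 ≃ Projectivization F (Fin 3 → F))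
    (hφ : ∀ L, IsProjLine F L ↔ ∃ j, L = {P | incident j (φ.symm P) = true})
    (Fs : Finset (Projectivization F (Fin 3 → F))) :
    (CF F Fs).map (pull φ) = evenPart (Fs.map φ.symm.toEmbedding) := by
  rw [CF, evenPart, Submodule.map_inf _
    (LinearMap.funLeft_injective_of_surjective _ _ _ φ.surjective), CDK_map φ hφ]
  congr 1
  ext w
  constructor
  · rintro ⟨v, hv, rfl⟩
    have hv' : (∑ x ∈ Fs, LinearMap.proj x :
      (Projectivization F (Fin 3 → F) → ZMod 2) →ₗ[ZMod 2] ZMod 2) v = 0 := hv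
    change (∑ x ∈ _, LinearMap.proj x : Word →ₗ[ZMod 2] ZMod 2) _ = 0
    simpa [Finset.sum_map, LinearMap.funLeft_apply] using hv'
  · intro hw
    have hw' : (∑ x ∈ Fs.map φ.symm.toEmbedding, LinearMap.proj x :
      Word →ₗ[ZMod 2] ZMod 2) w = 0 := hw
    refine ⟨w ∘ φ.symm, ?_, by ext i; simp [LinearMap.funLeft_apply]⟩
    change (∑ x ∈ Fs, LinearMap.proj x :
      (Projectivization F (Fin 3 → F) → ZMod 2) →ₗ[ZMod 2] ZMod 2) _ = 0
    simpa [Finset.sum_map] using hw'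

lemma collinSet_iff (φ : Fin 21 ≃ Projectivization F (Fin 3 → F))
    (hφ : ∀ L, IsProjLine F L ↔ ∃ j, L = {P | incident j (φ.symm P) = true})
    (T : Set (Projectivization F (Fin 3 → F))) :
    CollinSet F T ↔ ∃ j, ∀ P ∈ T, incident j (φ.symm P) = true := by
  constructor
  · rintro ⟨L, hL, hT⟩
    obtain ⟨j, rfl⟩ := (hφ L).mp hL
    exact ⟨j, hT⟩
  · rintro ⟨j, hj⟩
    exact ⟨_, (hφ _).mpr ⟨j, rfl⟩, hj⟩

/-- The code `CF F Fs` on the coordinates provided by `φ` is a good code, and the number of its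
light words is determined by the collinearities in `Fs`. -/
theorem CF_map_spec (φ : Fin 21 ≃ Projectivization F (Fin 3 → F))
    (hφ : ∀ L, IsProjLine F L ↔ ∃ j, L = {P | incident j (φ.symm P) = true})
    (Fs : Finset (Projectivization F (Fin 3 → F))) (hFs : Fs.card = 4) :
    GoodCode9 (Fin 21) ((CF F Fs).map (pull φ)) ∧
    ((∀ T ⊆ Fs, T.card = 3 → ¬ CollinSet F ↑T) → lightWords ((CF F Fs).map (pull φ)) = 13) ∧
    ((∃! T, T ⊆ Fs ∧ T.card = 3 ∧ CollinSet F ↑T) → lightWords ((CF F Fs).map (pull φ)) = 9) ∧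
    (CollinSet F ↑Fs → lightWords ((CF F Fs).map (pull φ)) = 5) := by
  rw [CF_map φ hφ]
  set T := Fs.map φ.symm.toEmbedding with hTdef
  have hT : T.card = 4 := by rw [hTdef, Finset.card_map, hFs]
  have hhits : ∀ j, hits T j = (Fs.filter fun P => incident j (φ.symm P) = true).card := by
    intro j
    rw [hits, hTdef, Finset.filter_map, Finset.card_map]
    rfl
  obtain ⟨h13, h9, h5⟩ := lightWords_cases hT
  obtain ⟨j, hj⟩ := exists_hits_odd hT
  have htriple : ∀ j, 3 ≤ hits T j → ∃ U ⊆ Fs, U.card = 3 ∧ CollinSet F ↑U := by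
    intro j hj
    rw [hhits] at hj
    obtain ⟨U, hU, hU3⟩ := Finset.exists_subset_card_eq hj
    refine ⟨U, hU.trans (Finset.filter_subset _ _), hU3, (collinSet_iff φ hφ _).mpr ⟨j, ?_⟩⟩
    exact fun P hP => (Finset.mem_filter.mp (hU hP)).2
  refine ⟨goodCode9_evenPart hT hj, fun h => h13 fun j => ?_, fun h => ?_, fun h => h5 ?_⟩
  · by_contra! hj
    obtain ⟨U, hU, hU3, hUc⟩ := htriple j hj
    exact h U hU hU3 hUc
  · obtain ⟨U, ⟨hU, hU3, hUc⟩, huniq⟩ := h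
    have h4 : ∀ j, hits T j ≠ 4 := by
      intro j hj
      rw [hhits, ← hFs, Finset.card_filter_eq_iff] at hj
      have hall : ∀ V ⊆ Fs, V.card = 3 → V = U := fun V hV hV3 =>
        huniq V ⟨hV, hV3, (collinSet_iff φ hφ _).mpr ⟨j, fun P hP => hj P (hV hP)⟩⟩
      obtain ⟨P, hP, hPU⟩ : ∃ P ∈ Fs, P ∉ U := by
        by_contra! hsub
        have := Finset.card_le_card hsub
        omega
      obtain ⟨Q, hQ⟩ : U.Nonempty := Finset.card_pos.mp (by omega)
      classical
      have := hall (Fs.erase Q) (Finset.erase_subset _ _) (by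
        rw [Finset.card_erase_of_mem (hU hQ), hFs])
      rw [← this] at hQ
      exact Finset.notMem_erase _ _ hQ
    refine h9 ?_ h4
    obtain ⟨j, hj⟩ := (collinSet_iff φ hφ _).mp hUc
    refine ⟨j, ?_⟩
    have h3 : 3 ≤ hits T j := by
      rw [hhits]
      exact hU3.symm.le.trans
        (Finset.card_le_card fun P hP => Finset.mem_filter.mpr ⟨hU hP, hj P hP⟩)
    have hle : hits T j ≤ 4 := hT ▸ Finset.card_filter_le _ _
    have := h4 j
    omega
  · obtain ⟨j, hj⟩ := (collinSet_iff φ hφ _).mp h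
    refine ⟨j, ?_⟩
    rw [hhits, ← hFs, Finset.card_filter_eq_iff]
    exact hj

end Geometry

/-- The constraints at the coordinate `i` on a word that is to be added to the words `prev`:
the last bit demands sortedness at a place where the words `prev` do not change, the next one
vanishing, and the remaining part prescribes the sum with the preceding coordinate. -/
def posCode (prev zs : List ℕ) (lam i : ℕ) : ℕ :=
  (bif !Nat.beq i 0 && prev.all fun m => Nat.beq (mbit m (i - 1)) (mbit m i) then 1 else 0) +
  (bif zs.any (Nat.beq i) then 2 else 0) +
  (bif Nat.ble 5 i && Nat.beq (i % 2) 0 then 4 * (1 + mbit lam i) else 0)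

/-- The constraint encoded by `posCode` for a coordinate `b` following a coordinate `last`. -/
def codeOK (c last b : ℕ) : Bool :=
  (Nat.beq (c % 2) 0 || Nat.ble last b) && (Nat.beq (c / 2 % 2) 0 || Nat.beq b 0) &&
    (Nat.beq (c / 4) 0 || Nat.beq ((last + b) % 2 + 1) (c / 4))

/-- All numbers `acc + pw * m`, where `m` encodes a word subject to the given constraints,
prepended to the list `tl`. -/
def walks : List ℕ → ℕ → ℕ → ℕ → List ℕ → List ℕ
  | [], _, _, acc, tl => acc :: tl
  | c :: cs, last, pw, acc, tl => forceNat (32 * pw) fun pw' =>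
      (fun tl' => bif codeOK c last 0 then walks cs 0 pw' acc tl' else tl')
        (bif codeOK c last 1 then forceNat (acc + pw) fun a => walks cs 1 pw' a tl else tl)

/-- The list of all sums of `g` with the words of `sp` has weights among 8, 12, 16. -/
def goodExt (sp : List ℕ) (g : ℕ) : Bool :=
  sp.all fun s => (fun t => Nat.beq t 8 || Nat.beq t 12 || Nat.beq t 16) ((s ^^^ g) % 31)

/-- The first of the coordinates `0, …, 4` at which `g` does not vanish. -/
def firstBit (g : ℕ) : Option ℕ := (List.range 5).find? fun i => Nat.beq (mbit g i) 1

/-- All extensions of the list `prev` by words with prescribed pair sums `lams`. -/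
def search : List ℕ → List ℕ → List ℕ → List ℕ → List (List ℕ)
  | [], _, _, prev => [prev]
  | lam :: lams, zs, sp, prev =>
    forceList ((List.range 21).map (posCode prev zs lam)) fun cs =>
      (walks cs 0 1 0 []).flatMap fun g =>
        bif goodExt sp g then
          forceList (sp ++ xorAll g sp) fun sp' =>
            forceList ((firstBit g).toList ++ zs) fun zs' => search lams zs' sp' (g :: prev)
        else []

def maskX : ℕ := 1307265928191301999315308773376
def maskY : ℕ := 1308541307152064730087869644800
def maskZ : ℕ := 1308542555073111205153131724800
def maskW : ℕ := 1308542555074301317674015129600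

def baseSpan : List ℕ := spanList [maskX, maskY, maskZ, maskW]

def solutions (lams : List ℕ) : List (List ℕ) :=
  forceList baseSpan fun sp => search lams [5, 7, 9, 13] sp [maskX, maskY, maskZ, maskW]

lemma subset_walks (cs : List ℕ) (last pw acc : ℕ) (tl : List ℕ) :
    ∀ m ∈ tl, m ∈ walks cs last pw acc tl := by
  induction cs generalizing last pw acc tl with
  | nil => intro m hm; simp [walks, hm]
  | cons c cs ih =>
    intro m hm
    simp only [walks, forceNat_eq]
    cases codeOK c last 0 <;> cases codeOK c last 1 <;> simp only [cond_true, cond_false]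
    · exact hm
    · exact ih _ _ _ _ _ hm
    · exact ih _ _ _ _ _ hm
    · exact ih _ _ _ _ _ (ih _ _ _ _ _ hm)

lemma mem_walks {f l c : ℕ → ℕ} (hf : ∀ i, f i < 2) (hl : ∀ i, l (i + 1) = f i) (n i : ℕ)
    (h : ∀ j, i ≤ j → j < i + n → codeOK (c j) (l j) (f j) = true) (pw acc : ℕ) (tl : List ℕ) :
    acc + pw * digits32 f n i ∈ walks ((List.range' i n).map c) (l i) pw acc tl := by
  induction n generalizing i pw acc tl with
  | zero => simp [walks, digits32]
  | succ n ih =>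
    have hi := h i le_rfl (by omega)
    have hj := fun pw acc tl => ih (i + 1) (fun j h1 h2 => h j (by omega) (by omega)) pw acc tl
    rw [hl] at hj
    have hfi := hf i
    simp only [List.range'_succ, List.map_cons, walks, forceNat_eq, digits32]
    rcases (show f i = 0 ∨ f i = 1 by omega) with h0 | h0
    · rw [h0] at hi hj ⊢
      rw [hi, cond_true]
      convert hj (32 * pw) acc _ using 1
      ring
    · rw [h0] at hi hj ⊢
      rw [hi, cond_true]
      have hm := hj (32 * pw) (acc + pw) tl
      rw [show acc + pw * (1 + 32 * digits32 f n (i + 1)) =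
        acc + pw + 32 * pw * digits32 f n (i + 1) by ring]
      cases codeOK (c i) (l i) 0
      · exact hm
      · exact subset_walks _ _ _ _ _ _ hm

lemma codeOK_of {A B P : Bool} {L u v : ℕ} (hL : L < 2) (hu : u < 2) (hv : v < 2)
    (hB : B = true → u ≤ v) (hA : A = true → v = 0) (hP : P = true → (u + v) % 2 = L) :
    codeOK ((bif B then 1 else 0) + (bif A then 2 else 0) + (bif P then 4 * (1 + L) else 0)) u v =
      true := by
  interval_cases L <;> interval_cases u <;> interval_cases v <;> revert A B P <;> decide

/-- The conditions on a word imposed by `posCode`. -/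
structure Fits (prev zs : List ℕ) (lam : ℕ) (g : Word) : Prop where
  sorted : ∀ i, i + 1 < 21 → (∀ m ∈ prev, mbit m i = mbit m (i + 1)) → g.bit i ≤ g.bit (i + 1)
  zero : ∀ i ∈ zs, g.bit i = 0
  pair : ∀ i, 4 ≤ i → i + 1 < 21 → i % 2 = 1 → (g.bit i + g.bit (i + 1)) % 2 = mbit lam (i + 1)

lemma Fits.mem_walks {prev zs : List ℕ} {lam : ℕ} {g : Word} (h : Fits prev zs lam g) :
    enc g ∈ walks ((List.range 21).map (posCode prev zs lam)) 0 1 0 [] := by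
  have := _root_.mem_walks (f := g.bit) (l := fun i => Nat.casesOn i 0 g.bit)
    (c := posCode prev zs lam) g.bit_lt (fun _ => rfl) 21 0 ?_ 1 0 []
  · simpa [enc, List.range_eq_range'] using this
  · intro j _ hj
    have hz : zs.any (Nat.beq j) = true → g.bit j = 0 := by
      intro hz
      obtain ⟨i, hi, hij⟩ := List.any_eq_true.mp hz
      rw [Nat.eq_of_beq_eq_true hij]
      exact h.zero i hi
    have hlam : mbit lam j < 2 := Nat.mod_lt _ two_pos
    cases j with
    | zero =>
      exact codeOK_of hlam two_pos (g.bit_lt _) (fun hs => by simp at hs) hz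
        (fun hs => by simp at hs)
    | succ i =>
      refine codeOK_of hlam (g.bit_lt _) (g.bit_lt _) (fun hs => ?_) hz (fun hs => ?_)
      · rw [Bool.and_eq_true] at hs
        exact h.sorted i (by omega) fun m hm =>
          Nat.eq_of_beq_eq_true (List.all_eq_true.mp hs.2 m hm)
      · simp only [Bool.and_eq_true, Nat.ble_eq, Nat.beq_eq] at hs
        exact h.pair i (by omega) (by omega) (by omega)

/-- The conditions on a list of words under which `search` finds it. -/
def Found : List ℕ → List ℕ → List ℕ → List ℕ → List Word → Prop
  | [], _, _, _, [] => True
  | lam :: lams, zs, sp, prev, g :: gs => Fits prev zs lam g ∧ goodExt sp (enc g) = true ∧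
      Found lams ((firstBit (enc g)).toList ++ zs) (sp ++ xorAll (enc g) sp) (enc g :: prev) gs
  | _, _, _, _, _ => False

lemma Found.mem_search {lams zs sp prev : List ℕ} {gs : List Word}
    (h : Found lams zs sp prev gs) : (gs.map enc).reverse ++ prev ∈ search lams zs sp prev := by
  induction lams generalizing zs sp prev gs with
  | nil =>
    cases gs with
    | nil => simp [search]
    | cons => exact h.elim
  | cons lam lams ih =>
    cases gs with
    | nil => exact h.elim
    | cons g gs =>
      obtain ⟨h1, h2, h3⟩ := h
      simp only [search, forceList_eq, List.mem_flatMap]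
      refine ⟨_, h1.mem_walks, ?_⟩
      rw [h2, cond_true]
      simpa using ih h3

/-- The rearrangement of the coordinates encoded by the base-21 digits of `c`. -/
def arrange (c : ℕ) (i : Fin 21) : Fin 21 := ⟨c / 21 ^ (i : ℕ) % 21, Nat.mod_lt _ (by norm_num)⟩

/-- The encoded word `m` with rearranged coordinates. -/
def gather (c m : ℕ) : ℕ := digits32 (fun i => mbit m (c / 21 ^ i % 21)) 21 0

lemma dec_gather (c m : ℕ) : dec (gather c m) = dec m ∘ arrange c := by
  funext i
  have h : mbit (gather c m) i = mbit m (arrange c i) := by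
    rw [gather, digits32_div _ (fun _ => mbit_lt _ _) _ _ _ i.2, zero_add]
    rfl
  simp only [dec, Function.comp, h]

/-- Whether `c` encodes a permutation that carries the words of `s` into the span of `R`. -/
def carries (R : List (ℕ × ℕ)) (c : ℕ) (s : List ℕ) : Bool :=
  ((List.range 21).all fun j => (List.range 21).any fun i => Nat.beq (c / 21 ^ i % 21) j) &&
    s.all fun m => forceNat (gather c m) fun w => Nat.beq (reduce R w w) 0

lemma codeEquiv_of_carries {R : List (ℕ × ℕ)} {c : ℕ} {s : List ℕ} (h : carries R c s = true)
    {C : Submodule (ZMod 2) Word} (hC : C ≤ spanOf s) (hR : R.length ≤ Module.finrank (ZMod 2) C) :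
    CodeEquiv (Fin 21) C (spanOf (R.map Prod.snd)) := by
  rw [carries, Bool.and_eq_true, List.all_eq_true, List.all_eq_true] at h
  obtain ⟨h1, h2⟩ := h
  have hsurj : Function.Surjective (arrange c) := by
    intro j
    obtain ⟨i, hi, hij⟩ := List.any_eq_true.mp (h1 j (List.mem_range.mpr j.2))
    exact ⟨⟨i, List.mem_range.mp hi⟩, Fin.ext (Nat.eq_of_beq_eq_true hij)⟩
  let σ : Equiv.Perm (Fin 21) := Equiv.ofBijective _ (Finite.injective_iff_bijective.mp
    (Finite.injective_iff_surjective.mpr hsurj))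
  refine ⟨σ, Submodule.eq_of_le_of_finrank_le ?_ ?_⟩
  · refine (Submodule.map_mono hC).trans ?_
    rw [spanOf, Submodule.map_span_le]
    rintro _ ⟨m, hm, rfl⟩
    have h3 := h2 m hm
    rw [forceNat_eq] at h3
    have h4 := dec_mem_spanOf_of_reduce h3
    rwa [dec_gather] at h4
  · rw [finrank_map_funLeft]
    refine le_trans ?_ hR
    exact (finrank_spanOf_le _).trans (List.length_map _).le

/-- Whether the entries of a list of certificates carry the lists in `ss` to the codes `Rs`. -/
def allCarried (Rs : ℕ → List (ℕ × ℕ)) : List (List ℕ) → List ℕ → Bool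
  | [], _ => true
  | _ :: _, [] => false
  | s :: ss, c :: cs => carries (Rs (c % 3)) (c / 3) s && allCarried Rs ss cs

lemma exists_of_allCarried {Rs : ℕ → List (ℕ × ℕ)} {ss : List (List ℕ)} {cs : List ℕ}
    (h : allCarried Rs ss cs = true) {s : List ℕ} (hs : s ∈ ss) :
    ∃ k c, k < 3 ∧ carries (Rs k) c s = true := by
  induction ss generalizing cs with
  | nil => simp at hs
  | cons t ss ih =>
    cases cs with
    | nil => simp [allCarried] at h
    | cons c cs =>
      rw [allCarried, Bool.and_eq_true] at h
      rcases List.mem_cons.mp hs with rfl | hs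
      · exact ⟨_, _, Nat.mod_lt _ (by norm_num), h.1⟩
      · exact ih h.2 hs

/-- The full word. -/
def maskFull : ℕ := 1308542555074301317674016212001

/-- Generators, with leading coordinates, of codes with 13, 9 and 5 words of weight 5. -/
def normalGens : ℕ → List (ℕ × ℕ)
  | 0 => [(0, 1308541307150874618701964902401),
      (1, 40853268002323074062521205792),
      (3, 38723405160658090170810368),
      (4, 1267651809155201938729997434880),
      (5, 1267689324814017709101337804800),
      (6, 1268889750375080065623287398400),
      (7, 1307265928191301999315308773376),
      (9, 1308541307152064730087869644800),
      (13, 1308542555073111205153131724800)]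
  | 1 => [(0, 1268889750375080065623287398401),
      (1, 39615329143665344401563975712),
      (2, 1267690532560397498618841400320),
      (3, 40891915849654908037042831360),
      (4, 37155797512224768),
      (5, 1277872371453476297559244800),
      (7, 1307265928191301999315308773376),
      (9, 1308541307152064730087869644800),
      (13, 1308542555073111205153131724800)]
  | _ => [(0, 1307264681486550520595100991489),
      (1, 1237977819407320533106163744),
      (2, 1267690532560362594621144957952),
      (3, 40891915849617754438555959296),
      (5, 1267689324814017709101337804800),
      (6, 1268889750375080065623287398400),
      (7, 1307265928191301999315308773376),
      (9, 1308541307152064730087869644800),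
      (13, 1308542555073111205153131724800)]

/-- Rearrangements for the elements of `solutions`. -/
def certsD : List ℕ := [
  17483941652520052695233014830,
  10472873280973233667756826670,
  17483941652520052695232960650,
  10472873280973233667756772490,
  16687225240943028584736377790,
  10472869184344711719473392830,
  16687225240943028584736323610,
  10472869184344711719473338650,
  16687229337529421919349155390,
  9676160965982602891872967230,
  16687229337529421919349101210,
  9676160965982602891872913050,
  17483937555891530746949580990,
  9676156869396209557260189630,
  17483937555891530746949526810,
  9676156869396209557260135450,
  14942389220782552134383176350,
  7931320849235733106906988190,
  15739105632359576244879813390,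
  7931324945822126441519765790,
  15739101535731054296596379550,
  8728033164184235269120191390,
  14942393317368945468995953950,
  8728037260812757217403625230,
  16683268696679626143805874430,
  17479981011628128306019077630,
  17479985108256650254301291790,
  16683272793266019478417432350,
  17479985108256650254302511470,
  16683272793266019478418652030,
  16683268696679626143804654750,
  17479981011628128306017857950,
  17478182582417585930343813630,
  16685075300568398257552389630,
  16685071222476656951567661150,
  17478178504367782610818561950,
  16685071222476656951568880830,
  17478178504367782610819781630,
  17478182582417585930342593950,
  16685075300568398257551169950,
  17483941652520052695233014832,
  10472873280973233667756826672,
  16687225240943028584736377792,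
  10472869184344711719473392832,
  16687229337529421919349155392,
  9676160965982602891872967232,
  17483937555891530746949580992,
  9676156869396209557260189632,
  16671331223308227318379821630,
  9691987143035375797815290430,
  9691987143035375797815236250,
  16671331223308227318379767450,
  17466241012459793770304983230,
  9693789650337754576949028030,
  9693789650337754576948973850,
  17466241012459793770304929050,
  17468043538298858094263681070,
  10488699458026006573699149870,
  10488699458026006573699095690,
  17468043538298858094263626890,
  16673133730610606097513559230,
  10486896932186942249740452030,
  10486896932186942249740397850,
  16673133730610606097513505050,
  7948953630177278126595826590,
  14928297710450129647160357790,
  7947151122874899347462088990,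
  15723207518138381643910479630,
  8742060912026465799387250590,
  15721404992299317319951781790,
  8743863437865530123345948430,
  14926495203147750868026620190,
  10484738817134082184485212670,
  9688026502185580022272009470,
  9688030598771973356883567390,
  10484742913762604132767426830,
  10482936309873736489285916670,
  9689829027982610830035015870,
  9689833106074352136017304990,
  10482940387923539808808728990,
  9689833106074352136018524670,
  10482940387923539808809948670,
  10482936309873736489284696990,
  9689829027982610830033796190,
  9688030598771973356884787070,
  10484742913762604132768646510,
  10484738817134082184483992990,
  9688026502185580022270789790]

/-- Rearrangements for the elements of `solutions`. -/
def certsE : List ℕ := [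
  16607918609362469290160548170,
  16607918600094126625813380510,
  16570065761817617908711687590,
  16570065752549275244364519930,
  13936931551831938397723744650,
  13899078704288135465936370990,
  13936931561099232612409425390,
  13899078713555429680622051730,
  16607905540934118054430779090,
  16607909628273233031531717150,
  16570052693412332565534630750,
  16570056780751447542635568810,
  17359216490155076095656816810,
  17359216499423418760003984470,
  16486798489343180534827993590,
  16486798480074837870480825930,
  14186769428408328027250032870,
  14186765341069213050149094810,
  13314347331035106610078528410,
  13314351418374221587179466470,
  17192659832930990584274719950,
  16320245919458210000546834790,
  17192663929538448225722825670,
  16320241822850752359098729070]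

/-- Rearrangements for the elements of `solutions`. -/
def certsF : List ℕ := [
  14842867058547376129030217792,
  15554844347787475836877988250,
  14803031647651388096101414592,
  15556646873626540160836686090,
  13227491597195704427771375072,
  15396223707115668284944293630,
  13651387687047455404801941150,
  14060258525111662299382549472,
  15398026232954732608902991470,
  12856477897895888952876779550,
  12059766361530299188913665290,
  12377007642873914292781058670,
  12057963835691234864954967450,
  12375205117034849968822360830,
  15637776847698942580955379392,
  14759934558635909384952826650,
  15677432415718006585996631072,
  14761737065938288164086564250,
  14099914093130726304423801152,
  14561478507068113800090328830,
  12816642486999900919947976350,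
  13267147165170733320607616672,
  14563461265054494064809554430,
  13691043255066519409843192830,
  11225201393630060644820228250,
  11582097835185662296030936830,
  11223218635643680380101002650,
  11580295327883283516897199230,
  15679410687849707806461882752,
  14720099147739921352024023450,
  15639575276909484956630643392,
  14722081905726301616743249050,
  13267151243262474626591125472,
  14601313917964101833019132030,
  13653190212886519728760638990,
  14099909607229810867841941472,
  14603116425266480612152869630,
  12858280405198267732010517150,
  12099602182087032758535526170,
  12416843463430647862402919550,
  12097619403710298869996219130,
  12414860685053913973863612510,
  14805009919782984709344204992,
  15594499915806539841919239930,
  14844665487758013602180446592,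
  15596482694183273730458546970,
  14060254447061858979858517472,
  15435879275134732289985545310,
  12818625244986281184667201950,
  13227496083050488079247810272,
  15437862053511466178524852350,
  13693026033443253298382499870,
  11264856553842047192163543450,
  11542442674973675748687621630,
  11263054046539668413029805850,
  11540459916987295483968396030,
  17366425981716651211054849952,
  10373154685330283853000612030,
  16310280043201559994324464670,
  16494007971636412985878859072,
  9496775645131964142640143870,
  17186663589644912372758988190,
  13289277839466315016654861950,
  16468900683873367546259326170,
  14165661385909667395089385470,
  17345284230316719924693849690,
  14165644999564094056637055390,
  13289261453120741678202531870,
  16494003485781629334402423872,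
  10371171927297667195953500670,
  17145025243249114479178429470,
  17366421495815735774472990272,
  9498758403118344407359369470,
  16351917961399926806387005470,
  14163678607532933506550078430,
  17343301451939986036154542650,
  13291260597452695281374087550,
  16470883441859747810978551770,
  13291244211107121942921757470,
  14163662221187360168097748350,
  16533659053756658227238665472,
  9536606959441558840956169470,
  17184680811268178484219681150,
  17326766335647783886489566272,
  10333323371018582951452806510,
  16312262801187940259043690270,
  13329109153775909714970887550,
  17303645883920922031113290970,
  14125821468724411877184090750,
  16510538602071734358321866970,
  14125809179007360487015194510,
  13329096864016729711131335070,
  17326770413697587206013598272,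
  9538409485238589648719175870,
  16350115454097548027253267870,
  16533663131848399533222174272,
  10331520845179518627494108670,
  17146827769088178803137127310,
  14124018961464066181984794750,
  16508736094769355579188129370,
  13330911679572940522733893950,
  17305448409759986355071988810,
  13330899371319108490265072670,
  14124006653168296163056496670,
  17483941652520052695233014831,
  16689027766740059392499384191,
  17483923627539922022936793391,
  16689009741759928720203162751,
  13183475555986519206465068671,
  13978389441766512509198699311,
  6989307725289381147650894131,
  6194402014187618015249764531,
  16687211312549291247052933951,
  17482117023651054379454063551,
  13976582837877644865715969471,
  13181677126775881733314839871,
  16687229337529421919349155391,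
  17482135048631185051750284991,
  6989325668708515753556634931,
  6194419957606752621155505331,
  6188305298291003641334572531,
  6983219184070996944068203171,
  6991114329178248791133623971,
  6196200443398255488399993331,
  6991132272597383397039364771,
  6196218386817390094305734131,
  6186506869080366168184343731,
  6981412580182129300585473331,
  17479958070786454245858179311,
  8734170660578559506861487091,
  13179545967631898278698571711,
  14926522118645507057729291251,
  16683245755795823469974319871,
  8735977264467427150344216931,
  13974459853411891581432202351,
  15721427829747270190130420851,
  16685044185006460943124548671,
  7939264949476796374460357491,
  13177747538421260805548342911,
  15723234433636137833613150691,
  17478151466897586602375449471,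
  7941063378687433847610586291,
  13972653249523023937949472511,
  14928320547856144530879520051,
  16681069656451162292882215231,
  10480813284535640030485349731,
  17474176938342287952133116031,
  10479006680646772387002619891,
  17475983542231155595615845871,
  9685899398755646727751719091,
  16679271227240524819731986431,
  9684100969545009254601490291]

lemma solutionsA : solutions [0, 0] = [] := by decide +kernel

lemma solutionsB : solutions [0, maskW, 0] = [] := by decide +kernel

lemma solutionsC : solutions [0, maskW, maskW] = [] := by decide +kernel

lemma carriedD : allCarried normalGens ((solutions [0, maskW, maskX, maskY]).map (maskFull :: ·))
    certsD = true := by decide +kernel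

lemma carriedE : allCarried normalGens ((solutions [0, maskX, maskY, maskZ]).map (maskFull :: ·))
    certsE = true := by decide +kernel

lemma carriedF : allCarried normalGens ((solutions [maskW, maskX, maskY, maskZ]).map (maskFull :: ·))
    certsF = true := by decide +kernel

/-- The code spanned by `normalGens k`. -/
def normalCode (k : ℕ) : Submodule (ZMod 2) Word := spanOf ((normalGens k).map Prod.snd)

/-- The generators of the common part of all codes in normal form. -/
def baseGens : List ℕ := [maskX, maskY, maskZ, maskW]

theorem Found.mem_solutions {lams : List ℕ} {gs : List Word}
    (h : Found lams [5, 7, 9, 13] baseSpan baseGens gs) :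
    (gs.map enc).reverse ++ baseGens ∈ solutions lams := by
  rw [solutions, forceList_eq]
  exact h.mem_search

theorem Found.codeEquiv_normalCode {lams : List ℕ}
    (hl : lams = [0, maskW, maskX, maskY] ∨ lams = [0, maskX, maskY, maskZ] ∨
      lams = [maskW, maskX, maskY, maskZ]) {gs : List Word}
    (h : Found lams [5, 7, 9, 13] baseSpan baseGens gs) {C : Submodule (ZMod 2) Word}
    (hfin : Module.finrank (ZMod 2) C = 9)
    (hC : C ≤ spanOf (maskFull :: ((gs.map enc).reverse ++ baseGens))) :
    ∃ k < 3, CodeEquiv (Fin 21) C (normalCode k) := by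
  have hcarried : ∀ {cs}, allCarried normalGens ((solutions lams).map (maskFull :: ·)) cs = true →
      ∃ k < 3, CodeEquiv (Fin 21) C (normalCode k) := by
    intro cs hcs
    obtain ⟨k, c, hk, hc⟩ := exists_of_allCarried hcs (List.mem_map_of_mem h.mem_solutions)
    refine ⟨k, hk, codeEquiv_of_carries hc hC ?_⟩
    rw [hfin]
    interval_cases k <;> decide
  rcases hl with rfl | rfl | rfl
  · exact hcarried carriedD
  · exact hcarried carriedE
  · exact hcarried carriedF

/-- The sign character of the `i`-th coordinate on a code. -/
def signChar {S : Type*} (C : Submodule (ZMod 2) (S → ZMod 2)) (i : S) : AddChar C ℤ where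
  toFun w := if (w : S → ZMod 2) i = 0 then 1 else -1
  map_zero_eq_one' := by simp
  map_add_eq_mul' v w := by
    rw [Submodule.coe_add, Pi.add_apply]
    have h : ∀ a b : ZMod 2, (if a + b = 0 then 1 else -1 : ℤ) =
        (if a = 0 then 1 else -1) * if b = 0 then 1 else -1 := by decide
    exact h _ _

section Moments

variable {S : Type*} (C : Submodule (ZMod 2) (S → ZMod 2))

lemma signChar_mul_self (i : S) : signChar C i * signChar C i = 1 := by
  ext w
  simp only [AddChar.mul_apply, AddChar.one_apply, signChar, AddChar.coe_mk]
  split_ifs <;> norm_num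

variable [Fintype S]

lemma sum_signChar (w : C) :
    ∑ i, signChar C i w = Fintype.card S - 2 * wt (w : S → ZMod 2) := by
  have h : ∀ i, signChar C i w = 1 - 2 * ((w : S → ZMod 2) i).val := by
    intro i
    simp only [signChar, AddChar.coe_mk]
    generalize (w : S → ZMod 2) i = a
    revert a; decide
  simp only [h, wt_eq_sum, Finset.sum_sub_distrib, ← Finset.mul_sum]
  simp

open Classical in
/-- The second moment of the weight distribution. -/
lemma sum_signChar_sq [Fintype C] : ∑ w : C, (∑ i, signChar C i w) ^ 2 = Fintype.card C *
    (Finset.univ.filter fun p : S × S => signChar C p.1 * signChar C p.2 = 1).card := by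
  have h : ∀ w : C, (∑ i, signChar C i w) ^ 2 =
      ∑ p : S × S, (signChar C p.1 * signChar C p.2) w := by
    intro w
    rw [sq, Finset.sum_mul_sum, ← Finset.univ_product_univ, Finset.sum_product]
    rfl
  simp only [h]
  rw [Finset.sum_comm]
  simp only [AddChar.sum_eq_ite]
  rw [Finset.card_filter]
  push_cast
  rw [Finset.mul_sum]
  simp
  rfl

open Classical in
/-- A lower bound for the fourth moment of the weight distribution. -/
lemma le_sum_signChar_pow_four [Fintype C] (N : ℤ)
    (hN : N = (Finset.univ.filter fun p : S × S => signChar C p.1 * signChar C p.2 = 1).card) :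
    Fintype.card C * (N * N + 2 * (Fintype.card S ^ 2 - N)) ≤
      ∑ w : C, (∑ i, signChar C i w) ^ 4 := by
  set ψ : S × S → AddChar C ℤ := fun p => signChar C p.1 * signChar C p.2 with hψ
  have h : ∀ w : C, (∑ i, signChar C i w) ^ 4 = ∑ p, ∑ q, (ψ p * ψ q) w := by
    intro w
    have h2 : (∑ i, signChar C i w) ^ 2 = ∑ p, ψ p w := by
      rw [sq, Finset.sum_mul_sum, ← Finset.univ_product_univ, Finset.sum_product]
      rfl
    rw [show 4 = 2 * 2 from rfl, pow_mul, h2, sq, Finset.sum_mul_sum]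
    rfl
  have h4 : ∑ w : C, (∑ i, signChar C i w) ^ 4 =
      Fintype.card C * ∑ p, ((Finset.univ.filter fun q => ψ p * ψ q = 1).card : ℤ) := by
    simp only [h]
    rw [Finset.sum_comm, Finset.mul_sum]
    refine Finset.sum_congr rfl fun p _ => ?_
    rw [Finset.sum_comm]
    simp only [AddChar.sum_eq_ite]
    rw [Finset.card_filter]
    push_cast
    rw [Finset.mul_sum]
    simp
    rfl
  rw [h4]
  refine mul_le_mul_of_nonneg_left ?_ (Nat.cast_nonneg _)
  have hp : ∀ p, (if ψ p = 1 then N else 2) ≤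
      ((Finset.univ.filter fun q => ψ p * ψ q = 1).card : ℤ) := by
    intro p
    split_ifs with h1
    · simp only [h1, one_mul, hN]; rfl
    · have hne : p ≠ p.swap := by
        rintro hs
        have : p.1 = p.2 := congrArg Prod.fst hs
        exact h1 (by simp only [hψ, this, signChar_mul_self])
      have hsub : ({p, p.swap} : Finset (S × S)) ⊆ Finset.univ.filter fun q => ψ p * ψ q = 1 := by
        intro q hq
        have hpp : ψ p * ψ p = 1 := by
          simp only [hψ]
          rw [mul_mul_mul_comm, signChar_mul_self, signChar_mul_self, one_mul]
        simp only [Finset.mem_insert, Finset.mem_singleton] at hq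
        rw [Finset.mem_filter]
        refine ⟨Finset.mem_univ _, ?_⟩
        rcases hq with rfl | rfl
        · exact hpp
        · rw [← hpp]
          simp only [hψ, Prod.fst_swap, Prod.snd_swap]
          rw [mul_comm (signChar C p.2)]
      have := Finset.card_le_card hsub
      rw [Finset.card_pair hne] at this
      exact_mod_cast this
  refine le_trans (le_of_eq ?_) (Finset.sum_le_sum fun p _ => hp p)
  rw [Finset.sum_ite]
  simp only [Finset.sum_const, nsmul_eq_mul]
  have hc := Finset.card_filter_add_card_filter_not (s := (Finset.univ : Finset (S × S)))
    (fun p => ψ p = 1)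
  rw [Finset.card_univ, Fintype.card_prod] at hc
  have hc' : ((Finset.univ.filter fun p => ¬ ψ p = 1).card : ℤ) = Fintype.card S ^ 2 - N := by
    rw [hN]
    push_cast [← hc, sq]
    zify at hc
    rw [← hc]
    ring
  rw [hc', ← hN]
  ring

end Moments

lemma GoodCode9.exists_wt_sixteen {C : Submodule (ZMod 2) Word} (hC : GoodCode9 (Fin 21) C) :
    ∃ w ∈ C, wt w = 16 := by
  classical
  by_contra! h16
  have hcompl : ∀ w : Word, wt ((fun _ => 1) + w) + wt w = 21 := by
    intro w
    rw [wt_eq_sum, wt_eq_sum, ← Finset.sum_add_distrib]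
    have h : ∀ i, (((fun _ => 1 : Word) + w) i).val + (w i).val = 1 := by
      intro i
      rw [Pi.add_apply]
      generalize w i = a
      revert a; decide
    rw [Finset.sum_congr rfl fun i _ => h i]
    simp
  have hcompl0 : ∀ w : Word, wt w = 0 → w = 0 := by
    intro w hw
    rw [wt_eq_sum, Finset.sum_eq_zero_iff] at hw
    funext i
    simpa using hw i (Finset.mem_univ i)
  have hw : ∀ w ∈ C, w = 0 ∨ w = (fun _ => 1) ∨ wt w = 8 ∨ wt w = 9 ∨ wt w = 12 ∨ wt w = 13 := by
    intro w hw
    have h1 := hC.2.2 w hw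
    have h2 := h16 w hw
    have h3 := h16 _ (C.add_mem hC.2.1 hw)
    have h4 := hcompl w
    simp only [Set.mem_insert_iff, Set.mem_singleton_iff] at h1
    by_cases h0 : wt w = 0
    · exact Or.inl (hcompl0 w h0)
    by_cases h21 : wt w = 21
    · have := hcompl0 _ (show wt ((fun _ => 1) + w) = 0 by omega)
      refine Or.inr (Or.inl ?_)
      have h := congrArg (fun v => (fun _ => 1 : Word) + v) this
      simpa [← add_assoc, CharTwo.add_self_eq_zero] using h
    omega
  have hcard : Fintype.card C = 512 := by
    rw [← Nat.card_eq_fintype_card, Module.natCard_eq_pow_finrank (K := ZMod 2), hC.1, Nat.card_zmod]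
    norm_num
  set f : C → ℤ := fun w => ∑ i, signChar C i w with hf
  have hfw : ∀ w : C, f w = 21 - 2 * wt (w : Word) := fun w => by
    rw [hf]; exact (sum_signChar C w).trans (by simp)
  set N : ℤ := ((Finset.univ.filter
    fun p : Fin 21 × Fin 21 => signChar C p.1 * signChar C p.2 = 1).card : ℤ) with hN
  have m2 : ∑ w, f w ^ 2 = 512 * N := by
    rw [hf, sum_signChar_sq, hcard]; rfl
  have m4 : 512 * (N * N + 2 * (21 ^ 2 - N)) ≤ ∑ w, f w ^ 4 := by
    have := le_sum_signChar_pow_four C N hN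
    rw [hcard] at this
    simpa using this
  have hsum : ∑ w, (f w ^ 4 - 34 * f w ^ 2 + 225) ≤ 2 * 179712 := by
    have hterm : ∀ w : C, f w ^ 4 - 34 * f w ^ 2 + 225 =
        if w ∈ ({0, ⟨_, hC.2.1⟩} : Finset C) then 179712 else 0 := by
      intro w
      rw [hfw]
      simp only [Finset.mem_insert, Finset.mem_singleton]
      by_cases h0 : w = 0
      · have : wt ((w : C) : Word) = 0 := by rw [h0, wt_eq_sum]; simp
        rw [if_pos (Or.inl h0), this]
        norm_num
      by_cases h1 : w = ⟨_, hC.2.1⟩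
      · have : wt ((w : C) : Word) = 21 := by
          rw [h1, wt_eq_sum]; simp [ZMod.val_one]
        rw [if_pos (Or.inr h1), this]
        norm_num
      rw [if_neg (by tauto)]
      rcases hw w w.2 with h | h | h | h | h | h
      · exact absurd (Subtype.ext h) h0
      · exact absurd (Subtype.ext h) h1
      all_goals rw [h]; norm_num
    simp only [hterm]
    rw [Finset.sum_ite_mem, Finset.univ_inter, Finset.sum_const, nsmul_eq_mul]
    refine mul_le_mul_of_nonneg_right ?_ (by norm_num)
    exact_mod_cast Finset.card_le_two
  rw [Finset.sum_add_distrib, Finset.sum_sub_distrib, ← Finset.mul_sum, m2, Finset.sum_const,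
    Finset.card_univ, hcard] at hsum
  norm_num at hsum
  nlinarith [sq_nonneg (N - 18)]

/-- The values at `i` of the words in a list, read as a binary number whose leading digit belongs to
the last word. -/
def key : List Word → Fin 21 → ℕ
  | [], _ => 0
  | w :: l, i => 2 * key l i + (w i).val

lemma key_append (l l' : List Word) (i : Fin 21) :
    key (l ++ l') i = key l' i * 2 ^ l.length + key l i := by
  induction l with
  | nil => simp [key]
  | cons w l ih =>
    simp only [List.cons_append, key, ih, List.length_cons]
    ring

lemma key_lt (l : List Word) (i : Fin 21) : key l i < 2 ^ l.length := by
  induction l with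
  | nil => simp [key]
  | cons w l ih =>
    have := ZMod.val_lt (w i)
    simp only [key, List.length_cons, pow_succ]
    omega

lemma key_eq_iff {l : List Word} {i j : Fin 21} : key l i = key l j ↔ ∀ w ∈ l, w i = w j := by
  induction l with
  | nil => simp [key]
  | cons w l ih =>
    have hi := ZMod.val_lt (w i)
    have hj := ZMod.val_lt (w j)
    rw [List.forall_mem_cons, ← ih, ← (ZMod.val_injective 2).eq_iff]
    simp only [key]
    omega

lemma key_eq_zero_iff {l : List Word} {i : Fin 21} : key l i = 0 ↔ ∀ w ∈ l, w i = 0 := by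
  induction l with
  | nil => simp [key]
  | cons w l ih =>
    rw [List.forall_mem_cons, ← ih, ← ZMod.val_eq_zero]
    simp only [key]
    omega

lemma key_map_comp (l : List Word) (σ : Fin 21 → Fin 21) (i : Fin 21) :
    key (l.map (· ∘ σ)) i = key l (σ i) := by
  induction l with
  | nil => rfl
  | cons w l ih => simp only [List.map_cons, key, ih, Function.comp]

lemma monotone_key_of_append {l l' : List Word} (h : Monotone (key (l ++ l'))) :
    Monotone (key l') := by
  intro i j hij
  have := h hij
  rw [key_append, key_append] at this
  have hj := key_lt l j
  by_contra! hlt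
  have : (key l' j + 1) * 2 ^ l.length ≤ key l' i * 2 ^ l.length := Nat.mul_le_mul_right _ hlt
  rw [add_mul] at this
  omega

lemma bit_le_of_monotone_key {g : Word} {l : List Word} (h : Monotone (key (g :: l))) {i j : Fin 21}
    (hij : i ≤ j) (hl : ∀ w ∈ l, w i = w j) : (g i).val ≤ (g j).val := by
  have := h hij
  simp only [key, key_eq_iff.mpr hl] at this
  omega

lemma eq_of_monotone {n : ℕ} {f g : Fin n → ℕ} (hf : Monotone f) (hg : Monotone g)
    (h : ∀ a, (Finset.univ.filter fun i => f i = a).card =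
      (Finset.univ.filter fun i => g i = a).card) : f = g := by
  apply List.ofFn_injective
  refine List.Perm.eq_of_sortedLE hf.sortedLE_ofFn hg.sortedLE_ofFn ?_
  rw [← Multiset.coe_eq_coe, ← Fin.univ_val_map, ← Fin.univ_val_map]
  ext a
  rw [Multiset.count_map, Multiset.count_map]
  simpa [Finset.card, eq_comm] using h a

/-- The words underlying the normal form. -/
def baseWords : List Word := [dec maskX, dec maskY, dec maskZ, dec maskW]

/-- Words `x`, `y`, `z`, `Z` that can be rearranged to `baseWords`. -/
structure Frame (x y z Z : Word) : Prop where
  zero : ∀ i, Z i = 0 → x i = 0 ∧ y i = 0 ∧ z i = 0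
  wt_Z : wt Z = 16
  wt_x : wt x = 8
  wt_y : wt y = 8
  wt_z : wt z = 8
  wt_xy : wt (x + y) = 8
  wt_xz : wt (x + z) = 8
  wt_yz : wt (y + z) = 8
  wt_xyz : wt (x + y + z) = 8

lemma wt_of_key {l : List Word} {w : Word} (φ : ℕ → ℕ) (h : ∀ i, (w i).val = φ (key l i)) :
    wt w = ∑ a ∈ Finset.range (2 ^ l.length),
      (Finset.univ.filter fun i => key l i = a).card * φ a := by
  rw [wt_eq_sum, ← Finset.sum_fiberwise_of_maps_to (t := Finset.range (2 ^ l.length))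
    (g := key l) fun i _ => Finset.mem_range.mpr (key_lt l i)]
  refine Finset.sum_congr rfl fun a _ => ?_
  rw [Finset.sum_congr rfl fun i hi => (h i).trans (congrArg φ (Finset.mem_filter.mp hi).2),
    Finset.sum_const, smul_eq_mul]

lemma Frame.card_key {x y z Z : Word} (h : Frame x y z Z) (a : ℕ) :
    (Finset.univ.filter fun i => key [x, y, z, Z] i = a).card =
      if a = 0 then 5 else if 8 ≤ a ∧ a < 16 then 2 else 0 := by
  have hk : ∀ i, key [x, y, z, Z] i =
      (x i).val + 2 * (y i).val + 4 * (z i).val + 8 * (Z i).val := by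
    intro i; simp only [key]; ring
  have hb := fun (w : Word) i => ZMod.val_lt (w i)
  have hadd : ∀ a b : ZMod 2, (a + b).val = (a.val + b.val) % 2 := ZMod.val_add
  set n : ℕ → ℕ := fun a => (Finset.univ.filter fun i => key [x, y, z, Z] i = a).card with hn
  have hout : ∀ a, (∀ i, key [x, y, z, Z] i ≠ a) → n a = 0 := by
    intro a ha
    simp only [hn, Finset.card_eq_zero, Finset.filter_eq_empty_iff]
    exact fun i _ => ha i
  have hlow : ∀ a, 1 ≤ a → a < 8 → n a = 0 := by
    refine fun a h1 h2 => hout a fun i hi => ?_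
    rw [hk] at hi
    by_cases hZ : Z i = 0
    · obtain ⟨h1, h2, h3⟩ := h.zero i hZ
      rw [hZ, h1, h2, h3] at hi
      simp at hi
      omega
    · rcases ZMod.val_two_cases (Z i) with hZ' | hZ'
      · exact hZ hZ'
      · rw [hZ', ZMod.val_one] at hi
        omega
  have hhigh : ∀ a, 16 ≤ a → n a = 0 := by
    refine fun a h1 => hout a fun i hi => ?_
    have := key_lt [x, y, z, Z] i
    simp at this
    omega
  have htot : 21 = ∑ a ∈ Finset.range 16, n a := by
    have := Finset.card_eq_sum_card_fiberwise (s := (Finset.univ : Finset (Fin 21)))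
      (t := Finset.range 16) (f := key [x, y, z, Z])
      fun i _ => Finset.mem_coe.mpr (Finset.mem_range.mpr (key_lt [x, y, z, Z] i))
    simpa using this
  have hX : ∀ i, (x i).val = key [x, y, z, Z] i % 2 := fun i => by
    have := hb x i; rw [hk]; omega
  have hY : ∀ i, (y i).val = key [x, y, z, Z] i / 2 % 2 := fun i => by
    have := hb x i; have := hb y i; rw [hk]; omega
  have hZ : ∀ i, (z i).val = key [x, y, z, Z] i / 4 % 2 := fun i => by
    have := hb x i; have := hb y i; have := hb z i; rw [hk]; omega
  have hW : ∀ i, (Z i).val = key [x, y, z, Z] i / 8 % 2 := fun i => by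
    have := hb x i; have := hb y i; have := hb z i; have := hb Z i; rw [hk]; omega
  have e1 := h.wt_Z.symm.trans (wt_of_key (fun a => a / 8 % 2) hW)
  have e2 := h.wt_x.symm.trans (wt_of_key (fun a => a % 2) hX)
  have e3 := h.wt_y.symm.trans (wt_of_key (fun a => a / 2 % 2) hY)
  have e4 := h.wt_z.symm.trans (wt_of_key (fun a => a / 4 % 2) hZ)
  have e5 := h.wt_xy.symm.trans (wt_of_key (l := [x, y, z, Z])
    (fun a => (a % 2 + a / 2 % 2) % 2) fun i => by rw [Pi.add_apply, hadd, hX, hY])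
  have e6 := h.wt_xz.symm.trans (wt_of_key (l := [x, y, z, Z])
    (fun a => (a % 2 + a / 4 % 2) % 2) fun i => by rw [Pi.add_apply, hadd, hX, hZ])
  have e7 := h.wt_yz.symm.trans (wt_of_key (l := [x, y, z, Z])
    (fun a => (a / 2 % 2 + a / 4 % 2) % 2) fun i => by rw [Pi.add_apply, hadd, hY, hZ])
  have e8 := h.wt_xyz.symm.trans (wt_of_key (l := [x, y, z, Z])
    (fun a => ((a % 2 + a / 2 % 2) % 2 + a / 4 % 2) % 2) fun i => by
      rw [Pi.add_apply, Pi.add_apply, hadd, hadd, hX, hY, hZ])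
  change n a = _
  change 16 = ∑ a ∈ Finset.range 16, n a * _ at e1
  change 8 = ∑ a ∈ Finset.range 16, n a * _ at e2 e3 e4 e5 e6 e7 e8
  simp only [Finset.sum_range_succ, Finset.sum_range_zero] at htot e1 e2 e3 e4 e5 e6 e7 e8
  norm_num at htot e1 e2 e3 e4 e5 e6 e7 e8
  have := hlow 1; have := hlow 2; have := hlow 3; have := hlow 4
  have := hlow 5; have := hlow 6; have := hlow 7
  split_ifs with h0 h8
  · subst h0; omega
  · obtain ⟨h1, h2⟩ := h8
    interval_cases a <;> omega
  · by_cases h16 : 16 ≤ a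
    · exact hhigh a h16
    · exact hlow a (by omega) (by omega)

/-- Sorting the coordinates by the words of a frame yields the normal form. -/
lemma Frame.comp_eq {x y z Z : Word} (h : Frame x y z Z) {σ : Equiv.Perm (Fin 21)}
    (hσ : Monotone (key ([x, y, z, Z].map (· ∘ σ)))) : [x, y, z, Z].map (· ∘ σ) = baseWords := by
  have hmono : ∀ i j, i ≤ j → key baseWords i ≤ key baseWords j := by decide +kernel
  have hcard : ∀ a, (Finset.univ.filter fun i => key baseWords i = a).card =
      if a = 0 then 5 else if 8 ≤ a ∧ a < 16 then 2 else 0 := by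
    intro a
    by_cases ha : a < 16
    · revert a
      decide +kernel
    · rw [if_neg (by omega), if_neg (by omega), Finset.card_eq_zero, Finset.filter_eq_empty_iff]
      intro i _
      have := key_lt baseWords i
      simp [baseWords] at this ⊢
      omega
  have hkey := eq_of_monotone hσ (fun i j => hmono i j) fun a => by
    rw [hcard, ← h.card_key]
    simp only [key_map_comp]
    exact Finset.card_bij (fun i _ => σ i) (by simp) (by simp)
      fun i hi => ⟨σ.symm i, by simpa using hi, by simp⟩
  have hval : ∀ a b : ZMod 2, a.val = b.val → a = b := fun a b h => ZMod.val_injective 2 h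
  have hbits : ∀ i, (x (σ i) = dec maskX i ∧ y (σ i) = dec maskY i) ∧
      z (σ i) = dec maskZ i ∧ Z (σ i) = dec maskW i := by
    intro i
    have := congrFun hkey i
    simp only [List.map_cons, List.map_nil, key, baseWords, Function.comp] at this
    have h1 := ZMod.val_lt (x (σ i)); have h2 := ZMod.val_lt (y (σ i))
    have h3 := ZMod.val_lt (z (σ i)); have h4 := ZMod.val_lt (Z (σ i))
    have k1 := ZMod.val_lt (dec maskX i); have k2 := ZMod.val_lt (dec maskY i)
    have k3 := ZMod.val_lt (dec maskZ i); have k4 := ZMod.val_lt (dec maskW i)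
    exact ⟨⟨hval _ _ (by omega), hval _ _ (by omega)⟩, hval _ _ (by omega), hval _ _ (by omega)⟩
  simp only [List.map_cons, List.map_nil, baseWords, List.cons.injEq, and_true]
  exact ⟨funext fun i => (hbits i).1.1, funext fun i => (hbits i).1.2,
    funext fun i => (hbits i).2.1, funext fun i => (hbits i).2.2⟩

lemma wt_add (v w : Word) : wt (v + w) + 2 * ∑ i, (v i).val * (w i).val = wt v + wt w := by
  simp only [wt_eq_sum, Finset.mul_sum, ← Finset.sum_add_distrib, Pi.add_apply]
  refine Finset.sum_congr rfl fun i _ => ?_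
  generalize v i = a
  generalize w i = b
  revert a b
  decide

lemma eq_zero_of_wt {w : Word} (h : wt w = 0) : w = 0 := by
  rw [wt_eq_sum, Finset.sum_eq_zero_iff] at h
  funext i
  simpa using h i (Finset.mem_univ i)

lemma wt_add_of_le {w Z : Word} (h : ∀ i, Z i = 0 → w i = 0) : wt (w + Z) + wt w = wt Z := by
  simp only [wt_eq_sum, ← Finset.sum_add_distrib, Pi.add_apply]
  refine Finset.sum_congr rfl fun i _ => ?_
  have := h i
  revert this
  generalize w i = a
  generalize Z i = b
  revert a b
  decide

lemma notMem_of_notMem_sup {V : Type*} [AddCommGroup V] [Module (ZMod 2) V]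
    {W : Submodule (ZMod 2) V} {g w : V} (h : w ∉ W ⊔ Submodule.span (ZMod 2) {g}) :
    w ∉ W ∧ g + w ∉ W := by
  rw [mem_sup_span_singleton, not_or] at h
  refine ⟨h.1, fun h' => h.2 ⟨_, h', ?_⟩⟩
  rw [add_right_comm, ZModModule.add_self, zero_add]

lemma exists_mem_notMem {V : Type*} [AddCommGroup V] [Module (ZMod 2) V] [Finite V]
    {D W : Submodule (ZMod 2) V} (h : Module.finrank (ZMod 2) W < Module.finrank (ZMod 2) D) :
    ∃ w ∈ D, w ∉ W := by
  by_contra! hle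
  exact absurd (Submodule.finrank_mono (show D ≤ W from hle)) (not_le.mpr h)

lemma Frame.of_notMem {K : Submodule (ZMod 2) Word} {x y z Z : Word} (hZ : wt Z = 16)
    (hK : ∀ w ∈ K, w = 0 ∨ w = Z ∨ wt w = 8) (h0 : ∀ w ∈ K, ∀ i, Z i = 0 → w i = 0)
    (hx : x ∈ K) (hy : y ∈ K) (hz : z ∈ K) (hx' : x ∉ Submodule.span (ZMod 2) {Z})
    (hy' : y ∉ Submodule.span (ZMod 2) {Z} ⊔ Submodule.span (ZMod 2) {x})
    (hz' : z ∉ Submodule.span (ZMod 2) {Z} ⊔ Submodule.span (ZMod 2) {x} ⊔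
      Submodule.span (ZMod 2) {y}) : Frame x y z Z := by
  have h8 : ∀ w ∈ K, w ∉ Submodule.span (ZMod 2) {Z} → wt w = 8 := by
    intro w hw h
    rcases hK w hw with rfl | rfl | h8
    · exact absurd (zero_mem _) h
    · exact absurd (Submodule.mem_span_singleton_self _) h
    · exact h8
  obtain ⟨hy1, hy2⟩ := notMem_of_notMem_sup hy'
  obtain ⟨hz1, hz2⟩ := notMem_of_notMem_sup hz'
  obtain ⟨hz3, hz4⟩ := notMem_of_notMem_sup hz1
  obtain ⟨hz5, hz6⟩ := notMem_of_notMem_sup hz2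
  exact
    { zero := fun i hi => ⟨h0 x hx i hi, h0 y hy i hi, h0 z hz i hi⟩
      wt_Z := hZ
      wt_x := h8 _ hx hx'
      wt_y := h8 _ hy hy1
      wt_z := h8 _ hz hz3
      wt_xy := h8 _ (K.add_mem hx hy) hy2
      wt_xz := h8 _ (K.add_mem hx hz) hz4
      wt_yz := h8 _ (K.add_mem hy hz) hz5
      wt_xyz := by
        rw [add_assoc]
        exact h8 _ (K.add_mem hx (K.add_mem hy hz)) hz6 }

lemma finrank_sup_span_singleton_le {V : Type*} [AddCommGroup V] [Module (ZMod 2) V] [Finite V]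
    (W : Submodule (ZMod 2) V) (g : V) :
    Module.finrank (ZMod 2) ↥(W ⊔ Submodule.span (ZMod 2) {g}) ≤ Module.finrank (ZMod 2) W + 1 := by
  by_cases hg : g ∈ W
  · rw [sup_eq_left.mpr ((Submodule.span_singleton_le_iff_mem _ _).mpr hg)]
    exact Nat.le_succ _
  · exact (finrank_sup_span_singleton W hg).le

lemma exists_frame {K : Submodule (ZMod 2) Word} {Z : Word} (hZ : wt Z = 16)
    (hK : ∀ w ∈ K, w = 0 ∨ w = Z ∨ wt w = 8) (h0 : ∀ w ∈ K, ∀ i, Z i = 0 → w i = 0)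
    (hdim : 4 ≤ Module.finrank (ZMod 2) K) :
    ∃ x ∈ K, ∃ y ∈ K, ∃ z ∈ K, Frame x y z Z := by
  have hZ0 : Module.finrank (ZMod 2) (Submodule.span (ZMod 2) {Z}) ≤ 1 := by
    have h := finrank_sup_span_singleton_le (⊥ : Submodule (ZMod 2) Word) Z
    rwa [bot_sup_eq, finrank_bot] at h
  obtain ⟨x, hx, hx'⟩ := exists_mem_notMem (D := K) (hZ0.trans_lt (by omega))
  have hx0 := finrank_sup_span_singleton_le (Submodule.span (ZMod 2) {Z}) x
  obtain ⟨y, hy, hy'⟩ := exists_mem_notMem (D := K) (hx0.trans_lt (by omega))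
  have hy0 := finrank_sup_span_singleton_le
    (Submodule.span (ZMod 2) {Z} ⊔ Submodule.span (ZMod 2) {x}) y
  obtain ⟨z, hz, hz'⟩ := exists_mem_notMem (D := K) (hy0.trans_lt (by omega))
  exact ⟨x, hx, y, hy, z, hz, Frame.of_notMem hZ hK h0 hx hy hz hx' hy' hz'⟩

lemma GoodCode9.exists_frame {C : Submodule (ZMod 2) Word} (hC : GoodCode9 (Fin 21) C) :
    ∃ x ∈ C, ∃ y ∈ C, ∃ z ∈ C, ∃ Z ∈ C, Frame x y z Z := by
  obtain ⟨Z, hZC, hZ⟩ := hC.exists_wt_sixteen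
  let f := (LinearMap.funLeft (ZMod 2) (ZMod 2)
    (Subtype.val : {i : Fin 21 // Z i = 0} → Fin 21)).domRestrict C
  have hf : ∀ w : C, f w = 0 ↔ ∀ i, Z i = 0 → (w : Word) i = 0 := by
    intro w
    rw [funext_iff]
    exact ⟨fun h i hi => h ⟨i, hi⟩, fun h i => h i i.2⟩
  have hcard : Fintype.card {i : Fin 21 // Z i = 0} = 5 := by
    have h1 : wt Z = Fintype.card {i : Fin 21 // ¬ Z i = 0} := by
      rw [wt_eq_sum, Fintype.card_subtype, Finset.card_filter]
      refine Finset.sum_congr rfl fun i _ => ?_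
      rcases ZMod.val_two_cases (Z i) with h | h <;> simp [h, ZMod.val_one]
    have h2 := Fintype.card_subtype_compl fun i : Fin 21 => Z i = 0
    have h3 := Fintype.card_subtype_le fun i : Fin 21 => Z i = 0
    rw [Fintype.card_fin] at h2 h3
    omega
  have hdim := f.finrank_range_add_finrank_ker
  have hrange := Submodule.finrank_le (LinearMap.range f)
  rw [Module.finrank_fintype_fun_eq_card, hcard] at hrange
  rw [hC.1] at hdim
  have hK : Module.finrank (ZMod 2) ((LinearMap.ker f).map C.subtype) =
      Module.finrank (ZMod 2) (LinearMap.ker f) :=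
    (LinearEquiv.finrank_eq (Submodule.equivMapOfInjective _ C.injective_subtype _)).symm
  have h0 : ∀ w ∈ (LinearMap.ker f).map C.subtype, ∀ i, Z i = 0 → w i = 0 := by
    rintro _ ⟨w, hw, rfl⟩
    exact (hf w).mp hw
  have hle : ∀ w ∈ (LinearMap.ker f).map C.subtype, w ∈ C := by
    rintro _ ⟨w, -, rfl⟩
    exact w.2
  obtain ⟨x, hx, y, hy, z, hz, h⟩ := _root_.exists_frame hZ (fun w hw => by
    have h1 := hC.2.2 w (hle w hw)
    have h2 := hC.2.2 _ (C.add_mem (hle w hw) hZC)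
    have h3 := wt_add_of_le (h0 w hw)
    simp only [Set.mem_insert_iff, Set.mem_singleton_iff] at h1 h2
    rcases show wt w = 0 ∨ wt (w + Z) = 0 ∨ wt w = 8 by omega with h | h | h
    · exact Or.inl (eq_zero_of_wt h)
    · exact Or.inr (Or.inl (CharTwo.add_eq_zero.mp (eq_zero_of_wt h)))
    · exact Or.inr (Or.inr h)) h0 (by omega)
  exact ⟨x, hle x hx, y, hle y hy, z, hle z hz, Z, hZC, h⟩

/-- The common part of all codes in normal form. -/
def baseCode : Submodule (ZMod 2) Word := spanOf [maskX, maskY, maskZ, maskW]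

lemma baseCode_le {C : Submodule (ZMod 2) Word} : baseCode ≤ C ↔ ∀ w ∈ baseWords, w ∈ C := by
  rw [baseCode, spanOf, Submodule.span_le]
  simp only [baseWords, List.mem_cons, List.not_mem_nil, or_false]
  constructor
  · rintro h w (rfl | rfl | rfl | rfl) <;> exact h ⟨_, by simp, rfl⟩
  · rintro h _ ⟨m, rfl | rfl | rfl | rfl, rfl⟩ <;> exact h _ (by simp)

lemma GoodCode9.exists_baseCode_le {C : Submodule (ZMod 2) Word} (hC : GoodCode9 (Fin 21) C) :
    ∃ D, CodeEquiv (Fin 21) C D ∧ baseCode ≤ D := by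
  obtain ⟨x, hx, y, hy, z, hz, Z, hZ, h⟩ := hC.exists_frame
  let σ := Tuple.sort (key [x, y, z, Z])
  have hσ := h.comp_eq (σ := σ) (by
    rw [show key ([x, y, z, Z].map (· ∘ σ)) = key [x, y, z, Z] ∘ σ from
      funext fun i => key_map_comp _ _ i]
    exact Tuple.monotone_sort _)
  refine ⟨_, ⟨σ, rfl⟩, ?_⟩
  rw [baseCode_le, ← hσ]
  simp only [List.map_cons, List.map_nil, List.mem_cons, List.not_mem_nil, or_false]
  rintro w (rfl | rfl | rfl | rfl)
  exacts [⟨x, hx, rfl⟩, ⟨y, hy, rfl⟩, ⟨z, hz, rfl⟩, ⟨Z, hZ, rfl⟩]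

/-- The involution exchanging the two coordinates of each of the eight pairs on which all words of
`baseCode` are constant. -/
def partner (i : Fin 21) : Fin 21 := if i < 5 then i else if i.val % 2 = 1 then i + 1 else i - 1

/-- The sums of a word over the eight pairs of coordinates. -/
def pairSum : Word →ₗ[ZMod 2] Word := LinearMap.id + LinearMap.funLeft (ZMod 2) (ZMod 2) partner

lemma pairSum_apply (w : Word) (i : Fin 21) : pairSum w i = w i + w (partner i) := rfl

lemma apply_partner {w : Word} (hw : w ∈ baseCode) (i : Fin 21) : w (partner i) = w i := by
  have h : baseCode ≤ LinearMap.eqLocus (LinearMap.funLeft (ZMod 2) (ZMod 2) partner)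
      LinearMap.id := by
    rw [baseCode_le]
    simp only [baseWords, List.forall_mem_cons, List.not_mem_nil, LinearMap.mem_eqLocus]
    refine ⟨?_, ?_, ?_, ?_, fun _ h => h.elim⟩ <;> decide +kernel
  exact congrFun (h hw) i

lemma pairSum_of_mem {w : Word} (hw : w ∈ baseCode) : pairSum w = 0 := by
  funext i
  rw [pairSum_apply, apply_partner hw, CharTwo.add_self_eq_zero, Pi.zero_apply]

lemma apply_eq_zero_of_mem {w : Word} (hw : w ∈ baseCode) {i : Fin 21} (hi : i < 5) : w i = 0 := by
  have h : baseCode ≤ LinearMap.ker (LinearMap.proj i : Word →ₗ[ZMod 2] ZMod 2) := by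
    rw [baseCode_le]
    simp only [baseWords, List.forall_mem_cons, List.not_mem_nil, LinearMap.mem_ker,
      LinearMap.proj_apply]
    refine ⟨?_, ?_, ?_, ?_, fun _ h => h.elim⟩ <;> (revert i; decide +kernel)
  exact h hw

lemma mem_baseCode (w : Word) (hw : w ∈ baseWords) : w ∈ baseCode := baseCode_le.mp le_rfl w hw

lemma finrank_baseCode : Module.finrank (ZMod 2) baseCode = 4 := by
  refine le_antisymm (finrank_spanOf_le _) ?_
  let R := [(5, maskW ^^^ maskX ^^^ maskY ^^^ maskZ), (7, maskX), (9, maskY), (13, maskZ)]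
  have hR : Module.finrank (ZMod 2) (spanOf (R.map Prod.snd)) = 4 :=
    finrank_spanOf_eq (R := R) (by decide +kernel)
  rw [← hR]
  have h := mem_baseCode
  simp only [baseWords, List.forall_mem_cons] at h
  refine Submodule.finrank_mono (Submodule.span_le.mpr ?_)
  rintro _ ⟨m, hm, rfl⟩
  simp only [R, List.map_cons, List.map_nil, List.mem_cons, List.not_mem_nil, or_false] at hm
  rcases hm with rfl | rfl | rfl | rfl
  · simp only [dec_xor]
    exact add_mem (add_mem (add_mem h.2.2.2.1 h.1) h.2.1) h.2.2.1
  exacts [h.1, h.2.1, h.2.2.1]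

lemma baseCode_wt {w : Word} (hw : w ∈ baseCode) : w = 0 ∨ w = dec maskW ∨ wt w = 8 := by
  have h := (lists_spanList baseGens (by decide +kernel) _).mpr ⟨w, hw, rfl⟩
  have hall : ∀ m ∈ spanList baseGens, m = 0 ∨ m = maskW ∨ m % 31 = 8 := by decide +kernel
  rcases hall _ h with h | h | h
  · exact Or.inl (enc_injective (h.trans enc_zero.symm))
  · exact Or.inr (Or.inl (by rw [← h, dec_enc]))
  · exact Or.inr (Or.inr (by rwa [← enc_mod]))

lemma wt_dec_maskW : wt (dec maskW) = 16 := by rw [← enc_mod]; decide +kernel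

lemma dec_maskW_eq_zero (i : Fin 21) : dec maskW i = 0 ↔ i < 5 := by
  revert i
  decide +kernel

lemma sum_mul_eq_zero {C : Submodule (ZMod 2) Word} (hC : GoodCode9 (Fin 21) C) {w v : Word}
    (hw : w ∈ C) (hv : v ∈ C) (h8 : wt v % 8 = 0) : ∑ i, w i * v i = 0 := by
  have h := wt_add w v
  have h1 := hC.2.2 _ hw
  have h2 := hC.2.2 _ (C.add_mem hw hv)
  simp only [Set.mem_insert_iff, Set.mem_singleton_iff] at h1 h2
  have heven : 2 ∣ ∑ i, (w i).val * (v i).val := by omega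
  have hcast := (ZMod.natCast_eq_zero_iff _ 2).mpr heven
  push_cast at hcast
  simpa using hcast

lemma pairSum_mem {C : Submodule (ZMod 2) Word} (hC : GoodCode9 (Fin 21) C) (hle : baseCode ≤ C)
    {w : Word} (hw : w ∈ C) : pairSum w ∈ baseCode := by
  have hbase := fun v hv => hle (mem_baseCode v hv)
  have h8 : ∀ v ∈ baseWords, wt v % 8 = 0 := by
    simp only [baseWords, List.forall_mem_cons, List.not_mem_nil, ← enc_mod]
    refine ⟨?_, ?_, ?_, ?_, fun _ h => h.elim⟩ <;> decide +kernel
  have h0 := fun v hv => sum_mul_eq_zero hC hw (hbase v hv) (h8 v hv)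
  have eX : dec maskX = ![0,0,0,0,0,0,0,1,1,0,0,1,1,0,0,1,1,0,0,1,1] := by decide +kernel
  have eY : dec maskY = ![0,0,0,0,0,0,0,0,0,1,1,1,1,0,0,0,0,1,1,1,1] := by decide +kernel
  have eZ : dec maskZ = ![0,0,0,0,0,0,0,0,0,0,0,0,0,1,1,1,1,1,1,1,1] := by decide +kernel
  have eW : dec maskW = ![0,0,0,0,0,1,1,1,1,1,1,1,1,1,1,1,1,1,1,1,1] := by decide +kernel
  have hX := h0 (dec maskX) (by simp [baseWords])
  have hY := h0 (dec maskY) (by simp [baseWords])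
  have hZ := h0 (dec maskZ) (by simp [baseWords])
  have hW := h0 (dec maskW) (by simp [baseWords])
  have key8 : ∀ p : Fin 8 → ZMod 2, p 1 + p 3 + p 5 + p 7 = 0 → p 2 + p 3 + p 6 + p 7 = 0 →
      p 4 + p 5 + p 6 + p 7 = 0 → p 0 + p 1 + p 2 + p 3 + p 4 + p 5 + p 6 + p 7 = 0 →
      ∀ i : Fin 21, (if i < 5 then 0 else p (Fin.ofNat 8 ((i.val - 5) / 2))) =
        (p 0 • dec maskW + (p 0 + p 1) • dec maskX + (p 0 + p 2) • dec maskY +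
          (p 0 + p 4) • dec maskZ) i := by
    rw [eX, eY, eZ, eW]
    decide +kernel
  let p : Fin 8 → ZMod 2 := fun v => pairSum w (Fin.ofNat 21 (5 + 2 * v.val))
  have hp : pairSum w = p 0 • dec maskW + (p 0 + p 1) • dec maskX + (p 0 + p 2) • dec maskY +
      (p 0 + p 4) • dec maskZ := by
    have hp' : ∀ v : Fin 8, p v =
        w (Fin.ofNat 21 (5 + 2 * v.val)) + w (Fin.ofNat 21 (6 + 2 * v.val)) := by
      intro v
      simp only [p, pairSum_apply]
      congr 2
      revert v
      decide +kernel
    have hpartner : ∀ i : Fin 21, i < 5 → partner i = i := by decide +kernel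
    have hpair : ∀ i : Fin 21, ¬ i < 5 →
        i = Fin.ofNat 21 (5 + 2 * ((i.val - 5) / 2)) ∨
        i = partner (Fin.ofNat 21 (5 + 2 * ((i.val - 5) / 2))) ∧
          partner i = Fin.ofNat 21 (5 + 2 * ((i.val - 5) / 2)) := by decide +kernel
    have hmod : ∀ i : Fin 21, (Fin.ofNat 8 ((i.val - 5) / 2)).val = (i.val - 5) / 2 := by
      decide +kernel
    funext i
    rw [← key8 p]
    · split_ifs with hi
      · rw [pairSum_apply, hpartner i hi, CharTwo.add_self_eq_zero]
      · simp only [p, hmod]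
        rcases hpair i hi with h | ⟨h1, h2⟩
        · rw [← h]
        · rw [pairSum_apply, pairSum_apply, ← h1, h2, add_comm]
    · rw [← hX, eX, hp' 1, hp' 3, hp' 5, hp' 7]
      simp [Fin.sum_univ_succ, add_assoc]
    · rw [← hY, eY, hp' 2, hp' 3, hp' 6, hp' 7]
      simp [Fin.sum_univ_succ, add_assoc]
    · rw [← hZ, eZ, hp' 4, hp' 5, hp' 6, hp' 7]
      simp [Fin.sum_univ_succ, add_assoc]
    · rw [← hW, eW, hp' 0, hp' 1, hp' 2, hp' 3, hp' 4, hp' 5, hp' 6, hp' 7]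
      simp [Fin.sum_univ_succ, add_assoc]
  rw [hp]
  have h := mem_baseCode
  simp only [baseWords, List.forall_mem_cons] at h
  exact add_mem (add_mem (add_mem (Submodule.smul_mem _ _ h.2.2.2.1) (Submodule.smul_mem _ _ h.1))
    (Submodule.smul_mem _ _ h.2.1)) (Submodule.smul_mem _ _ h.2.2.1)

/-- Some coordinate among the first five at which `g` does not vanish, and which is smallest with
respect to the preceding words, is annihilated by the subsequent words. -/
def Anchored (prev : List Word) (g : Word) (gs : List Word) : Prop :=
  ∀ i < 5, g i = 1 → ∃ t < 5, g t = 1 ∧ (∀ j < 5, g j = 1 → key prev t ≤ key prev j) ∧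
    ∀ w ∈ gs, w t = 0

/-- The words of a list are independent modulo `P`, and each of them is anchored. -/
def Chain (P : Submodule (ZMod 2) Word) (prev : List Word) : List Word → Prop
  | [] => True
  | g :: gs => g ∉ P ∧ Anchored prev g gs ∧ Chain (P ⊔ Submodule.span (ZMod 2) {g}) (g :: prev) gs

/-- The span of a submodule and the words of a list. -/
def extend (P : Submodule (ZMod 2) Word) : List Word → Submodule (ZMod 2) Word
  | [] => P
  | g :: gs => extend (P ⊔ Submodule.span (ZMod 2) {g}) gs

lemma extend_le {P S : Submodule (ZMod 2) Word} {gs : List Word} (hP : P ≤ S) (h : ∀ g ∈ gs, g ∈ S) :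
    extend P gs ≤ S := by
  induction gs generalizing P with
  | nil => exact hP
  | cons g gs ih =>
    rw [List.forall_mem_cons] at h
    exact ih (sup_le hP ((Submodule.span_singleton_le_iff_mem _ _).mpr h.1)) h.2

lemma Chain.finrank_extend {P : Submodule (ZMod 2) Word} {prev gs : List Word}
    (h : Chain P prev gs) :
    Module.finrank (ZMod 2) (extend P gs) = Module.finrank (ZMod 2) P + gs.length := by
  induction gs generalizing P prev with
  | nil => rfl
  | cons g gs ih =>
    rw [extend, ih h.2.2, finrank_sup_span_singleton P h.1, List.length_cons, add_assoc, add_comm 1]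

lemma mem_sup_span_singleton_iff {V : Type*} [AddCommGroup V] [Module (ZMod 2) V]
    {W : Submodule (ZMod 2) V} {g w : V} :
    w ∈ W ⊔ Submodule.span (ZMod 2) {g} ↔ w ∈ W ∨ w + g ∈ W := by
  rw [mem_sup_span_singleton]
  refine or_congr_right ⟨?_, fun h => ⟨_, h, ?_⟩⟩
  · rintro ⟨v, hv, rfl⟩
    rwa [add_assoc, ZModModule.add_self, add_zero]
  · rw [add_assoc, ZModModule.add_self, add_zero]

lemma Anchored.map {σ : Equiv.Perm (Fin 21)} (hσ : ∀ i, σ i < 5 ↔ i < 5) {τ : Word → Word}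
    (hτ : ∀ w, ∀ i < 5, τ w i = w (σ i)) {prev prev' gs : List Word} {g : Word}
    (hprev : ∀ i < 5, key prev' i = key prev (σ i)) (h : Anchored prev g gs) :
    Anchored prev' (τ g) (gs.map τ) := by
  intro i hi hgi
  rw [hτ g i hi] at hgi
  obtain ⟨t, ht, hgt, hmin, hgs⟩ := h (σ i) ((hσ i).mpr hi) hgi
  have ht' : σ.symm t < 5 := by rwa [← hσ, σ.apply_symm_apply]
  refine ⟨σ.symm t, ht', ?_, fun j hj hgj => ?_, fun w hw => ?_⟩
  · rw [hτ g _ ht', σ.apply_symm_apply, hgt]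
  · rw [hprev _ ht', hprev j hj, σ.apply_symm_apply]
    exact hmin _ ((hσ j).mpr hj) (by rwa [hτ g j hj] at hgj)
  · obtain ⟨w, hw', rfl⟩ := List.mem_map.mp hw
    rw [hτ w _ ht', σ.apply_symm_apply, hgs w hw']

lemma Chain.map {σ : Equiv.Perm (Fin 21)} (hσ : ∀ i, σ i < 5 ↔ i < 5) {τ : Word → Word}
    (hτ : ∀ w, ∀ i < 5, τ w i = w (σ i)) {P P' : Submodule (ZMod 2) Word}
    (hP' : ∀ w, τ w + w ∘ σ ∈ P') {prev prev' gs : List Word}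
    (hP : ∀ w, w ∈ P ↔ w ∘ σ ∈ P') (hprev : ∀ i < 5, key prev' i = key prev (σ i))
    (h : Chain P prev gs) : Chain P' prev' (gs.map τ) := by
  induction gs generalizing P P' prev prev' with
  | nil => trivial
  | cons g gs ih =>
    have hiff : ∀ w, w + g ∈ P ↔ w ∘ σ + τ g ∈ P' := by
      intro w
      rw [hP, ← Submodule.add_mem_iff_left P' (hP' g)]
      have : (w + g) ∘ σ + (τ g + g ∘ σ) = w ∘ σ + τ g := by
        rw [add_comm (τ g), ← add_assoc,
          show (w + g) ∘ σ + g ∘ σ = w ∘ σ + (g ∘ σ + g ∘ σ) from add_assoc _ _ _,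
          ZModModule.add_self, add_zero]
      rw [this]
    refine ⟨fun hmem => h.1 ?_, h.2.1.map hσ hτ hprev, ih (fun w => ?_) (fun w => ?_)
      (fun i hi => ?_) h.2.2⟩
    · have := (hiff 0).mpr (by simpa [show (0 : Word) ∘ σ = 0 from rfl] using hmem)
      rwa [zero_add] at this
    · exact Submodule.mem_sup_left (hP' w)
    · rw [mem_sup_span_singleton_iff, mem_sup_span_singleton_iff, hP, hiff]
    · simp only [key, hprev i hi, hτ g i hi]

/-- After sorting, the first coordinate at which `g` does not vanish serves as an anchor. -/
lemma Anchored.apply_eq_zero {prev gs : List Word} {g : Word}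
    (hmono : Monotone (key (gs.reverse ++ g :: prev))) (h : Anchored prev g gs) {i : Fin 21}
    (hi : i < 5) (hgi : g i = 1) (hfirst : ∀ j < i, g j ≠ 1) : ∀ w ∈ gs, w i = 0 := by
  obtain ⟨t, ht, hgt, hmin, hgs⟩ := h i hi hgi
  have hit : i ≤ t := not_lt.mp fun hlt => hfirst t hlt hgt
  have hle := hmono hit
  have hprev := (hmin i hi hgi).antisymm' (monotone_key_of_append (l := gs.reverse ++ [g])
    (by simpa using hmono) hit)
  have ht0 : key gs.reverse t = 0 := key_eq_zero_iff.mpr fun w hw => hgs w (by simpa using hw)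
  rw [key_append, key_append, ht0] at hle
  simp only [key, hprev, hgi, hgt] at hle
  have hi0 : key gs.reverse i = 0 := by omega
  exact fun w hw => key_eq_zero_iff.mp hi0 w (by simpa using hw)

lemma firstBit_spec {g : Word} {j : ℕ} (h : firstBit (enc g) = some j) :
    ∃ i : Fin 21, i.val = j ∧ i < 5 ∧ g i = 1 ∧ ∀ k < i, g k ≠ 1 := by
  obtain ⟨hj, hlt, hmin⟩ := List.find?_range_eq_some.mp h
  rw [List.mem_range] at hlt
  have hbit : ∀ k : Fin 21, Nat.beq (mbit (enc g) k) 1 = true ↔ g k = 1 := by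
    intro k
    rw [Nat.beq_eq, mbit_enc_fin]
    exact (ZMod.val_injective 2).eq_iff' rfl
  refine ⟨⟨j, by omega⟩, rfl, hlt, (hbit _).mp hj, fun k hk hgk => ?_⟩
  have := hmin k hk
  rw [(hbit k).mpr hgk] at this
  exact absurd this (by decide)

/-- A sorted chain is found by the search. -/
lemma Chain.found {E : Submodule (ZMod 2) Word}
    (hE : ∀ w ∈ E, w = 0 ∨ wt w = 8 ∨ wt w = 12 ∨ wt w = 16) {gs : List Word}
    (hgs : ∀ g ∈ gs, g ∈ E) {lams : List ℕ}
    (hl : List.Forall₂ (fun lam g => ∀ i, 4 ≤ i → i + 1 < 21 → i % 2 = 1 →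
      (Word.bit g i + g.bit (i + 1)) % 2 = mbit lam (i + 1)) lams gs)
    {P : Submodule (ZMod 2) Word} (hP : P ≤ E) {sp : List ℕ} (hsp : ListsCodes sp P)
    {zs : List ℕ} (hzs : ∀ i ∈ zs, ∀ g ∈ gs, Word.bit g i = 0) {prev : List Word}
    (hmono : Monotone (key (gs.reverse ++ prev))) (h : Chain P prev gs) :
    Found lams zs sp (prev.map enc) gs := by
  induction hl generalizing P sp zs prev with
  | nil => trivial
  | @cons lam g lams gs hpair hl ih =>
    rw [List.forall_mem_cons] at hgs
    have hmono' : Monotone (key (gs.reverse ++ g :: prev)) := by simpa using hmono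
    refine ⟨⟨fun i hi hm => ?_, fun i hi => (hzs i hi) g (by simp), hpair⟩, ?_, ?_⟩
    · rw [show i = (⟨i, by omega⟩ : Fin 21).val from rfl,
        show (⟨i, by omega⟩ : Fin 21).val + 1 = (⟨i + 1, hi⟩ : Fin 21).val from rfl,
        Word.bit_fin, Word.bit_fin]
      refine bit_le_of_monotone_key (monotone_key_of_append hmono') (Fin.mk_le_mk.mpr (by omega))
        fun w hw => ZMod.val_injective 2 ?_
      have := hm _ (List.mem_map_of_mem hw)
      rwa [mbit_enc_fin w ⟨i, by omega⟩, mbit_enc_fin w ⟨i + 1, hi⟩] at this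
    · rw [goodExt, List.all_eq_true]
      intro s hs
      obtain ⟨w, hw, rfl⟩ := (hsp s).mp hs
      simp only [Bool.or_eq_true, Nat.beq_eq, ← enc_add, enc_mod]
      rcases hE (w + g) (E.add_mem (hP hw) hgs.1) with h0 | h0 | h0 | h0
      · exact absurd (by rwa [← CharTwo.add_eq_zero.mp h0]) h.1
      all_goals simp [h0]
    · refine ih hgs.2 (sup_le hP ((Submodule.span_singleton_le_iff_mem _ _).mpr hgs.1))
        (hsp.sup g) (fun i hi w hw => ?_) hmono' h.2.2
      rw [List.mem_append, Option.mem_toList] at hi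
      rcases hi with hi | hi
      · obtain ⟨i, rfl, hi, hgi, hfirst⟩ := firstBit_spec hi
        rw [Word.bit_fin, h.2.1.apply_eq_zero hmono' hi hgi hfirst w hw, ZMod.val_zero]
      · exact hzs i hi w (by simp [hw])

lemma dec_val (m : ℕ) (i : Fin 21) : (dec m i).val = mbit m i := by
  have := mbit_lt m i
  rw [dec]
  split_ifs with h
  · rw [h, ZMod.val_one]
  · rw [ZMod.val_zero]
    omega

lemma monotone_key_sort (l : List Word) : Monotone (key (l.map (· ∘ Tuple.sort (key l)))) := by
  rw [show key (l.map (· ∘ Tuple.sort (key l))) = key l ∘ Tuple.sort (key l) from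
    funext fun i => key_map_comp _ _ i]
  exact Tuple.monotone_sort _

lemma map_baseCode {x y z : Word} (hx : x ∈ baseCode) (hy : y ∈ baseCode) (hz : z ∈ baseCode)
    {σ : Equiv.Perm (Fin 21)} (hσ : [x, y, z, dec maskW].map (· ∘ σ) = baseWords) :
    baseCode.map (LinearMap.funLeft (ZMod 2) (ZMod 2) σ) = baseCode := by
  refine (Submodule.eq_of_le_of_finrank_eq (baseCode_le.mpr ?_) (finrank_map_funLeft σ _).symm).symm
  rw [← hσ]
  have hW := mem_baseCode (dec maskW) (by simp [baseWords])
  simp only [List.map_cons, List.map_nil, List.mem_cons, List.not_mem_nil, or_false]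
  rintro w (rfl | rfl | rfl | rfl)
  exacts [⟨x, hx, rfl⟩, ⟨y, hy, rfl⟩, ⟨z, hz, rfl⟩, ⟨_, hW, rfl⟩]

/-- The projection along `baseCode` onto the words vanishing at four coordinates which the words
`x`, `y`, `z` and `dec maskW` separate. -/
lemma Frame.exists_projection {x y z : Word} (h : Frame x y z (dec maskW)) (hx : x ∈ baseCode)
    (hy : y ∈ baseCode) (hz : z ∈ baseCode) :
    ∃ ρ : Word → Word, (∀ w, ρ w + w ∈ baseCode) ∧ ∀ j ∈ ({5, 7, 9, 13} : Finset (Fin 21)),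
      ∃ s, key [x, y, z, dec maskW] s = key baseWords j ∧ ∀ w, ρ w s = 0 := by
  have hσ := h.comp_eq (monotone_key_sort _)
  have hW := mem_baseCode (dec maskW) (by simp [baseWords])
  set σ := Tuple.sort (key [x, y, z, dec maskW])
  have hkey : ∀ j, key [x, y, z, dec maskW] (σ j) = key baseWords j := by
    intro j
    rw [← hσ, key_map_comp]
  simp only [baseWords, List.map_cons, List.map_nil, List.cons.injEq, and_true] at hσ
  obtain ⟨hσx, hσy, hσz, hσW⟩ := hσ
  let ρ : Word → Word := fun w => w + (w (σ 5) • dec maskW + (w (σ 5) + w (σ 7)) • x +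
    (w (σ 5) + w (σ 9)) • y + (w (σ 5) + w (σ 13)) • z)
  refine ⟨ρ, fun w => ?_, fun j hj => ⟨σ j, hkey j, fun w => ?_⟩⟩
  · have : ρ w + w = w (σ 5) • dec maskW + (w (σ 5) + w (σ 7)) • x +
        (w (σ 5) + w (σ 9)) • y + (w (σ 5) + w (σ 13)) • z := by
      simp only [ρ]
      rw [add_comm, ← add_assoc, ZModModule.add_self, zero_add]
    rw [this]
    exact add_mem (add_mem (add_mem (Submodule.smul_mem _ _ hW) (Submodule.smul_mem _ _ hx))
      (Submodule.smul_mem _ _ hy)) (Submodule.smul_mem _ _ hz)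
  · have e1 := congrFun hσx j
    have e2 := congrFun hσy j
    have e3 := congrFun hσz j
    have e4 := congrFun hσW j
    simp only [Function.comp] at e1 e2 e3 e4
    have hrow : dec maskX j = (if j = 7 then 1 else 0) ∧ dec maskY j = (if j = 9 then 1 else 0) ∧
        dec maskZ j = (if j = 13 then 1 else 0) ∧ dec maskW j = 1 := by
      clear * - hj
      revert j
      decide +kernel
    simp only [ρ, Pi.add_apply, Pi.smul_apply, e1, e2, e3, e4, hrow, smul_eq_mul]
    clear * - hj
    simp only [Finset.mem_insert, Finset.mem_singleton] at hj
    rcases hj with rfl | rfl | rfl | rfl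
    all_goals
      generalize w (σ 5) = a, w (σ 7) = b, w (σ 9) = c, w (σ 13) = d
      revert a b c d
      decide

lemma pairSum_projection {ρ : Word → Word} (hρ : ∀ w, ρ w + w ∈ baseCode) (w : Word) :
    pairSum (ρ w) = pairSum w := by
  have := pairSum_of_mem (hρ w)
  rw [map_add] at this
  exact CharTwo.add_eq_zero.mp this

/-- The two coordinates of a pair remain adjacent after sorting. -/
lemma symm_partner {x y z : Word} (hx : x ∈ baseCode) (hy : y ∈ baseCode) (hz : z ∈ baseCode)
    {σ : Equiv.Perm (Fin 21)} (hσ : [x, y, z, dec maskW].map (· ∘ σ) = baseWords)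
    {i j : Fin 21} (hj : 5 ≤ j) (hij : j.val = i.val + 1) (hodd : i.val % 2 = 1) :
    partner (σ j) = σ i := by
  have hkey : ∀ k, key baseWords k = key [x, y, z, dec maskW] (σ k) := by
    intro k
    rw [← hσ, key_map_comp]
  have hW := mem_baseCode (dec maskW) (by simp [baseWords])
  have h1 : key baseWords (σ.symm (partner (σ j))) = key baseWords j := by
    rw [hkey, hkey, σ.apply_symm_apply, key_eq_iff]
    simp only [List.forall_mem_cons, List.not_mem_nil]
    exact ⟨apply_partner hx _, apply_partner hy _, apply_partner hz _, apply_partner hW _,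
      fun _ h => h.elim⟩
  have h5 : ¬ σ j < 5 := by
    have := congrFun (congrArg (fun l => l.getD 3 0) hσ) j
    simp only [baseWords, List.map_cons, List.map_nil, List.getD_cons_succ, List.getD_cons_zero,
      Function.comp] at this
    rw [← dec_maskW_eq_zero, this, dec_maskW_eq_zero]
    exact not_lt.mpr hj
  have hne : σ.symm (partner (σ j)) ≠ j := by
    rw [Ne, Equiv.symm_apply_eq]
    revert h5
    generalize σ j = k
    revert k
    decide +kernel
  rw [← Equiv.symm_apply_eq]
  revert h1 hne
  generalize σ.symm (partner (σ j)) = k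
  clear * - hj hij hodd
  revert i j k
  decide +kernel

lemma key_eq_zero_of_mem {l : List Word} (hl : ∀ w ∈ l, w ∈ baseCode) {i : Fin 21} (hi : i < 5) :
    key l i = 0 := key_eq_zero_iff.mpr fun w hw => apply_eq_zero_of_mem (hl w hw) hi

/-- Any chain whose pair sums are expressed by a frame is found by the search after a suitable
rearrangement of the coordinates. -/
lemma Frame.exists_found {x y z : Word} (h : Frame x y z (dec maskW)) (hx : x ∈ baseCode)
    (hy : y ∈ baseCode) (hz : z ∈ baseCode) {E : Submodule (ZMod 2) Word}
    (hE : ∀ w ∈ E, w = 0 ∨ wt w = 8 ∨ wt w = 12 ∨ wt w = 16) (hle : baseCode ≤ E) {gs : List Word}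
    (hgs : ∀ g ∈ gs, g ∈ E) (hchain : Chain baseCode [] gs) {lams : List ℕ}
    (hl : List.Forall₂ (fun lam g => ∀ σ : Equiv.Perm (Fin 21),
      [x, y, z, dec maskW].map (· ∘ σ) = baseWords → pairSum g ∘ σ = dec lam) lams gs) :
    ∃ (σ : Equiv.Perm (Fin 21)) (gs' : List Word), Found lams [5, 7, 9, 13] baseSpan baseGens gs' ∧
      (extend baseCode gs).map (LinearMap.funLeft (ZMod 2) (ZMod 2) σ) ≤
        spanOf ((gs'.map enc).reverse ++ baseGens) := by
  obtain ⟨ρ, hρ, hzero⟩ := h.exists_projection hx hy hz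
  set l := [x, y, z, dec maskW] with hldef
  have hW := mem_baseCode (dec maskW) (by simp [baseWords])
  have hlmem : ∀ w ∈ l, w ∈ baseCode := by
    simp only [hldef, List.forall_mem_cons, List.not_mem_nil]
    exact ⟨hx, hy, hz, hW, fun _ h => h.elim⟩
  have hmono := monotone_key_sort ((gs.map ρ).reverse ++ l)
  set σ := Tuple.sort (key ((gs.map ρ).reverse ++ l))
  rw [List.map_append] at hmono
  have hσ : l.map (· ∘ σ) = baseWords := h.comp_eq (monotone_key_of_append hmono)
  have hmap := map_baseCode hx hy hz hσ
  have hcomp : ∀ {w}, w ∈ baseCode → w ∘ σ ∈ baseCode := fun hw => hmap ▸ ⟨_, hw, rfl⟩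
  have hσW : ∀ i, dec maskW (σ i) = dec maskW i := by
    simp only [hldef, baseWords, List.map_cons, List.map_nil, List.cons.injEq, and_true] at hσ
    exact congrFun hσ.2.2.2
  let τ : Word → Word := fun w => ρ w ∘ σ
  have hτσ : ∀ w, τ w + w ∘ σ ∈ baseCode := fun w => hcomp (hρ w)
  rw [← List.map_reverse, List.map_map, hσ,
    show (· ∘ σ) ∘ ρ = τ from rfl, List.map_reverse] at hmono
  have hkey : ∀ i, key l (σ i) = key baseWords i := fun i => by rw [← hσ, key_map_comp]
  refine ⟨σ, gs.map τ, ?_, ?_⟩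
  · have hbase : baseGens = baseWords.map enc := by decide +kernel
    rw [hbase]
    refine Chain.found (E := E.map (LinearMap.funLeft (ZMod 2) (ZMod 2) σ)) (P := baseCode)
      ?_ ?_ ?_ ?_ (lists_spanList _ (by decide +kernel)) ?_ hmono
      (hchain.map (σ := σ) (fun i => ?_) (fun w i hi => ?_) hτσ (fun w => ⟨hcomp, fun hw => ?_⟩)
        fun i hi => ?_)
    · rintro _ ⟨w, hw, rfl⟩
      rw [show LinearMap.funLeft (ZMod 2) (ZMod 2) σ w = w ∘ σ from rfl, wt_comp]
      refine (hE w hw).imp_left ?_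
      rintro rfl
      rfl
    · intro w hw
      obtain ⟨g, hg, rfl⟩ := List.mem_map.mp hw
      exact ⟨_, (E.add_mem_iff_left (hgs g hg)).mp (hle (hρ g)), rfl⟩
    · refine List.forall₂_map_right_iff.mpr (hl.imp fun lam g hg i hi hi' hodd => ?_)
      have h1 := congrFun (hg σ hσ) ⟨i + 1, hi'⟩
      have hpart := symm_partner hx hy hz hσ (i := ⟨i, by omega⟩) (j := ⟨i + 1, hi'⟩)
        (Fin.mk_le_mk.mpr (by omega : 5 ≤ i + 1)) rfl hodd
      rw [← pairSum_projection hρ, Function.comp, pairSum_apply, hpart] at h1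
      have h2 := congrArg ZMod.val h1
      rw [ZMod.val_add, dec_val] at h2
      rw [add_comm, ← h2]
      exact congrArg (· % 2) (congrArg₂ (· + ·) (Word.bit_fin (τ g) ⟨i + 1, hi'⟩)
        (Word.bit_fin (τ g) ⟨i, by omega⟩))
    · rw [← hmap]
      exact Submodule.map_mono hle
    · intro i hi w hw
      obtain ⟨g, hg, rfl⟩ := List.mem_map.mp hw
      have hi' : ∀ i ∈ [5, 7, 9, 13], ∃ j ∈ ({5, 7, 9, 13} : Finset (Fin 21)), j.val = i ∧
          ∀ k, key baseWords k = key baseWords j → j ≤ k := by decide +kernel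
      obtain ⟨j, hj, rfl, hjle⟩ := hi' i hi
      obtain ⟨s, hs, hs0⟩ := hzero j hj
      have hkj : key baseWords (σ.symm s) = key baseWords j := by
        rw [← hkey, σ.apply_symm_apply, hs]
      have hle := hmono (hjle _ hkj)
      have h0 : key (gs.map τ).reverse (σ.symm s) = 0 := key_eq_zero_iff.mpr fun w hw => by
        obtain ⟨g, -, rfl⟩ := List.mem_map.mp (List.mem_reverse.mp hw)
        simpa [τ] using hs0 g
      rw [key_append, key_append, hkj, h0] at hle
      have h0' : key (gs.map τ).reverse j = 0 := by omega
      rw [Word.bit_fin, key_eq_zero_iff.mp h0' (τ g) (by simpa using ⟨g, hg, rfl⟩), ZMod.val_zero]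
    · rw [← dec_maskW_eq_zero, hσW, dec_maskW_eq_zero]
    · refine CharTwo.add_eq_zero.mp (apply_eq_zero_of_mem (hρ w) (i := σ i) ?_)
      rwa [← dec_maskW_eq_zero, hσW, dec_maskW_eq_zero]
    · rw [← hmap] at hw
      obtain ⟨v, hv, hvw⟩ := hw
      rwa [← LinearMap.funLeft_injective_of_surjective (ZMod 2) (ZMod 2) σ σ.surjective hvw]
    · exact key_eq_zero_of_mem mem_baseCode hi
  · have hbase : baseCode ≤ spanOf (((gs.map τ).map enc).reverse ++ baseGens) :=
      Submodule.span_mono fun w ⟨m, hm, hw⟩ => ⟨m, List.mem_append_right _ hm, hw⟩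
    rw [Submodule.map_le_iff_le_comap]
    refine extend_le (fun w hw => hbase (hcomp hw)) fun g hg => ?_
    have hτ : τ g ∈ spanOf (((gs.map τ).map enc).reverse ++ baseGens) :=
      Submodule.subset_span ⟨enc (τ g), List.mem_append_left _ (List.mem_reverse.mpr
        (List.mem_map_of_mem (List.mem_map_of_mem hg))), (dec_enc _).symm⟩
    exact (Submodule.add_mem_iff_right _ hτ).mp (hbase (hτσ g))

lemma exists_step {D P : Submodule (ZMod 2) Word} (prev : List Word) {g : Word} (hg : g ∈ D)
    (hgP : g ∉ P) : ∃ D' ≤ D, D ≤ D' ⊔ Submodule.span (ZMod 2) {g} ∧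
      ∀ gs, (∀ h ∈ gs, h ∈ D') → Chain (P ⊔ Submodule.span (ZMod 2) {g}) (g :: prev) gs →
        Chain P prev (g :: gs) := by
  by_cases hne : (Finset.univ.filter fun i : Fin 21 => i < 5 ∧ g i = 1).Nonempty
  · obtain ⟨t, ht, hmin⟩ := Finset.exists_min_image _ (key prev) hne
    simp only [Finset.mem_filter, Finset.mem_univ, true_and] at ht hmin
    refine ⟨D ⊓ LinearMap.ker (LinearMap.proj t : Word →ₗ[ZMod 2] ZMod 2), inf_le_left,
      (inf_ker_sup_span_singleton D _ hg ht.2).ge, fun gs hgs h => ⟨hgP, ?_, h⟩⟩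
    exact fun i hi hgi => ⟨t, ht.1, ht.2, fun j hj hgj => hmin j ⟨hj, hgj⟩, fun w hw => (hgs w hw).2⟩
  · refine ⟨D, le_rfl, le_sup_left, fun gs hgs h => ⟨hgP, fun i hi hgi => (hne ⟨i, ?_⟩).elim, h⟩⟩
    simp [hi, hgi]

/-- The words of a list are linearly independent modulo `U`. -/
def IndepMod (U : Submodule (ZMod 2) Word) : List Word → Prop
  | [] => True
  | x :: l => x ∉ U ∧ IndepMod (U ⊔ Submodule.span (ZMod 2) {x}) l

lemma pairSum_notMem_sup {D D' P U : Submodule (ZMod 2) Word}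
    (hU : ∀ h ∈ D, h ∉ P → pairSum h ∉ U) {g : Word} (hg : g ∈ D) (hD' : D' ≤ D) :
    ∀ h ∈ D', h ∉ P ⊔ Submodule.span (ZMod 2) {g} →
      pairSum h ∉ U ⊔ Submodule.span (ZMod 2) {pairSum g} := by
  intro h hh hhP
  rw [mem_sup_span_singleton_iff, not_or] at hhP ⊢
  rw [← map_add]
  exact ⟨hU h (hD' hh) hhP.1, hU _ (D.add_mem (hD' hh) hg) hhP.2⟩

lemma le_sup_step {E D D' P : Submodule (ZMod 2) Word} {g : Word} (hED : E ≤ D ⊔ P)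
    (hD : D ≤ D' ⊔ Submodule.span (ZMod 2) {g}) :
    E ≤ D' ⊔ (P ⊔ Submodule.span (ZMod 2) {g}) := by
  refine hED.trans (sup_le (hD.trans (sup_le le_sup_left ?_)) ?_)
  · exact le_sup_right.trans le_sup_right
  · exact le_sup_left.trans le_sup_right

lemma exists_mem_notMem_of_le_sup {E D P : Submodule (ZMod 2) Word} (hED : E ≤ D ⊔ P)
    (hlt : Module.finrank (ZMod 2) P < Module.finrank (ZMod 2) E) : ∃ g ∈ D, g ∉ P := by
  by_contra! hle
  exact absurd (Submodule.finrank_mono (hED.trans (sup_le hle le_rfl))) (not_le.mpr hlt)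

lemma exists_chain (n : ℕ) {E D P U : Submodule (ZMod 2) Word} (prev : List Word)
    (hED : E ≤ D ⊔ P) (hn : Module.finrank (ZMod 2) P + n = Module.finrank (ZMod 2) E)
    (hU : ∀ h ∈ D, h ∉ P → pairSum h ∉ U) :
    ∃ gs, gs.length = n ∧ (∀ g ∈ gs, g ∈ D) ∧ Chain P prev gs ∧ IndepMod U (gs.map pairSum) := by
  induction n generalizing D P U prev with
  | zero => exact ⟨[], rfl, by simp, trivial, trivial⟩
  | succ n ih =>
    obtain ⟨g, hg, hgP⟩ := exists_mem_notMem_of_le_sup hED (by omega)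
    obtain ⟨D', hD', hD, hstep⟩ := exists_step prev hg hgP
    obtain ⟨gs, hlen, hgs, hchain, hind⟩ := ih (g :: prev) (le_sup_step hED hD)
      (by rw [finrank_sup_span_singleton P hgP]; omega) (pairSum_notMem_sup hU hg hD')
    exact ⟨g :: gs, by rw [List.length_cons, hlen],
      List.forall_mem_cons.mpr ⟨hg, fun w hw => hD' (hgs w hw)⟩, hstep gs hgs hchain,
      hU g hg hgP, hind⟩

lemma Frame.of_indepMod {x y z : Word} (hx : x ∈ baseCode) (hy : y ∈ baseCode) (hz : z ∈ baseCode)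
    (h : IndepMod (Submodule.span (ZMod 2) {dec maskW}) [x, y, z]) : Frame x y z (dec maskW) :=
  Frame.of_notMem wt_dec_maskW (fun _ => baseCode_wt)
    (fun _ hw i hi => apply_eq_zero_of_mem hw ((dec_maskW_eq_zero i).mp hi)) hx hy hz
    h.1 h.2.1 h.2.2.1

lemma exists_frame_extension {x y : Word} (hx : x ∈ baseCode) (hy : y ∈ baseCode)
    (h : IndepMod (Submodule.span (ZMod 2) {dec maskW}) [x, y]) :
    ∃ z ∈ baseCode, Frame x y z (dec maskW) := by
  have h1 := finrank_sup_span_singleton_le (⊥ : Submodule (ZMod 2) Word) (dec maskW)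
  rw [bot_sup_eq, finrank_bot] at h1
  have h2 := finrank_sup_span_singleton_le (Submodule.span (ZMod 2) {dec maskW}) x
  have h3 := finrank_sup_span_singleton_le
    (Submodule.span (ZMod 2) {dec maskW} ⊔ Submodule.span (ZMod 2) {x}) y
  obtain ⟨z, hz, hz'⟩ := exists_mem_notMem (D := baseCode) (h3.trans_lt (by
    rw [finrank_baseCode]; omega))
  exact ⟨z, hz, .of_indepMod hx hy hz ⟨h.1, h.2.1, hz', trivial⟩⟩

lemma frame_base : Frame (dec maskX) (dec maskY) (dec maskZ) (dec maskW) where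
  zero := by decide +kernel
  wt_Z := wt_dec_maskW
  wt_x := by rw [← enc_mod]; decide +kernel
  wt_y := by rw [← enc_mod]; decide +kernel
  wt_z := by rw [← enc_mod]; decide +kernel
  wt_xy := by rw [← enc_mod]; decide +kernel
  wt_xz := by rw [← enc_mod]; decide +kernel
  wt_yz := by rw [← enc_mod]; decide +kernel
  wt_xyz := by rw [← enc_mod]; decide +kernel

/-- The properties of the subcode of words of even weight of a code in the classification. -/
structure EvenCode (E : Submodule (ZMod 2) Word) : Prop where
  wt_mem : ∀ w ∈ E, w = 0 ∨ wt w = 8 ∨ wt w = 12 ∨ wt w = 16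
  base_le : baseCode ≤ E
  finrank_eq : Module.finrank (ZMod 2) E = 8
  pairSum_mem : ∀ w ∈ E, pairSum w ∈ baseCode

lemma mem_span_maskW {w : Word} (h : w ∈ Submodule.span (ZMod 2) {dec maskW}) :
    w = 0 ∨ w = dec maskW := by
  obtain ⟨c, rfl⟩ := Submodule.mem_span_singleton.mp h
  rcases ZMod.val_two_cases c with rfl | rfl <;> simp

/-- The relation between a pair sum and its image after the coordinates have been sorted. -/
def Carries (l : List Word) (lam : ℕ) (w : Word) : Prop :=
  ∀ σ : Equiv.Perm (Fin 21), l.map (· ∘ σ) = baseWords → w ∘ σ = dec lam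

lemma carries_zero (l : List Word) : Carries l 0 0 := fun σ _ => by rw [dec_zero]; rfl

lemma carries_frame (x y z : Word) : Carries [x, y, z, dec maskW] maskX x ∧
    Carries [x, y, z, dec maskW] maskY y ∧ Carries [x, y, z, dec maskW] maskZ z ∧
    Carries [x, y, z, dec maskW] maskW (dec maskW) := by
  simp only [Carries, baseWords, List.map_cons, List.map_nil, List.cons.injEq, and_true]
  exact ⟨fun _ h => h.1, fun _ h => h.2.1, fun _ h => h.2.2.1, fun _ h => h.2.2.2⟩

lemma EvenCode.not_chain {E : Submodule (ZMod 2) Word} (hE : EvenCode E) {gs : List Word}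
    (hgs : ∀ g ∈ gs, g ∈ E) (h : Chain baseCode [] gs) {lams : List ℕ}
    (hlams : lams = [0, 0] ∨ lams = [0, maskW, 0] ∨ lams = [0, maskW, maskW])
    (hl : List.Forall₂ (fun lam g => lam = 0 ∧ pairSum g = 0 ∨ lam = maskW ∧ pairSum g = dec maskW)
      lams gs) : False := by
  have hb := mem_baseCode
  simp only [baseWords, List.forall_mem_cons] at hb
  obtain ⟨-, gs', hfound, -⟩ := frame_base.exists_found hb.1 hb.2.1 hb.2.2.1 hE.wt_mem hE.base_le
    hgs h (lams := lams) (hl.imp fun lam g hg => by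
      rcases hg with ⟨rfl, hg⟩ | ⟨rfl, hg⟩ <;> rw [hg]
      exacts [carries_zero _, (carries_frame _ _ _).2.2.2])
  have hmem := hfound.mem_solutions
  rcases hlams with rfl | rfl | rfl
  · simp [solutionsA] at hmem
  · simp [solutionsB] at hmem
  · simp [solutionsC] at hmem

lemma EvenCode.exists_pairSum_eq {E : Submodule (ZMod 2) Word} (hE : EvenCode E)
    (h : ∀ g ∈ E, g ∉ baseCode → pairSum g ≠ 0) {z : Word} (hz : z ∈ baseCode) :
    ∃ g ∈ E, pairSum g = z := by
  have hle : E.map pairSum ≤ baseCode := by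
    rintro _ ⟨w, hw, rfl⟩
    exact hE.pairSum_mem w hw
  have hker : (LinearMap.ker (pairSum.domRestrict E)).map E.subtype ≤ baseCode := by
    rintro _ ⟨w, hw, rfl⟩
    by_contra hn
    exact h w w.2 hn hw
  have h1 := Submodule.finrank_mono hker
  rw [LinearEquiv.finrank_eq (Submodule.equivMapOfInjective _ E.injective_subtype _).symm,
    finrank_baseCode] at h1
  have h2 := (pairSum.domRestrict E).finrank_range_add_finrank_ker
  rw [LinearMap.range_domRestrict, hE.finrank_eq] at h2
  have heq := Submodule.eq_of_le_of_finrank_le hle (by rw [finrank_baseCode]; omega)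
  rw [← heq] at hz
  exact hz

lemma EvenCode.found_of_chain {E : Submodule (ZMod 2) Word} (hE : EvenCode E) {x y z : Word}
    (h : Frame x y z (dec maskW)) (hx : x ∈ baseCode) (hy : y ∈ baseCode) (hz : z ∈ baseCode)
    {gs : List Word} (hgs : ∀ g ∈ gs, g ∈ E) (hchain : Chain baseCode [] gs)
    (hlen : gs.length = 4) {lams : List ℕ}
    (hl : List.Forall₂ (fun lam g => Carries [x, y, z, dec maskW] lam (pairSum g)) lams gs) :
    ∃ (σ : Equiv.Perm (Fin 21)) (gs' : List Word), Found lams [5, 7, 9, 13] baseSpan baseGens gs' ∧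
      E.map (LinearMap.funLeft (ZMod 2) (ZMod 2) σ) ≤
        spanOf ((gs'.map enc).reverse ++ baseGens) := by
  obtain ⟨σ, gs', hfound, hle⟩ := h.exists_found hx hy hz hE.wt_mem hE.base_le hgs hchain hl
  refine ⟨σ, gs', hfound, ?_⟩
  rwa [Submodule.eq_of_le_of_finrank_eq (extend_le hE.base_le hgs) (by
    rw [hchain.finrank_extend, finrank_baseCode, hlen, hE.finrank_eq])] at hle

lemma forall_notMem_span_maskW {D P : Submodule (ZMod 2) Word}
    (h0 : ∀ h ∈ D, h ∉ P → pairSum h ≠ 0) (hW : ∀ h ∈ D, h ∉ P → pairSum h ≠ dec maskW) :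
    ∀ h ∈ D, h ∉ P → pairSum h ∉ Submodule.span (ZMod 2) {dec maskW} :=
  fun h hh hhP hmem => (mem_span_maskW hmem).elim (h0 h hh hhP) (hW h hh hhP)

lemma EvenCode.exists_found {E : Submodule (ZMod 2) Word} (hE : EvenCode E) :
    ∃ lams, (lams = [0, maskW, maskX, maskY] ∨ lams = [0, maskX, maskY, maskZ] ∨
        lams = [maskW, maskX, maskY, maskZ]) ∧
      ∃ (σ : Equiv.Perm (Fin 21)) (gs' : List Word),
        Found lams [5, 7, 9, 13] baseSpan baseGens gs' ∧
        E.map (LinearMap.funLeft (ZMod 2) (ZMod 2) σ) ≤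
          spanOf ((gs'.map enc).reverse ++ baseGens) := by
  have hbase : E ≤ E ⊔ baseCode := le_sup_left
  by_cases hzero : ∀ g ∈ E, g ∉ baseCode → pairSum g ≠ 0
  · obtain ⟨g, hg, hgW⟩ := hE.exists_pairSum_eq hzero (mem_baseCode (dec maskW) (by simp [baseWords]))
    have hgP : g ∉ baseCode := fun h => by
      have := wt_dec_maskW
      rw [← hgW, pairSum_of_mem h, ← enc_mod, enc_zero] at this
      exact absurd this (by decide)
    obtain ⟨D, hD, hED, hstep⟩ := exists_step [] hg hgP
    have hU := pairSum_notMem_sup (U := ⊥) (by simpa using hzero) hg hD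
    rw [hgW, bot_sup_eq] at hU
    obtain ⟨gs, hlen, hgs, hchain, hind⟩ := exists_chain 3 [g] (le_sup_step hbase hED)
      (by rw [finrank_sup_span_singleton _ hgP, finrank_baseCode, hE.finrank_eq]) hU
    obtain ⟨a, b, c, rfl⟩ := List.length_eq_three.mp hlen
    have hmem : ∀ w ∈ [g, a, b, c], w ∈ E :=
      List.forall_mem_cons.mpr ⟨hg, fun w hw => hD (hgs w hw)⟩
    have hps : ∀ w ∈ [g, a, b, c], pairSum w ∈ baseCode := fun w hw => hE.pairSum_mem w (hmem w hw)
    simp only [List.forall_mem_cons] at hps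
    obtain ⟨cx, cy, cz, cW⟩ := carries_frame (pairSum a) (pairSum b) (pairSum c)
    exact ⟨_, .inr (.inr rfl), hE.found_of_chain (.of_indepMod hps.2.1 hps.2.2.1 hps.2.2.2.1 hind)
      hps.2.1 hps.2.2.1 hps.2.2.2.1 hmem (hstep _ hgs hchain) rfl
      (.cons (hgW ▸ cW) (.cons cx (.cons cy (.cons cz .nil))))⟩
  push Not at hzero
  obtain ⟨g, hg, hgP, hg0⟩ := hzero
  obtain ⟨D, hD, hED, hstep⟩ := exists_step [] hg hgP
  have hED' := le_sup_step hbase hED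
  have hfin := finrank_sup_span_singleton _ hgP
  have hzero' : ∀ h ∈ D, h ∉ baseCode ⊔ Submodule.span (ZMod 2) {g} → pairSum h ≠ 0 := by
    intro h hh hhP h0
    obtain ⟨D', hD', -, hstep'⟩ := exists_step [g] hh hhP
    exact hE.not_chain (List.forall_mem_cons.mpr ⟨hg, List.forall_mem_singleton.mpr (hD hh)⟩)
      (hstep _ (List.forall_mem_singleton.mpr hh) (hstep' [] (by simp) trivial)) (.inl rfl)
      (.cons (.inl ⟨rfl, hg0⟩) (.cons (.inl ⟨rfl, h0⟩) .nil))
  by_cases hW : ∀ h ∈ D, h ∉ baseCode ⊔ Submodule.span (ZMod 2) {g} → pairSum h ≠ dec maskW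
  · obtain ⟨gs, hlen, hgs, hchain, hind⟩ := exists_chain 3 [g] hED'
      (by rw [hfin, finrank_baseCode, hE.finrank_eq]) (forall_notMem_span_maskW hzero' hW)
    obtain ⟨a, b, c, rfl⟩ := List.length_eq_three.mp hlen
    have hmem : ∀ w ∈ [g, a, b, c], w ∈ E :=
      List.forall_mem_cons.mpr ⟨hg, fun w hw => hD (hgs w hw)⟩
    have hps : ∀ w ∈ [g, a, b, c], pairSum w ∈ baseCode := fun w hw => hE.pairSum_mem w (hmem w hw)
    simp only [List.forall_mem_cons] at hps
    obtain ⟨cx, cy, cz, -⟩ := carries_frame (pairSum a) (pairSum b) (pairSum c)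
    exact ⟨_, .inr (.inl rfl), hE.found_of_chain (.of_indepMod hps.2.1 hps.2.2.1 hps.2.2.2.1 hind)
      hps.2.1 hps.2.2.1 hps.2.2.2.1 hmem (hstep _ hgs hchain) rfl
      (.cons (hg0 ▸ carries_zero _) (.cons cx (.cons cy (.cons cz .nil))))⟩
  push Not at hW
  obtain ⟨h, hh, hhP, hhW⟩ := hW
  obtain ⟨D', hD', hDD', hstep'⟩ := exists_step [g] hh hhP
  have hne : ∀ lam w, (lam = 0 ∧ w = 0 ∨ lam = maskW ∧ w = dec maskW) →
      ∀ k ∈ D', k ∉ baseCode ⊔ Submodule.span (ZMod 2) {g} ⊔ Submodule.span (ZMod 2) {h} →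
        pairSum k ≠ w := by
    rintro lam _ hlam k hk hkP rfl
    obtain ⟨D'', hD'', -, hstep''⟩ := exists_step [h, g] hk hkP
    have hmem : ∀ w ∈ [h, k], w ∈ D :=
      List.forall_mem_cons.mpr ⟨hh, List.forall_mem_singleton.mpr (hD' hk)⟩
    refine hE.not_chain (List.forall_mem_cons.mpr ⟨hg, fun w hw => hD (hmem w hw)⟩)
      (hstep _ hmem (hstep' _ (List.forall_mem_singleton.mpr hk) (hstep'' [] (by simp) trivial)))
      (lams := [0, maskW, lam]) ?_
      (.cons (.inl ⟨rfl, hg0⟩) (.cons (.inr ⟨rfl, hhW⟩) (.cons hlam .nil)))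
    rcases hlam with ⟨rfl, -⟩ | ⟨rfl, -⟩
    · exact .inr (.inl rfl)
    · exact .inr (.inr rfl)
  obtain ⟨gs, hlen, hgs, hchain, hind⟩ := exists_chain 2 [h, g] (le_sup_step hED' hDD')
    (by rw [finrank_sup_span_singleton _ hhP, hfin, finrank_baseCode, hE.finrank_eq])
    (forall_notMem_span_maskW (hne 0 0 (.inl ⟨rfl, rfl⟩)) (hne maskW _ (.inr ⟨rfl, rfl⟩)))
  obtain ⟨a, b, rfl⟩ := List.length_eq_two.mp hlen
  have hmem' : ∀ w ∈ [h, a, b], w ∈ D :=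
    List.forall_mem_cons.mpr ⟨hh, fun w hw => hD' (hgs w hw)⟩
  have hmem : ∀ w ∈ [g, h, a, b], w ∈ E :=
    List.forall_mem_cons.mpr ⟨hg, fun w hw => hD (hmem' w hw)⟩
  have hps : ∀ w ∈ [g, h, a, b], pairSum w ∈ baseCode := fun w hw => hE.pairSum_mem w (hmem w hw)
  simp only [List.forall_mem_cons] at hps
  obtain ⟨z, hz, hframe⟩ := exists_frame_extension hps.2.2.1 hps.2.2.2.1 hind
  obtain ⟨cx, cy, -, cW⟩ := carries_frame (pairSum a) (pairSum b) z
  exact ⟨_, .inl rfl, hE.found_of_chain hframe hps.2.2.1 hps.2.2.2.1 hz hmem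
    (hstep _ hmem' (hstep' _ hgs hchain)) rfl
    (.cons (hg0 ▸ carries_zero _) (.cons (hhW ▸ cW) (.cons cx (.cons cy .nil))))⟩

lemma dec_maskFull : dec maskFull = 1 := by decide +kernel

/-- The words of even weight in a code. -/
def evenWords (C : Submodule (ZMod 2) Word) : Submodule (ZMod 2) Word :=
  C ⊓ LinearMap.ker (∑ i, LinearMap.proj i)

lemma mem_evenWords {C : Submodule (ZMod 2) Word} {w : Word} :
    w ∈ evenWords C ↔ w ∈ C ∧ Even (wt w) := by
  rw [← ZMod.natCast_eq_zero_iff_even, wt_eq_sum, Nat.cast_sum]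
  simp [evenWords]

lemma GoodCode9.evenCode {C : Submodule (ZMod 2) Word} (hC : GoodCode9 (Fin 21) C)
    (hle : baseCode ≤ C) : EvenCode (evenWords C) where
  wt_mem w hw := by
    obtain ⟨hwC, heven⟩ := mem_evenWords.mp hw
    have hwt := hC.2.2 w hwC
    simp only [Set.mem_insert_iff, Set.mem_singleton_iff] at hwt
    rcases hwt with h | h | h | h | h | h | h | h <;> rw [h] at heven
    exacts [.inl (eq_zero_of_wt h), absurd heven (by decide), .inr (.inl h),
      absurd heven (by decide), .inr (.inr (.inl h)), absurd heven (by decide),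
      .inr (.inr (.inr h)), absurd heven (by decide)]
  base_le w hw := by
    refine mem_evenWords.mpr ⟨hle hw, ?_⟩
    rcases baseCode_wt hw with rfl | rfl | h
    · rw [← enc_mod, enc_zero]
      decide
    · rw [wt_dec_maskW]
      decide
    · rw [h]
      decide
  finrank_eq := by
    have := finrank_inf_ker C (∑ i, LinearMap.proj i) hC.2.1
      (by simp only [LinearMap.sum_apply, LinearMap.proj_apply]; decide)
    rw [hC.1] at this
    exact Nat.succ_injective this
  pairSum_mem w hw := pairSum_mem hC hle (mem_evenWords.mp hw).1

/-- Every code in the classification is equivalent to one of the codes in normal form. -/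
theorem GoodCode9.exists_codeEquiv_normalCode {C : Submodule (ZMod 2) Word}
    (hC : GoodCode9 (Fin 21) C) : ∃ k < 3, CodeEquiv (Fin 21) C (normalCode k) := by
  obtain ⟨_, ⟨π, rfl⟩, hle⟩ := hC.exists_baseCode_le
  have hD := hC.map π
  set D := C.map (LinearMap.funLeft (ZMod 2) (ZMod 2) π)
  obtain ⟨lams, hlams, σ, gs, hfound, hspan⟩ := (hD.evenCode hle).exists_found
  obtain ⟨k, hk, hequiv⟩ := hfound.codeEquiv_normalCode hlams
    (C := D.map (LinearMap.funLeft (ZMod 2) (ZMod 2) σ)) (hD.map σ).1 (by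
      rw [spanOf_cons, dec_maskFull, ← inf_ker_sup_span_singleton D (∑ i, LinearMap.proj i) hD.2.1
        (by simp only [LinearMap.sum_apply, LinearMap.proj_apply]; decide), Submodule.map_sup,
        Submodule.map_span, Set.image_singleton]
      exact sup_le_sup hspan le_rfl)
  exact ⟨k, hk, CodeEquiv.trans ⟨π, rfl⟩ (CodeEquiv.trans ⟨σ, rfl⟩ hequiv)⟩

lemma ListsCodes.lightWords_eq {l : List ℕ} {W : Submodule (ZMod 2) Word} (h : ListsCodes l W) :
    lightWords W = (l.filter fun m => m % 31 = 5).toFinset.card := by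
  rw [lightWords, ← Set.ncard_image_of_injective _ enc_injective, ← Set.ncard_coe_finset]
  congr 1
  ext m
  simp only [Set.mem_image, Set.mem_ofPred_eq, List.coe_toFinset, List.mem_filter,
    decide_eq_true_eq, h m]
  constructor
  · rintro ⟨w, ⟨hw, h5⟩, rfl⟩
    exact ⟨⟨w, hw, rfl⟩, by rw [enc_mod, h5]⟩
  · rintro ⟨⟨w, hw, rfl⟩, h5⟩
    exact ⟨w, ⟨hw, by rw [← enc_mod, h5]⟩, rfl⟩

lemma lightWords_normalCode :
    lightWords (normalCode 0) = 13 ∧ lightWords (normalCode 1) = 9 ∧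
      lightWords (normalCode 2) = 5 := by
  refine ⟨?_, ?_, ?_⟩ <;> rw [normalCode, (lists_spanList _ (by decide +kernel)).lightWords_eq] <;>
    decide +kernel

lemma GoodCode9.codeEquiv_normalCode {C : Submodule (ZMod 2) Word} (hC : GoodCode9 (Fin 21) C) :
    lightWords C = 13 ∧ CodeEquiv (Fin 21) C (normalCode 0) ∨
      lightWords C = 9 ∧ CodeEquiv (Fin 21) C (normalCode 1) ∨
      lightWords C = 5 ∧ CodeEquiv (Fin 21) C (normalCode 2) := by
  obtain ⟨h0, h1, h2⟩ := lightWords_normalCode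
  obtain ⟨k, hk, h⟩ := hC.exists_codeEquiv_normalCode
  have hlight := h.lightWords_eq
  interval_cases k
  · exact .inl ⟨hlight.trans h0, h⟩
  · exact .inr (.inl ⟨hlight.trans h1, h⟩)
  · exact .inr (.inr ⟨hlight.trans h2, h⟩)

/-- A code in the classification has 13, 9 or 5 words of weight 5. -/
lemma GoodCode9.lightWords_mem {S : Type*} (e : S ≃ Fin 21) {C : Submodule (ZMod 2) (S → ZMod 2)}
    (hC : GoodCode9 S C) : lightWords C = 13 ∨ lightWords C = 9 ∨ lightWords C = 5 := by
  rw [← lightWords_map e.symm]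
  rcases (hC.map e.symm).codeEquiv_normalCode with h | h | h
  exacts [.inl h.1, .inr (.inl h.1), .inr (.inr h.1)]

/-- The number of words of weight 5 is a complete invariant of the codes in the classification. -/
theorem GoodCode9.codeEquiv_of_lightWords_eq {S : Type*} (e : S ≃ Fin 21)
    {C D : Submodule (ZMod 2) (S → ZMod 2)} (hC : GoodCode9 S C) (hD : GoodCode9 S D)
    (h : lightWords C = lightWords D) : CodeEquiv S C D := by
  have hequiv : CodeEquiv (Fin 21) (C.map (LinearMap.funLeft (ZMod 2) (ZMod 2) e.symm))
      (D.map (LinearMap.funLeft (ZMod 2) (ZMod 2) e.symm)) := by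
    rw [← lightWords_map e.symm C, ← lightWords_map e.symm D] at h
    rcases (hC.map e.symm).codeEquiv_normalCode with ⟨h1, h1'⟩ | ⟨h1, h1'⟩ | ⟨h1, h1'⟩ <;>
      rcases (hD.map e.symm).codeEquiv_normalCode with ⟨h2, h2'⟩ | ⟨h2, h2'⟩ | ⟨h2, h2'⟩ <;>
      first | exact h1'.trans h2'.symm | omega
  have := hequiv.map e
  rwa [map_funLeft_map, map_funLeft_map, e.symm_comp_self, map_funLeft_id, map_funLeft_id] at this

/-- on a 21-element set `S` there are, up to the symmetric group action,
exactly three `F₂`-linear codes of dimension 9 containing the full word `S` and with all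
weights in `{0,5,8,9,12,13,16,21}`; representatives are given, via any bijection
`γ : S ≃ P²(F₄)`, by the codes `C_F` for `F` a four-point set with no three points
collinear, with exactly one collinear triple, and with all four points collinear. -/
theorem three_codes_dim9 (F : Type*) [Field F] [Fintype F] (hF : Fintype.card F = 4)
    (S : Type*) (hS : Nat.card S = 21)
    (γ : S ≃ Projectivization F (Fin 3 → F))
    (F₁ F₂ F₃ : Finset (Projectivization F (Fin 3 → F)))
    (hF₁ : F₁.card = 4)
    (hF₁c : ∀ T : Finset (Projectivization F (Fin 3 → F)),
      T ⊆ F₁ → T.card = 3 → ¬ CollinSet F ↑T)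
    (hF₂ : F₂.card = 4)
    (hF₂c : ∃! T : Finset (Projectivization F (Fin 3 → F)),
      T ⊆ F₂ ∧ T.card = 3 ∧ CollinSet F ↑T)
    (hF₃ : F₃.card = 4)
    (hF₃c : CollinSet F ↑F₃) :
    GoodCode9 S (Submodule.map (LinearMap.funLeft (ZMod 2) (ZMod 2) ⇑γ) (CF F F₁)) ∧
    GoodCode9 S (Submodule.map (LinearMap.funLeft (ZMod 2) (ZMod 2) ⇑γ) (CF F F₂)) ∧
    GoodCode9 S (Submodule.map (LinearMap.funLeft (ZMod 2) (ZMod 2) ⇑γ) (CF F F₃)) ∧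
    (¬ CodeEquiv S (Submodule.map (LinearMap.funLeft (ZMod 2) (ZMod 2) ⇑γ) (CF F F₁))
        (Submodule.map (LinearMap.funLeft (ZMod 2) (ZMod 2) ⇑γ) (CF F F₂))) ∧
    (¬ CodeEquiv S (Submodule.map (LinearMap.funLeft (ZMod 2) (ZMod 2) ⇑γ) (CF F F₁))
        (Submodule.map (LinearMap.funLeft (ZMod 2) (ZMod 2) ⇑γ) (CF F F₃))) ∧
    (¬ CodeEquiv S (Submodule.map (LinearMap.funLeft (ZMod 2) (ZMod 2) ⇑γ) (CF F F₂))
        (Submodule.map (LinearMap.funLeft (ZMod 2) (ZMod 2) ⇑γ) (CF F F₃))) ∧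
    (∀ C : Submodule (ZMod 2) (S → ZMod 2), GoodCode9 S C →
      CodeEquiv S C (Submodule.map (LinearMap.funLeft (ZMod 2) (ZMod 2) ⇑γ) (CF F F₁)) ∨
      CodeEquiv S C (Submodule.map (LinearMap.funLeft (ZMod 2) (ZMod 2) ⇑γ) (CF F F₂)) ∨
      CodeEquiv S C (Submodule.map (LinearMap.funLeft (ZMod 2) (ZMod 2) ⇑γ) (CF F F₃))) := by
  obtain ⟨φ, hφ⟩ := exists_plane_equiv F hF
  obtain ⟨hg₁, hl₁, -, -⟩ := CF_map_spec φ hφ F₁ hF₁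
  obtain ⟨hg₂, -, hl₂, -⟩ := CF_map_spec φ hφ F₂ hF₂
  obtain ⟨hg₃, -, -, hl₃⟩ := CF_map_spec φ hφ F₃ hF₃
  have e : S ≃ Fin 21 := γ.trans φ.symm
  have hgood : ∀ {D : Submodule (ZMod 2) (Projectivization F (Fin 3 → F) → ZMod 2)},
      GoodCode9 (Fin 21) (D.map (LinearMap.funLeft (ZMod 2) (ZMod 2) φ)) →
        GoodCode9 S (D.map (LinearMap.funLeft (ZMod 2) (ZMod 2) γ)) := by
    intro D h
    have := h.map (γ.trans φ.symm)
    rwa [map_funLeft_map, show φ ∘ (γ.trans φ.symm) = γ from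
      funext fun s => φ.apply_symm_apply (γ s)] at this
  have hlight : ∀ D : Submodule (ZMod 2) (Projectivization F (Fin 3 → F) → ZMod 2),
      lightWords (D.map (LinearMap.funLeft (ZMod 2) (ZMod 2) γ)) =
        lightWords (D.map (LinearMap.funLeft (ZMod 2) (ZMod 2) φ)) :=
    fun D => (lightWords_map γ D).trans (lightWords_map φ D).symm
  have h₁ := (hlight _).trans (hl₁ hF₁c)
  have h₂ := (hlight _).trans (hl₂ hF₂c)
  have h₃ := (hlight _).trans (hl₃ hF₃c)
  refine ⟨hgood hg₁, hgood hg₂, hgood hg₃, fun h => ?_, fun h => ?_, fun h => ?_, fun C hC => ?_⟩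
  · exact absurd (h₁.symm.trans (h.lightWords_eq.trans h₂)) (by decide)
  · exact absurd (h₁.symm.trans (h.lightWords_eq.trans h₃)) (by decide)
  · exact absurd (h₂.symm.trans (h.lightWords_eq.trans h₃)) (by decide)
  · rcases hC.lightWords_mem e with h | h | h
    · exact .inl (hC.codeEquiv_of_lightWords_eq e (hgood hg₁) (h.trans h₁.symm))
    · exact .inr (.inl (hC.codeEquiv_of_lightWords_eq e (hgood hg₂) (h.trans h₂.symm)))
    · exact .inr (.inr (hC.codeEquiv_of_lightWords_eq e (hgood hg₃) (h.trans h₃.symm)))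
end

section
/- Let F ⊆ P²(F₄) be a four-point subset no three of whose points are collinear. Then the number of words c ∈ Pow(P²(F₄)) of weight 6 that are centers of Cremona transformation with respect to C_F is exactly 1644. -/
/-- A linear word of a code: a word of the code of weight 5. -/
def IsLinearWord {S : Type*} (C : Submodule (ZMod 2) (S → ZMod 2)) (w : S → ZMod 2) : Prop :=
  w ∈ C ∧ wt w = 5

/-- A quadratic word of a code: a word of the code of weight 8 which is not the sum of two
linear words of the code. -/
def IsQuadraticWord {S : Type*} (C : Submodule (ZMod 2) (S → ZMod 2)) (w : S → ZMod 2) : Prop :=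
  w ∈ C ∧ wt w = 8 ∧
    ¬ ∃ l₁ l₂ : S → ZMod 2, IsLinearWord C l₁ ∧ IsLinearWord C l₂ ∧ w = l₁ + l₂

/-- A center of Cremona transformation with respect to a code `C`: a word of weight 6 which
meets every linear word of `C` in at most 2 points and every quadratic word of `C` in at
most 4 points. -/
def IsCremonaCenter {S : Type*} (C : Submodule (ZMod 2) (S → ZMod 2)) (c : S → ZMod 2) :
    Prop :=
  wt c = 6 ∧
    (∀ l, IsLinearWord C l → ({x | c x = 1} ∩ {x | l x = 1}).ncard ≤ 2) ∧
    (∀ q, IsQuadraticWord C q → ({x | c x = 1} ∩ {x | q x = 1}).ncard ≤ 4)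

/-! ### Counting subsets with packed counters -/

/-- The base-16 number whose digits are the values of `h` along the list `cs`. -/
def pack {β : Type*} (cs : List β) (h : β → ℕ) : ℕ :=
  cs.foldr (fun b a => h b + 16 * a) 0

theorem pack_cons {β : Type*} (b : β) (cs : List β) (h : β → ℕ) :
    pack (b :: cs) h = h b + 16 * pack cs h := rfl

theorem pack_add {β : Type*} (cs : List β) (h k : β → ℕ) :
    pack cs (fun b => h b + k b) = pack cs h + pack cs k := by
  induction cs with
  | nil => rfl
  | cons b cs ih => simp only [pack_cons, ih]; ring

theorem land_add_sixteen_mul_eq_zero {x : ℕ} (hx : x < 16) (a b : ℕ) :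
    (x + 16 * a) &&& (8 + 16 * b) = 0 ↔ x < 8 ∧ a &&& b = 0 := by
  have hm : ((x + 16 * a) &&& (8 + 16 * b)) % 2 ^ 4 = x &&& 8 := by
    rw [Nat.and_mod_two_pow]; congr 1 <;> omega
  have hd : ((x + 16 * a) &&& (8 + 16 * b)) / 2 ^ 4 = a &&& b := by
    rw [Nat.and_div_two_pow]; congr 1 <;> omega
  have hx8 : x &&& 8 = 0 ↔ x < 8 := by
    clear hm hd
    revert x; decide
  rw [← hx8, ← hm, ← hd]
  omega

theorem pack_land_eq_zero_iff {β : Type*} (cs : List β) (h : β → ℕ) (hlt : ∀ b ∈ cs, h b < 16) :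
    pack cs h &&& pack cs (fun _ => 8) = 0 ↔ ∀ b ∈ cs, h b < 8 := by
  induction cs with
  | nil => simp [pack]
  | cons b cs ih =>
    rw [List.forall_mem_cons] at hlt
    rw [pack_cons, pack_cons, land_add_sixteen_mul_eq_zero hlt.1, ih hlt.2, List.forall_mem_cons]

/-- The number of ways to add `k` entries of a list of increments to `s`, one after the other,
so that no intermediate sum meets the mask `M`. -/
def countFrom (M : ℕ) : List ℕ → ℕ → ℕ → ℕ
  | _, 0, _ => 1
  | [], _ + 1, _ => 0
  | a :: as, k + 1, s => Nat.add (countFrom M as (k + 1) s)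
     (match Nat.land (Nat.add s a) M with
      | 0 => countFrom M as k (Nat.add s a)
      | _ + 1 => 0)

theorem countFrom_cons (M a : ℕ) (as : List ℕ) (k s : ℕ) :
    countFrom M (a :: as) (k + 1) s = countFrom M as (k + 1) s +
      if (s + a) &&& M = 0 then countFrom M as k (s + a) else 0 := by
  have hland : Nat.land (Nat.add s a) M = (s + a) &&& M := rfl
  rw [countFrom, hland]
  split_ifs with h
  · rw [h]; rfl
  · obtain ⟨n, hn⟩ := Nat.exists_eq_succ_of_ne_zero h
    rw [hn]; rfl

section Count

variable {α β : Type*} (cs : List β) (hit : α → β → ℕ) (slack : β → ℕ)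

/-- The counter of every constraint stays below eight. -/
def Admissible (A : Finset α) : Prop := ∀ b ∈ cs, slack b + ∑ i ∈ A, hit i b < 8

instance (A : Finset α) : Decidable (Admissible cs hit slack A) := by
  unfold Admissible; infer_instance

variable {cs hit slack}

theorem Admissible.mono {A B : Finset α} (hAB : A ⊆ B) (hB : Admissible cs hit slack B) :
    Admissible cs hit slack A := fun b hb =>
  (Nat.add_le_add_left (Finset.sum_le_sum_of_subset hAB) _).trans_lt (hB b hb)

theorem pack_add_sum [DecidableEq α] (A : Finset α) :
    pack cs slack + ∑ i ∈ A, pack cs (hit i) = pack cs (fun b => slack b + ∑ i ∈ A, hit i b) := by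
  induction A using Finset.induction_on with
  | empty => simp
  | insert a A ha ih =>
    simp only [Finset.sum_insert ha]
    rw [add_left_comm, ih, ← pack_add]
    congr 1; funext b; ring

theorem pack_land_eq_zero_iff_admissible [DecidableEq α] (hhit : ∀ i b, hit i b ≤ 1)
    (hslack : ∀ b ∈ cs, slack b ≤ 5) {A : Finset α} (hA : A.card ≤ 6) :
    (pack cs slack + ∑ i ∈ A, pack cs (hit i)) &&& pack cs (fun _ => 8) = 0 ↔
      Admissible cs hit slack A := by
  rw [pack_add_sum, pack_land_eq_zero_iff, Admissible]
  intro b hb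
  have h₁ : ∑ i ∈ A, hit i b ≤ A.card * 1 := Finset.sum_le_card_nsmul _ _ _ fun i _ => hhit i b
  have h₂ := hslack b hb
  omega

theorem countFrom_eq_card [DecidableEq α] (hhit : ∀ i b, hit i b ≤ 1)
    (hslack : ∀ b ∈ cs, slack b ≤ 5) (l : List α) (hl : l.Nodup) (k : ℕ) (A : Finset α) (hlA : ∀ i ∈ l, i ∉ A)
    (hk : A.card + k ≤ 6) (hA : Admissible cs hit slack A) :
    countFrom (pack cs fun _ => 8) (l.map fun i => pack cs (hit i)) k
        (pack cs slack + ∑ i ∈ A, pack cs (hit i)) =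
      ((l.toFinset.powersetCard k).filter fun D => Admissible cs hit slack (A ∪ D)).card := by
  induction l generalizing k A with
  | nil =>
    cases k with
    | zero => simp [countFrom, Finset.filter_singleton, hA]
    | succ k =>
      simp [countFrom, Finset.powersetCard_eq_empty.2 (Finset.card_empty.trans_lt k.succ_pos)]
  | cons a l ih =>
    cases k with
    | zero => simp [countFrom, Finset.filter_singleton, hA]
    | succ k =>
      rw [List.nodup_cons] at hl
      rw [List.forall_mem_cons] at hlA
      have hal : a ∉ l.toFinset := by simpa using hl.1
      have hcard : (insert a A).card = A.card + 1 := Finset.card_insert_of_notMem hlA.1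
      have hsum : pack cs slack + ∑ i ∈ A, pack cs (hit i) + pack cs (hit a) =
          pack cs slack + ∑ i ∈ insert a A, pack cs (hit i) := by
        rw [Finset.sum_insert hlA.1]; ring
      have hunion (D : Finset α) : A ∪ insert a D = insert a A ∪ D := by
        ext; simp only [Finset.mem_union, Finset.mem_insert]; tauto
      have hadm := pack_land_eq_zero_iff_admissible hhit hslack (A := insert a A) (by omega)
      rw [List.map_cons, countFrom_cons, hsum, if_congr hadm rfl rfl, List.toFinset_cons,
        Finset.powersetCard_succ_insert hal, Finset.filter_union, Finset.card_union_of_disjoint,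
        ih hl.2 (k + 1) A hlA.2 hk hA]
      · congr 1
        rw [Finset.filter_image, Finset.card_image_of_injOn]
        · simp only [hunion]
          split_ifs with h
          · refine ih hl.2 k _ (fun i hi => ?_) (by omega) h
            rw [Finset.mem_insert, not_or]
            exact ⟨fun e => hl.1 (e ▸ hi), hlA.2 i hi⟩
          · rw [eq_comm, Finset.card_eq_zero, Finset.filter_eq_empty_iff]
            exact fun D _ hD => h (hD.mono Finset.subset_union_left)
        · intro D hD E hE hDE
          have hnot {D : Finset α} (hD : D ∈ l.toFinset.powersetCard k) : a ∉ D :=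
            fun h => hal ((Finset.mem_powersetCard.1 hD).1 h)
          simp only [Finset.coe_filter, Set.mem_ofPred_eq] at hD hE
          rw [← Finset.erase_insert (hnot hD.1), ← Finset.erase_insert (hnot hE.1)]
          exact congrArg (Finset.erase · a) hDE
      · refine Finset.disjoint_left.2 fun D hD hD' => ?_
        obtain ⟨E, -, rfl⟩ := Finset.mem_image.1 (Finset.mem_filter.1 hD').1
        exact hal ((Finset.mem_powersetCard.1 (Finset.mem_filter.1 hD).1).1
          (Finset.mem_insert_self a E))

end Count

/-! ### The code in terms of bit masks -/

/-- The lines meeting the frame `{0, 1, 2, 3}` in an even number of points, as bit masks. -/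
def evenLines : List ℕ := [
  118, 901, 140291, 590992, 1081369, 278666, 7180, 296512, 1066272, 168096, 150032, 1059008,
  274704]

/-- The lines meeting the frame `{0, 1, 2, 3}` in an odd number of points, as bit masks. -/
def oddLines : List ℕ := [
  544833, 329761, 1118722, 559362, 1966084, 196936, 122884, 533032]

/-- The sums of two distinct lines that meet the frame in an odd number of points. -/
def quadrics : List ℕ := [
  874592, 1655363, 55619, 1462341, 741641, 634949, 29289, 1317411, 885027, 1771557, 395625,
  321573, 862729, 1678080, 987654, 1184586, 1110534, 1650730, 1476870, 755786, 616710, 43818,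
  1900876, 2088960, 1450540, 188748, 729952, 639532]

/-- Ten lines which span all others. -/
def lineBasis : List ℕ := [
  118, 901, 140291, 590992, 1081369, 544833, 329761, 278666, 1118722, 1966084]

/-- The points whose bit is set in a mask. -/
def bits (n : ℕ) : Finset (Fin 21) := Finset.univ.filter fun i => n.testBit i

theorem mem_bits {n : ℕ} {i : Fin 21} : i ∈ bits n ↔ n.testBit i = true := by simp [bits]

theorem bits_xor (a b : ℕ) : bits (a ^^^ b) = symmDiff (bits a) (bits b) := by
  ext i
  simp only [Finset.mem_symmDiff, mem_bits, Nat.testBit_xor]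
  cases a.testBit i <;> cases b.testBit i <;> simp

/-- The number of the lowest 21 bits that are set. -/
def bitCount (n : ℕ) : ℕ := (List.range 21).foldr (fun i a => n / 2 ^ i % 2 + a) 0

theorem card_bits (n : ℕ) : (bits n).card = bitCount n := by
  rw [bits, Finset.card_filter, ← List.sum_ofFn]
  simp only [Nat.testBit_eq_decide_div_mod_eq, decide_eq_true_eq]
  have h (m : ℕ) : (if m % 2 = 1 then 1 else 0) = m % 2 := by split_ifs <;> omega
  simp only [h]
  simp [bitCount, List.range_succ, List.ofFn_succ]

/-- The mask has an even number of bits in the frame. -/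
def evenOnFrame (n : ℕ) : Bool :=
  !(n.testBit 0 ^^ n.testBit 1 ^^ n.testBit 2 ^^ n.testBit 3)

/-- All sums of elements of a list of masks. -/
def xorSpan : List ℕ → List ℕ
  | [] => [0]
  | b :: bs => xorSpan bs ++ (xorSpan bs).map (b ^^^ ·)

theorem lines_subset_xorSpan : ∀ l ∈ evenLines ++ oddLines, l ∈ xorSpan lineBasis := by
  decide +kernel

theorem lineBasis_subset : ∀ l ∈ lineBasis, l ∈ evenLines ++ oddLines := by
  decide +kernel

theorem mem_evenLines_of_bitCount : ∀ n ∈ xorSpan lineBasis,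
    bitCount n = 5 → evenOnFrame n → n ∈ evenLines := by
  decide +kernel

theorem mem_quadrics_of_bitCount : ∀ n ∈ xorSpan lineBasis, bitCount n = 8 → evenOnFrame n →
    n ∈ quadrics ∨ ∃ a ∈ evenLines, ∃ b ∈ evenLines, n = a ^^^ b := by
  decide +kernel

theorem evenLines_spec : ∀ l ∈ evenLines, bitCount l = 5 ∧ evenOnFrame l := by
  decide +kernel

theorem quadrics_spec : ∀ q ∈ quadrics, bitCount q = 8 ∧ evenOnFrame q ∧
    q ∈ xorSpan lineBasis ∧
    ∀ a ∈ evenLines, ∀ b ∈ evenLines, bits q ≠ bits (a ^^^ b) := by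
  decide +kernel

/-- The conditions defining centers of Cremona transformation: the mask to be intersected with,
and the difference of seven and the allowed size of the intersection. -/
def constraints : List (ℕ × ℕ) := evenLines.map (·, 5) ++ quadrics.map (·, 3)

/-- The packed increments of the counters of all constraints, one for each point. -/
def increments : List ℕ := [
  1352160640243439891090214289680, 92919771638909713397577202778285720731905,
  1467568839287347075877530831382972227083858608145,
  1467568921275380876108559891095024415719187087360, 282574488408065,
  1553202388700876000402221303728245273806266957825,
  97054237240867739298658630653008821972719632385, 17660906573840,
  97054329478656843087969749655167261975263576080,
  1553202388699635387437136591737379610976074072080, 4580184320,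
  92918353838983309999955832829468150333440, 1417841843344559541788211915301847040,
  97432048330596401093031931308778454803508363520,
  1467232934291526235915039723355356051975537950720,
  1467233016320844332076196947310713159483983462400,
  1552869189991987601099184506359140267647026860032,
  97431956133935824179540109297949042057846718720,
  380506486217902560315840243234996823098654720,
  1552869189991987601099184506359140267647026860032,
  380506487635094015011412707907004039937720320]

theorem map_pack_eq_increments : (List.finRange 21).map
    (fun i : Fin 21 => pack constraints fun b => (b.1.testBit i).toNat) = increments := by
  decide +kernel

theorem pack_slack_eq : pack constraints Prod.snd =
    4676805239458889338251791464692106263378934453589 := by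
  decide +kernel

theorem pack_eight_eq : pack constraints (fun _ => 8) =
    12471480638557038235338110572512281767730624366728 := by
  decide +kernel

theorem countFrom_increments : countFrom
    12471480638557038235338110572512281767730624366728 increments 6
    4676805239458889338251791464692106263378934453589 = 1644 := by
  decide +kernel

theorem card_filter_powersetCard :
    ((Finset.univ.powersetCard 6).filter fun A : Finset (Fin 21) =>
      (∀ l ∈ evenLines, (A ∩ bits l).card ≤ 2) ∧ ∀ q ∈ quadrics, (A ∩ bits q).card ≤ 4).card =
      1644 := by
  have h := countFrom_eq_card (cs := constraints)
    (hit := fun (i : Fin 21) b => (b.1.testBit i).toNat) (slack := Prod.snd)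
    (fun i b => Bool.toNat_le _) (by decide) (List.finRange 21) (List.nodup_finRange 21) 6 ∅
    (by simp) (by simp) (by decide)
  rw [map_pack_eq_increments, Finset.sum_empty, add_zero, pack_slack_eq, pack_eight_eq,
    countFrom_increments] at h
  rw [h]
  have hsum (A : Finset (Fin 21)) (n : ℕ) :
      ∑ i ∈ A, (n.testBit i).toNat = (A ∩ bits n).card := by
    rw [bits, Finset.inter_filter, Finset.inter_univ, Finset.card_filter]
    exact Finset.sum_congr rfl fun i _ => by cases n.testBit i <;> rfl
  have htop : (List.finRange 21).toFinset = Finset.univ := by ext; simp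
  rw [htop]
  refine congrArg Finset.card (Finset.filter_congr fun A _ => ?_)
  simp only [Admissible, constraints, List.forall_mem_append, List.forall_mem_map, hsum,
    Finset.empty_union]
  refine and_congr (forall₂_congr fun l _ => ?_) (forall₂_congr fun q _ => ?_) <;> omega

section Words

variable {S : Type*} (e : Fin 21 ≃ S)

/-- The word whose support is the image of a set of labels. -/
def word (A : Finset (Fin 21)) : S → ZMod 2 := fun s => if e.symm s ∈ A then 1 else 0

theorem setOf_word_eq_one (A : Finset (Fin 21)) : {s | word e A s = 1} = e '' A := by
  ext s
  simp [word, Equiv.image_eq_preimage_symm]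

theorem word_injective : Function.Injective (word e) := fun A B h => by
  have hAB := congrArg (fun w : S → ZMod 2 => {s | w s = 1}) h
  simp only [setOf_word_eq_one] at hAB
  exact_mod_cast e.injective.image_injective hAB

theorem word_surjective : Function.Surjective (word e) := fun w => by
  refine ⟨Finset.univ.filter fun i => w (e i) = 1, funext fun s => ?_⟩
  have h01 : ∀ x : ZMod 2, (if x = 1 then 1 else 0) = x := by decide
  simp [word, h01]

theorem wt_word (A : Finset (Fin 21)) : wt (word e A) = A.card := by
  rw [wt, setOf_word_eq_one, Set.ncard_image_of_injective _ e.injective, Set.ncard_coe_finset]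

theorem ncard_inter_word (A B : Finset (Fin 21)) :
    ({s | word e A s = 1} ∩ {s | word e B s = 1}).ncard = (A ∩ B).card := by
  rw [setOf_word_eq_one, setOf_word_eq_one, ← Set.image_inter e.injective,
    Set.ncard_image_of_injective _ e.injective, ← Finset.coe_inter, Set.ncard_coe_finset]

theorem word_bits_xor (a b : ℕ) :
    word e (bits (a ^^^ b)) = word e (bits a) + word e (bits b) := by
  funext s
  simp only [word, bits_xor, Finset.mem_symmDiff, Pi.add_apply]
  by_cases ha : e.symm s ∈ bits a <;> by_cases hb : e.symm s ∈ bits b <;> simp [ha, hb]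
  decide

theorem mem_span_word_iff (bs : List ℕ) (w : S → ZMod 2) :
    w ∈ Submodule.span (ZMod 2) {v | ∃ b ∈ bs, v = word e (bits b)} ↔
      ∃ n ∈ xorSpan bs, w = word e (bits n) := by
  have hzero : word e (bits 0) = 0 := by funext s; simp [word, bits]
  induction bs generalizing w with
  | nil => simp [xorSpan, hzero]
  | cons b bs ih =>
    have hset : {v | ∃ a ∈ b :: bs, v = word e (bits a)} =
        insert (word e (bits b)) {v | ∃ a ∈ bs, v = word e (bits a)} := by
      ext v; simp
    have h01 : ∀ x : ZMod 2, x = 0 ∨ x = 1 := by decide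
    simp only [hset, Submodule.mem_span_insert, ih, xorSpan, List.mem_append, List.mem_map]
    constructor
    · rintro ⟨t, _, ⟨n, hn, rfl⟩, rfl⟩
      rcases h01 t with rfl | rfl
      · exact ⟨n, Or.inl hn, by simp⟩
      · exact ⟨b ^^^ n, Or.inr ⟨n, hn, rfl⟩, by rw [word_bits_xor, one_smul]⟩
    · rintro ⟨_, hn | ⟨n, hn, rfl⟩, rfl⟩
      · exact ⟨0, _, ⟨_, hn, rfl⟩, by simp⟩
      · exact ⟨1, _, ⟨n, hn, rfl⟩, by rw [word_bits_xor, one_smul]⟩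

theorem sum_frame_word_eq_zero_iff [DecidableEq S] (n : ℕ) :
    ∑ s ∈ (Finset.univ : Finset (Fin 4)).image (fun j => e (j.castLE (by decide))),
      word e (bits n) s = 0 ↔ evenOnFrame n := by
  rw [Finset.sum_image fun i _ j _ h => by simpa using h]
  have h : ∀ a b c d : Bool, ((if a then 1 else 0) + (if b then 1 else 0) +
      (if c then 1 else 0) + (if d then 1 else 0) : ZMod 2) = 0 ↔ !(a ^^ b ^^ c ^^ d) := by decide
  simp only [word, mem_bits, Equiv.symm_apply_apply, Fin.sum_univ_four, evenOnFrame]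
  exact h _ _ _ _

variable {e} {C : Submodule (ZMod 2) (S → ZMod 2)}

theorem isLinearWord_iff
    (hC : ∀ w, w ∈ C ↔ ∃ n ∈ xorSpan lineBasis, evenOnFrame n ∧ w = word e (bits n))
    (w : S → ZMod 2) :
    IsLinearWord C w ↔ ∃ l ∈ evenLines, w = word e (bits l) := by
  constructor
  · rintro ⟨hw, hwt⟩
    obtain ⟨n, hn, heven, rfl⟩ := (hC w).1 hw
    rw [wt_word, card_bits] at hwt
    exact ⟨n, mem_evenLines_of_bitCount n hn hwt heven, rfl⟩
  · rintro ⟨l, hl, rfl⟩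
    have h := evenLines_spec l hl
    exact ⟨(hC _).2 ⟨l, lines_subset_xorSpan l (List.mem_append_left _ hl), h.2, rfl⟩,
      by rw [wt_word, card_bits, h.1]⟩

theorem isQuadraticWord_iff
    (hC : ∀ w, w ∈ C ↔ ∃ n ∈ xorSpan lineBasis, evenOnFrame n ∧ w = word e (bits n))
    (w : S → ZMod 2) :
    IsQuadraticWord C w ↔ ∃ q ∈ quadrics, w = word e (bits q) := by
  simp only [IsQuadraticWord, isLinearWord_iff hC]
  constructor
  · rintro ⟨hw, hwt, hsum⟩
    obtain ⟨n, hn, heven, rfl⟩ := (hC w).1 hw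
    rw [wt_word, card_bits] at hwt
    rcases mem_quadrics_of_bitCount n hn hwt heven with hq | ⟨a, ha, b, hb, rfl⟩
    · exact ⟨n, hq, rfl⟩
    · exact absurd ⟨_, _, ⟨a, ha, rfl⟩, ⟨b, hb, rfl⟩, word_bits_xor e a b⟩ hsum
  · rintro ⟨q, hq, rfl⟩
    obtain ⟨hcard, heven, hspan, hne⟩ := quadrics_spec q hq
    refine ⟨(hC _).2 ⟨q, hspan, heven, rfl⟩, by rw [wt_word, card_bits, hcard], ?_⟩
    rintro ⟨_, _, ⟨a, ha, rfl⟩, ⟨b, hb, rfl⟩, h⟩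
    rw [← word_bits_xor] at h
    exact hne a ha b hb (word_injective e h)

theorem isCremonaCenter_word_iff
    (hC : ∀ w, w ∈ C ↔ ∃ n ∈ xorSpan lineBasis, evenOnFrame n ∧ w = word e (bits n))
    (A : Finset (Fin 21)) :
    IsCremonaCenter C (word e A) ↔ A.card = 6 ∧ (∀ l ∈ evenLines, (A ∩ bits l).card ≤ 2) ∧
      ∀ q ∈ quadrics, (A ∩ bits q).card ≤ 4 := by
  simp only [IsCremonaCenter, isLinearWord_iff hC, isQuadraticWord_iff hC, wt_word,
    forall_exists_index, and_imp]
  refine and_congr_right fun _ => and_congr ?_ ?_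
  · exact ⟨fun h l hl => ncard_inter_word e A _ ▸ h _ l hl rfl,
      fun h _ l hl hw => by rw [hw, ncard_inter_word]; exact h l hl⟩
  · exact ⟨fun h l hl => ncard_inter_word e A _ ▸ h _ l hl rfl,
      fun h _ l hl hw => by rw [hw, ncard_inter_word]; exact h l hl⟩

theorem ncard_isCremonaCenter
    (hC : ∀ w, w ∈ C ↔ ∃ n ∈ xorSpan lineBasis, evenOnFrame n ∧ w = word e (bits n)) :
    {c | IsCremonaCenter C c}.ncard = 1644 := by
  rw [← card_filter_powersetCard, ← Set.ncard_coe_finset,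
    ← Set.ncard_image_of_injective _ (word_injective e)]
  congr 1
  ext c
  obtain ⟨A, rfl⟩ := word_surjective e c
  simp [isCremonaCenter_word_iff hC, (word_injective e).mem_set_image]

end Words

/-! ### Coordinates on the projective plane over a field with four elements -/

/-- Addition in the field with four elements `0, 1, ω, ω + 1`, encoded by `0, 1, 2, 3`. -/
def addCode : Fin 4 → Fin 4 → Fin 4 :=
  ![![0, 1, 2, 3], ![1, 0, 3, 2], ![2, 3, 0, 1], ![3, 2, 1, 0]]

/-- Multiplication in the field with four elements `0, 1, ω, ω + 1`, encoded by `0, 1, 2, 3`. -/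
def mulCode : Fin 4 → Fin 4 → Fin 4 :=
  ![![0, 0, 0, 0], ![0, 1, 2, 3], ![0, 2, 3, 1], ![0, 3, 1, 2]]

/-- Normalized homogeneous coordinates of the 21 points, beginning with the standard frame. -/
def coord : Fin 21 → Fin 4 × Fin 4 × Fin 4 := ![
  (1, 0, 0), (0, 1, 0), (0, 0, 1), (1, 1, 1), (0, 1, 1), (0, 1, 2), (0, 1, 3), (1, 0, 1),
  (1, 0, 2), (1, 0, 3), (1, 1, 0), (1, 1, 2), (1, 1, 3), (1, 2, 0), (1, 2, 1), (1, 2, 2),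
  (1, 2, 3), (1, 3, 0), (1, 3, 1), (1, 3, 2), (1, 3, 3)]

/-- The standard bilinear form in encoded coordinates. -/
def dotCode (a c : Fin 4 × Fin 4 × Fin 4) : Fin 4 :=
  addCode (addCode (mulCode a.1 c.1) (mulCode a.2.1 c.2.1)) (mulCode a.2.2 c.2.2)

/-- Scalar multiplication in encoded coordinates. -/
def smulCode (t : Fin 4) (c : Fin 4 × Fin 4 × Fin 4) : Fin 4 × Fin 4 × Fin 4 :=
  (mulCode t c.1, mulCode t c.2.1, mulCode t c.2.2)

theorem exists_line_of_ne_zero : ∀ x y z : Fin 4, (x, y, z) ≠ (0, 0, 0) →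
    ∃ l ∈ evenLines ++ oddLines, ∀ i : Fin 21, l.testBit i = (dotCode (x, y, z) (coord i) == 0) := by
  decide +kernel

theorem exists_ne_zero_of_line : ∀ l ∈ evenLines ++ oddLines, ∃ x y z : Fin 4,
    (x, y, z) ≠ (0, 0, 0) ∧ ∀ i : Fin 21, l.testBit i = (dotCode (x, y, z) (coord i) == 0) := by
  decide +kernel

theorem coord_ne_zero : ∀ i, coord i ≠ (0, 0, 0) := by decide +kernel

theorem eq_of_coord_eq_smulCode : ∀ i j : Fin 21, ∀ t : Fin 4,
    coord i = smulCode t (coord j) → i = j := by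
  decide +kernel

theorem exists_smulCode_coord : ∀ x y z : Fin 4, (x, y, z) ≠ (0, 0, 0) →
    ∃ i : Fin 21, ∃ t : Fin 4, (x, y, z) = smulCode t (coord i) := by
  decide +kernel

section Plane

variable {F : Type*} [Field F]

theorem exists_fin_four_equiv [Fintype F] (hF : Fintype.card F = 4) :
    ∃ g : Fin 4 ≃ F, g 0 = 0 ∧ g 1 = 1 ∧ (∀ a b, g (addCode a b) = g a + g b) ∧
      ∀ a b, g (mulCode a b) = g a * g b := by
  classical
  have h₂ : (2 : F) = 0 := by
    have h : ((Fintype.card F : ℕ) : F) = 0 := Nat.cast_card_eq_zero F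
    rw [hF] at h
    have : (2 : F) * 2 = 0 := by push_cast at h; linear_combination h
    simpa using this
  obtain ⟨ω, hω⟩ : ∃ ω : F, ω ∉ ({0, 1} : Finset F) := by
    by_contra! h
    have := Finset.card_le_card (fun x _ => h x : (Finset.univ : Finset F) ⊆ {0, 1})
    rw [Finset.card_univ, hF] at this
    exact absurd (this.trans Finset.card_le_two) (by decide)
  simp only [Finset.mem_insert, Finset.mem_singleton, not_or] at hω
  have hω₂ : ω ^ 2 + ω + 1 = 0 := by
    have h : ω ^ 4 = ω := hF ▸ FiniteField.pow_card ω
    have h' : ω * (ω - 1) * (ω ^ 2 + ω + 1) = 0 := by linear_combination h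
    exact (mul_eq_zero.1 h').resolve_left (mul_ne_zero hω.1 (sub_ne_zero.2 hω.2))
  let g : Fin 4 → F := ![0, 1, ω, ω + 1]
  have hω₁ : ω + 1 ≠ 0 := fun h => hω.2 (by linear_combination h - h₂)
  have hg : Function.Injective g := by
    intro a b
    fin_cases a <;> fin_cases b <;> simp [g, hω.1, hω.2, hω₁, Ne.symm hω.1, Ne.symm hω.2,
      Ne.symm hω₁]
  have hbij : Function.Bijective g :=
    (Fintype.bijective_iff_injective_and_card g).2 ⟨hg, by simp [hF]⟩
  refine ⟨Equiv.ofBijective g hbij, rfl, rfl, fun a b => ?_, fun a b => ?_⟩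
  · change g (addCode a b) = g a + g b
    fin_cases a <;> fin_cases b <;> simp [g, addCode] <;> grind
  · change g (mulCode a b) = g a * g b
    fin_cases a <;> fin_cases b <;> simp [g, mulCode] <;> grind

theorem exists_basis_of_frame (Fs : Finset (Projectivization F (Fin 3 → F))) (hcard : Fs.card = 4)
    (hconf : ∀ T : Finset (Projectivization F (Fin 3 → F)),
      T ⊆ Fs → T.card = 3 → ¬ CollinSet F ↑T) :
    ∃ (p : Fin 4 → Projectivization F (Fin 3 → F)) (b : Module.Basis (Fin 3) F (Fin 3 → F)),
      (∀ P, P ∈ Fs ↔ ∃ j, P = p j) ∧ (∀ j : Fin 3, ∃ t : F, b j = t • (p j.castSucc).rep) ∧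
        ∑ j, b j = (p 3).rep := by
  classical
  let f := (Finset.equivFinOfCardEq hcard).symm
  let p : Fin 4 → Projectivization F (Fin 3 → F) := fun j => f j
  have hp : Function.Injective p := Subtype.val_injective.comp f.injective
  have hmem (P) : P ∈ Fs ↔ ∃ j, P = p j := by
    refine ⟨fun h => ⟨f.symm ⟨P, h⟩, by simp [p]⟩, ?_⟩
    rintro ⟨j, rfl⟩
    exact (f j).2
  have hne (i : Fin 4) (φ : (Fin 3 → F) →ₗ[F] F) (hφ : ∀ j ≠ i, φ (p j).rep = 0) : φ = 0 := by
    by_contra h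
    refine hconf ((Finset.univ.erase i).image p) ?_ ?_ ⟨_, ⟨φ, h, rfl⟩, ?_⟩
    · intro P hP
      obtain ⟨j, -, rfl⟩ := Finset.mem_image.1 hP
      exact (hmem _).2 ⟨j, rfl⟩
    · rw [Finset.card_image_of_injective _ hp]; simp
    · intro P hP
      obtain ⟨j, hj, rfl⟩ := Finset.mem_image.1 (Finset.mem_coe.1 hP)
      exact hφ j (Finset.ne_of_mem_erase hj)
  have hspan : ⊤ ≤ Submodule.span F (Set.range fun j : Fin 3 => (p j.castSucc).rep) := by
    by_contra h
    obtain ⟨φ, hφ, hle⟩ := Submodule.exists_le_ker_of_lt_top _ (lt_top_iff_ne_top.2 (h ∘ Eq.ge))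
    refine hφ (hne 3 φ fun j hj => ?_)
    obtain ⟨j, rfl⟩ := Fin.exists_castSucc_eq.2 hj
    exact hle (Submodule.subset_span ⟨j, rfl⟩)
  let v := basisOfTopLeSpanOfCardEqFinrank _ hspan (by simp)
  have hv (j) : v j = (p j.castSucc).rep := by simp [v]
  have hcoord (j : Fin 3) : v.coord j (p 3).rep ≠ 0 := fun h => by
    have hz : v.coord j = 0 := hne j.castSucc _ fun i hi => by
      rcases Fin.eq_castSucc_or_eq_last i with ⟨k, rfl⟩ | rfl
      · rw [← hv, v.coord_apply, v.repr_self, Finsupp.single_apply, if_neg]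
        exact fun hkj => hi (hkj ▸ rfl)
      · exact h
    have := congrArg (fun φ => φ (v j)) hz
    simp at this
  refine ⟨p, v.unitsSMul fun j => Units.mk0 _ (hcoord j), hmem, fun j => ⟨v.coord j (p 3).rep, ?_⟩,
    ?_⟩
  · rw [Module.Basis.unitsSMul_apply, hv]; rfl
  · simp only [Module.Basis.unitsSMul_apply]
    exact v.sum_repr (p 3).rep

theorem exists_labelling [Fintype F] (hF : Fintype.card F = 4)
    (Fs : Finset (Projectivization F (Fin 3 → F))) (hcard : Fs.card = 4)
    (hconf : ∀ T : Finset (Projectivization F (Fin 3 → F)),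
      T ⊆ Fs → T.card = 3 → ¬ CollinSet F ↑T) :
    ∃ e : Fin 21 ≃ Projectivization F (Fin 3 → F),
      (∀ P, P ∈ Fs ↔ ∃ j : Fin 4, P = e (j.castLE (by decide))) ∧
      ∀ L, IsProjLine F L ↔ ∃ l ∈ evenLines ++ oddLines, L = e '' bits l := by
  obtain ⟨g, hg₀, hg₁, hadd, hmul⟩ := exists_fin_four_equiv hF
  obtain ⟨p, b, hFs, hp, hp₃⟩ := exists_basis_of_frame Fs hcard hconf
  let V (c : Fin 4 × Fin 4 × Fin 4) : Fin 3 → F := g c.1 • b 0 + g c.2.1 • b 1 + g c.2.2 • b 2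
  have hV (x y z : F) (hxyz : x • b 0 + y • b 1 + z • b 2 = 0) : x = 0 ∧ y = 0 ∧ z = 0 := by
    have h := Fintype.linearIndependent_iff.1 b.linearIndependent ![x, y, z]
      (by simpa [Fin.sum_univ_three] using hxyz)
    exact ⟨h 0, h 1, h 2⟩
  have hV_inj : Function.Injective V := by
    rintro ⟨x, y, z⟩ ⟨x', y', z'⟩ h
    have h' := hV (g x - g x') (g y - g y') (g z - g z')
      (by simp only [V] at h; linear_combination (norm := module) h)
    simpa [sub_eq_zero] using h'
  have hV_zero : V (0, 0, 0) = 0 := by simp [V, hg₀]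
  have hV_smul (t c) : V (smulCode t c) = g t • V c := by
    simp only [V, smulCode, hmul, smul_add, mul_smul]
  have hV_surj (v : Fin 3 → F) : ∃ c, V c = v := by
    refine ⟨(g.symm (b.repr v 0), g.symm (b.repr v 1), g.symm (b.repr v 2)), ?_⟩
    have h := b.sum_repr v
    rw [Fin.sum_univ_three] at h
    simpa [V] using h
  have hV_ne (i) : V (coord i) ≠ 0 := fun h => coord_ne_zero i (hV_inj (h.trans hV_zero.symm))
  let P (i : Fin 21) := Projectivization.mk F (V (coord i)) (hV_ne i)
  have hP : Function.Bijective P := by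
    constructor
    · intro i j hij
      obtain ⟨t, ht⟩ := (Projectivization.mk_eq_mk_iff' F _ _ _ _).1 hij
      obtain ⟨s, rfl⟩ := g.surjective t
      rw [← hV_smul] at ht
      exact eq_of_coord_eq_smulCode i j s (hV_inj ht.symm)
    · intro Q
      obtain ⟨⟨x, y, z⟩, hc⟩ := hV_surj Q.rep
      obtain ⟨i, t, hit⟩ := exists_smulCode_coord x y z fun h =>
        Q.rep_nonzero (by rw [← hc, h, hV_zero])
      refine ⟨i, ?_⟩
      rw [← Q.mk_rep, eq_comm, Projectivization.mk_eq_mk_iff']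
      exact ⟨g t, by rw [← hc, hit, hV_smul]⟩
  have hφ (φ : (Fin 3 → F) →ₗ[F] F) (i : Fin 21) : φ (P i).rep = 0 ↔ φ (V (coord i)) = 0 := by
    obtain ⟨t, ht⟩ := Projectivization.exists_smul_eq_mk_rep F _ (hV_ne i)
    rw [← ht, Units.smul_def, map_smul, smul_eq_zero, or_iff_right t.ne_zero]
  have hdot (φ : (Fin 3 → F) →ₗ[F] F) (x y z : Fin 4) (hx : φ (b 0) = g x) (hy : φ (b 1) = g y)
      (hz : φ (b 2) = g z) (l : ℕ)
      (hl : ∀ i : Fin 21, l.testBit i = (dotCode (x, y, z) (coord i) == 0)) :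
      {Q | φ Q.rep = 0} = Equiv.ofBijective P hP '' bits l := by
    ext Q
    obtain ⟨i, rfl⟩ := (Equiv.ofBijective P hP).surjective Q
    rw [(Equiv.injective _).mem_set_image, Finset.mem_coe, mem_bits, hl, beq_iff_eq,
      ← g.injective.eq_iff, hg₀]
    refine (hφ φ i).trans ?_
    simp only [V, dotCode, map_add, map_smul, hx, hy, hz, hadd, hmul, smul_eq_mul]
    rw [mul_comm (g x), mul_comm (g y), mul_comm (g z)]
  refine ⟨Equiv.ofBijective P hP, fun Q => ?_, fun L => ⟨?_, ?_⟩⟩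
  · have hPp : ∀ j : Fin 4, p j = P (j.castLE (by decide)) := by
      intro j
      rw [← (p j).mk_rep, eq_comm, Projectivization.mk_eq_mk_iff']
      rcases Fin.eq_castSucc_or_eq_last j with ⟨k, rfl⟩ | rfl
      · obtain ⟨t, ht⟩ := hp k
        refine ⟨t, ht.symm.trans ?_⟩
        fin_cases k <;> simp [V, coord, hg₀, hg₁]
      · refine ⟨1, ?_⟩
        rw [one_smul]
        refine hp₃.symm.trans ?_
        simp [V, coord, hg₁, Fin.sum_univ_three]
    simp only [hFs, hPp]; rfl
  · rintro ⟨φ, hne, rfl⟩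
    obtain ⟨l, hl, hbits⟩ := exists_line_of_ne_zero (g.symm (φ (b 0))) (g.symm (φ (b 1)))
      (g.symm (φ (b 2))) fun h => hne (b.ext fun j => by
        simp only [Prod.mk.injEq, Equiv.symm_apply_eq, hg₀] at h
        fin_cases j
        exacts [h.1, h.2.1, h.2.2])
    exact ⟨l, hl, hdot φ _ _ _ (by simp) (by simp) (by simp) l hbits⟩
  · rintro ⟨l, hl, rfl⟩
    obtain ⟨x, y, z, hne, hbits⟩ := exists_ne_zero_of_line l hl
    let φ := b.constr F ![g x, g y, g z]
    have hφb (j) : φ (b j) = ![g x, g y, g z] j := b.constr_basis F _ j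
    refine ⟨φ, fun h => hne ?_, (hdot φ x y z (hφb 0) (hφb 1) (hφb 2) l hbits).symm⟩
    have hzero (j) : ![g x, g y, g z] j = 0 := by rw [← hφb, h]; rfl
    have h₀ := hzero 0
    have h₁ := hzero 1
    have h₂ := hzero 2
    simp only [← hg₀] at h₀ h₁ h₂
    rw [g.injective h₀, g.injective h₁, g.injective h₂]

end Plane

/-- for a four-point subset `F ⊆ P²(F₄)` with no three points collinear,
there are exactly 1644 words of weight 6 that are centers of Cremona transformation with
respect to the code `C_F`. -/
theorem count_centers_A (F : Type*) [Field F] [Fintype F] (hF : Fintype.card F = 4)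
    (Fs : Finset (Projectivization F (Fin 3 → F))) (hcard : Fs.card = 4)
    (hconf : ∀ T : Finset (Projectivization F (Fin 3 → F)),
      T ⊆ Fs → T.card = 3 → ¬ CollinSet F ↑T) :
    {c : Projectivization F (Fin 3 → F) → ZMod 2 | IsCremonaCenter (CF F Fs) c}.ncard
      = 1644 := by
  classical
  obtain ⟨e, hFs, hlines⟩ := exists_labelling hF Fs hcard hconf
  refine ncard_isCremonaCenter (e := e) fun w => ?_
  have hindicator (l : ℕ) :
      Set.indicator (e '' bits l) (fun _ => (1 : ZMod 2)) = word e (bits l) := by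
    funext s
    simp [word, Set.indicator_apply, Equiv.image_eq_preimage_symm]
  have hgen : {w | ∃ L, IsProjLine F L ∧ w = Set.indicator L (fun _ => (1 : ZMod 2))} =
      {w | ∃ l ∈ evenLines ++ oddLines, w = word e (bits l)} := by
    ext w
    constructor
    · rintro ⟨L, hL, rfl⟩
      obtain ⟨l, hl, rfl⟩ := (hlines L).1 hL
      exact ⟨l, hl, hindicator l⟩
    · rintro ⟨l, hl, rfl⟩
      exact ⟨_, (hlines _).2 ⟨l, hl, rfl⟩, (hindicator l).symm⟩
  have hCDK : CDK F = Submodule.span (ZMod 2) {w | ∃ l ∈ lineBasis, w = word e (bits l)} := by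
    rw [CDK, hgen]
    refine le_antisymm (Submodule.span_le.2 ?_) (Submodule.span_mono ?_)
    · rintro _ ⟨l, hl, rfl⟩
      exact (mem_span_word_iff e _ _).2 ⟨l, lines_subset_xorSpan l hl, rfl⟩
    · rintro _ ⟨l, hl, rfl⟩
      exact ⟨l, lineBasis_subset l hl, rfl⟩
  have hFs' : Fs = (Finset.univ : Finset (Fin 4)).image fun j => e (j.castLE (by decide)) := by
    ext P
    simp [hFs, eq_comm]
  rw [CF, hCDK, Submodule.mem_inf, mem_span_word_iff, hFs']
  simp only [LinearMap.mem_ker, LinearMap.sum_apply, LinearMap.proj_apply]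
  constructor
  · rintro ⟨⟨n, hn, rfl⟩, h⟩
    exact ⟨n, hn, (sum_frame_word_eq_zero_iff e n).1 h, rfl⟩
  · rintro ⟨n, hn, heven, rfl⟩
    exact ⟨⟨n, hn, rfl⟩, (sum_frame_word_eq_zero_iff e n).2 heven⟩
end
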